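/- Sharp Marchaud and sharp Jackson-type inequalities between mixed moduli of different orders: let f ∈ L_p^0(T²), 1<p<∞, τ=max(2,p), θ=min(2,p), 0<α₁<β₁, 0<α₂<β₂, δ₁,δ₂ ∈ (0,1/2). Then δ₁^{α₁} δ₂^{α₂} {∫_{δ₁}¹∫_{δ₂}¹ [t₁^{−α₁} t₂^{−α₂} ω_{β₁,β₂}(f,t₁,t₂)_p]^τ (dt₁/t₁)(dt₂/t₂)}^{1/τ} ≲ ω_{α₁,α₂}(f,δ₁,δ₂)_p ≲ δ₁^{α₁} δ₂^{α₂} {∫_{δ₁}¹∫_{δ₂}¹ [t₁^{−α₁} t₂^{−α₂} ω_{β₁,β₂}(f,t₁,t₂)_p]^θ (dt₁/t₁)(dt₂/t₂)}^{1/θ}. -/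

import Mathlib

open MeasureTheory Real
open scoped ENNReal

noncomputable section

/-- The `L_p` norm of a function of two variables over the period square `(0,2π]²`. -/
def Lp2Norm (p : ℝ) (f : ℝ → ℝ → ℝ) : ℝ≥0∞ :=
  (∫⁻ x in Set.Ioc (0:ℝ) (2*π), ∫⁻ y in Set.Ioc (0:ℝ) (2*π),
      ENNReal.ofReal (|f x y| ^ p)) ^ (1/p)

/-- `f ∈ L_p^0(T²)`: measurable, `2π`-periodic in each variable, finite `L_p` norm,
and zero mean in each variable separately. -/
structure MemLp0 (p : ℝ) (f : ℝ → ℝ → ℝ) : Prop where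
  meas : Measurable (Function.uncurry f)
  periodic_x : ∀ y, Function.Periodic (fun x => f x y) (2*π)
  periodic_y : ∀ x, Function.Periodic (f x) (2*π)
  norm_ne_top : Lp2Norm p f ≠ ⊤
  mean_x : ∀ᵐ (y : ℝ) ∂volume, (∫ x in (0:ℝ)..(2*π), f x y) = 0
  mean_y : ∀ᵐ (x : ℝ) ∂volume, (∫ y in (0:ℝ)..(2*π), f x y) = 0

/-- Generalized (fractional) binomial coefficient `C(α,ν) = α(α-1)⋯(α-ν+1)/ν!`. -/
def fracBinom (α : ℝ) : ℕ → ℝ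
  | 0 => 1
  | n+1 => fracBinom α n * (α - (n : ℝ)) / ((n : ℝ) + 1)

/-- Fractional difference of order `α` with step `h` in the first variable. -/
def diffX (α h : ℝ) (f : ℝ → ℝ → ℝ) : ℝ → ℝ → ℝ :=
  fun x y => ∑' ν : ℕ, (-1 : ℝ) ^ ν * fracBinom α ν * f (x + (α - (ν : ℝ)) * h) y

/-- Fractional difference of order `α` with step `h` in the second variable. -/
def diffY (α h : ℝ) (f : ℝ → ℝ → ℝ) : ℝ → ℝ → ℝ :=
  fun x y => ∑' ν : ℕ, (-1 : ℝ) ^ ν * fracBinom α ν * f x (y + (α - (ν : ℝ)) * h)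

/-- The mixed (fractional) modulus of smoothness `ω_{α₁,α₂}(f, δ₁, δ₂)_p`. -/
def mixedMod (p α₁ α₂ δ₁ δ₂ : ℝ) (f : ℝ → ℝ → ℝ) : ℝ≥0∞ :=
  ⨆ (h₁ : ℝ) (_ : |h₁| ≤ δ₁) (h₂ : ℝ) (_ : |h₂| ≤ δ₂),
    Lp2Norm p (diffX α₁ h₁ (diffY α₂ h₂ f))

/-- `δ₁^{α₁} δ₂^{α₂} {∫_{δ₁}^1 ∫_{δ₂}^1 [t₁^{-α₁} t₂^{-α₂} ω_{β₁,β₂}(f,t₁,t₂)_p]^s (dt₁/t₁)(dt₂/t₂)}^{1/s}`. -/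
def marchaudInt (p α₁ α₂ β₁ β₂ δ₁ δ₂ s : ℝ) (f : ℝ → ℝ → ℝ) : ℝ≥0∞ :=
  ENNReal.ofReal (δ₁ ^ α₁ * δ₂ ^ α₂) *
    (∫⁻ t₁ in Set.Ioo δ₁ 1, ∫⁻ t₂ in Set.Ioo δ₂ 1,
      ENNReal.ofReal ((t₁ ^ (-α₁) * t₂ ^ (-α₂)) ^ s / (t₁ * t₂)) *
        mixedMod p β₁ β₂ t₁ t₂ f ^ s) ^ (1/s)

open scoped NNReal

/-- Signed binomial coefficient `(-1)^ν C(α,ν)`. -/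
def sgnBinom (α : ℝ) (ν : ℕ) : ℝ := (-1) ^ ν * fracBinom α ν

lemma sgnBinom_zero (α : ℝ) : sgnBinom α 0 = 1 := by simp [sgnBinom, fracBinom]

lemma sgnBinom_succ (α : ℝ) (ν : ℕ) :
    sgnBinom α (ν + 1) = sgnBinom α ν * ((ν - α) / (ν + 1)) := by
  simp only [sgnBinom, fracBinom, pow_succ]
  ring

lemma fracBinom_eq_choose (α : ℝ) (ν : ℕ) : fracBinom α ν = Ring.choose α ν := by
  rw [Ring.choose_eq_smul]
  induction ν with
  | zero => simp [fracBinom]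
  | succ n ih =>
    rw [fracBinom, ih, descPochhammer_succ_right, Polynomial.smeval_mul]
    have : (n.factorial : ℝ) ≠ 0 := by positivity
    simp only [Polynomial.smeval_sub, Polynomial.smeval_X, Polynomial.smeval_natCast, Nat.factorial_succ]
    push_cast
    simp only [smul_eq_mul, pow_one, pow_zero, nsmul_eq_mul, mul_one]
    have h2 : ((n:ℝ) + 1) ≠ 0 := by positivity
    field_simp

lemma hasSum_sgnBinom_of_lt (α : ℝ) {w : ℂ} (hw : ‖w‖ < 1) :
    HasSum (fun ν => (sgnBinom α ν : ℂ) * w ^ ν) ((1 - w) ^ (α : ℂ)) := by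
  have h := (Complex.one_add_cpow_hasFPowerSeriesOnBall_zero (a := (α:ℂ))).hasSum (y := -w)
    (by simpa [Metric.mem_eball, edist_zero_right, ← ofReal_norm] using hw)
  simp only [binomialSeries_apply] at h
  rw [zero_add, ← sub_eq_add_neg] at h
  refine h.congr_fun ?_ |> fun h => h
  intro n
  simp [sgnBinom, fracBinom_eq_choose, neg_pow w n]
  rw [Complex.ofReal_choose]; ring

lemma summable_abs_sgnBinom {α : ℝ} (hα : 0 < α) : Summable (fun ν => |sgnBinom α ν|) := by
  obtain ⟨n, hn⟩ := exists_nat_ge α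
  rw [← summable_nat_add_iff n]
  have key : ∀ k : ℕ, α * |sgnBinom α (k + n)| =
      (k + n : ℕ) * |sgnBinom α (k + n)| - ((k + 1 + n : ℕ)) * |sgnBinom α (k + 1 + n)| := by
    intro k
    have h1 : (0:ℝ) ≤ ((k + n : ℕ) : ℝ) - α := by push_cast; linarith [(Nat.cast_nonneg k : (0:ℝ) ≤ k)]
    have h2 : (0:ℝ) < ((k + n : ℕ) : ℝ) + 1 := by positivity
    rw [show k + 1 + n = (k + n) + 1 by ring, sgnBinom_succ, abs_mul,
      abs_of_nonneg (div_nonneg h1 h2.le)]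
    push_cast at h2 ⊢
    field_simp
    ring
  refine summable_of_sum_range_le (c := ((n : ℕ) * |sgnBinom α n|) / α) (fun _ => abs_nonneg _) ?_
  intro m
  rw [le_div_iff₀ hα, mul_comm, Finset.mul_sum, Finset.sum_congr rfl (fun k _ => key k),
    Finset.sum_range_sub' (fun k => ((k + n : ℕ) : ℝ) * |sgnBinom α (k + n)|)]
  simp only [zero_add, sub_le_self_iff]
  positivity

lemma cpow_ofReal_continuousAt {α : ℝ} (hα : 0 < α) {w : ℂ} (hw : 0 ≤ w.re) :
    ContinuousWithinAt (fun w : ℂ => w ^ (α : ℂ)) {w | 0 ≤ w.re} w := by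
  by_cases h0 : w = 0
  · subst h0
    exact (Complex.continuousAt_cpow_const_of_re_pos (z := 0) (w := (α:ℂ))
      (Or.inl (by simp)) (by simpa using hα)).continuousWithinAt
  · refine (continuousAt_cpow_const ?_).continuousWithinAt
    rw [Complex.mem_slitPlane_iff]
    by_contra hc
    push Not at hc
    exact h0 (Complex.ext (le_antisymm hc.1 hw) hc.2)

lemma hasSum_sgnBinom {α : ℝ} (hα : 0 < α) {w : ℂ} (hw : ‖w‖ ≤ 1) :
    HasSum (fun ν => (sgnBinom α ν : ℂ) * w ^ ν) ((1 - w) ^ (α : ℂ)) := by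
  have hs := summable_abs_sgnBinom hα
  have hb : ∀ (n : ℕ) (r : ℂ), r ∈ Metric.closedBall (0:ℂ) 1 →
      ‖(sgnBinom α n : ℂ) * r ^ n‖ ≤ |sgnBinom α n| := by
    intro n r hr
    rw [norm_mul, norm_pow, Complex.norm_real, Real.norm_eq_abs]
    exact mul_le_of_le_one_right (abs_nonneg _)
      (pow_le_one₀ (norm_nonneg _) (by simpa using hr))
  have hcont : ContinuousOn (fun r : ℂ => ∑' n, (sgnBinom α n : ℂ) * r ^ n)
      (Metric.closedBall 0 1) :=
    continuousOn_tsum (fun n => by fun_prop) hs hb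
  have hsum : Summable (fun ν => (sgnBinom α ν : ℂ) * w ^ ν) :=
    Summable.of_norm_bounded hs (fun n => hb n w (by simpa using hw))
  rw [hsum.hasSum_iff]
  have hmem : ∀ t : ℝ, t ∈ Set.Ioo (0:ℝ) 1 → ‖(t:ℂ) * w‖ < 1 := by
    intro t ht
    rw [norm_mul, Complex.norm_real, Real.norm_eq_abs, abs_of_pos ht.1]
    nlinarith [ht.1, ht.2, norm_nonneg w]
  have htend : Filter.Tendsto (fun t : ℝ => (t:ℂ) * w) (nhdsWithin 1 (Set.Ioo 0 1)) (nhds w) := by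
    have : Filter.Tendsto (fun t : ℝ => (t:ℂ) * w) (nhds 1) (nhds (((1:ℝ):ℂ) * w)) :=
      Continuous.tendsto (by fun_prop) 1
    simpa using this.mono_left nhdsWithin_le_nhds
  have hev : ∀ᶠ t : ℝ in nhdsWithin 1 (Set.Ioo 0 1), t ∈ Set.Ioo (0:ℝ) 1 :=
    self_mem_nhdsWithin
  have l1 : Filter.Tendsto (fun t : ℝ => ∑' n, (sgnBinom α n : ℂ) * ((t:ℂ) * w) ^ n)
      (nhdsWithin 1 (Set.Ioo 0 1)) (nhds (∑' n, (sgnBinom α n : ℂ) * w ^ n)) := by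
    refine (hcont w (by simpa using hw)).tendsto.comp ?_
    exact tendsto_nhdsWithin_iff.2 ⟨htend, hev.mono fun t ht => by
      simpa using (hmem t ht).le⟩
  have l2 : Filter.Tendsto (fun t : ℝ => (1 - (t:ℂ) * w) ^ (α:ℂ))
      (nhdsWithin 1 (Set.Ioo 0 1)) (nhds ((1 - w) ^ (α : ℂ))) := by
    have hre : ∀ v : ℂ, ‖v‖ ≤ 1 → 0 ≤ (1 - v).re := by
      intro v hv
      have := (Complex.re_le_norm v).trans hv
      simpa using this
    refine (cpow_ofReal_continuousAt hα (hre w hw)).tendsto.comp ?_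
    exact tendsto_nhdsWithin_iff.2 ⟨htend.const_sub 1, hev.mono fun t ht => hre _ (hmem t ht).le⟩
  have : (nhdsWithin (1:ℝ) (Set.Ioo 0 1)).NeBot := by
    rw [nhdsWithin_Ioo_eq_nhdsLT (by norm_num)]; infer_instance
  refine tendsto_nhds_unique l1 (l2.congr' (hev.mono fun t ht => ?_))
  exact (hasSum_sgnBinom_of_lt α (hmem t ht)).tsum_eq.symm

lemma mul_cpow_of_arg {a b : ℂ} (ha : a ≠ 0) (hb : b ≠ 0)
    (h : a.arg + b.arg ∈ Set.Ioc (-π) π) (r : ℂ) : (a * b) ^ r = a ^ r * b ^ r := by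
  rw [Complex.cpow_def_of_ne_zero (mul_ne_zero ha hb), Complex.cpow_def_of_ne_zero ha,
    Complex.cpow_def_of_ne_zero hb, Complex.log_mul ha hb h, add_mul, Complex.exp_add]

lemma mul_cpow_of_re {a b : ℂ} (ha : 0 ≤ a.re) (hb : 0 < b.re) {r : ℂ} (hr : r ≠ 0) :
    (a * b) ^ r = a ^ r * b ^ r := by
  by_cases h0 : a = 0
  · simp [h0, hr]
  have hb0 : b ≠ 0 := fun h => by simp [h] at hb
  refine mul_cpow_of_arg h0 hb0 ?_ r
  have h1 := abs_le.1 (Complex.abs_arg_le_pi_div_two_iff.2 ha)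
  have h2 := abs_lt.1 (Complex.abs_arg_lt_pi_div_two_iff.2 (Or.inl hb))
  constructor <;> linarith [h1.1, h1.2, h2.1, h2.2]

/-- One doubling step: `(2(1-s)/(2-s))^α = 2^α (2-s)^(-α) (1-s)^α`. -/
lemma doubling_cpow {α : ℝ} (hα : 0 < α) {s s' : ℂ} (hs : ‖s‖ ≤ 1)
    (h : (1 - s') * (2 - s) = 2 * (1 - s)) (hs' : ‖s'‖ ≤ 1) :
    ((2 ^ (-α) : ℝ) : ℂ) * (1 - s') ^ (α : ℂ) = (2 - s) ^ (-(α:ℂ)) * (1 - s) ^ (α : ℂ) := by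
  have hr : (α:ℂ) ≠ 0 := by exact_mod_cast hα.ne'
  have hre := (Complex.re_le_norm s).trans hs
  have hre' := (Complex.re_le_norm s').trans hs'
  have h2 : (0:ℝ) < (2 - s).re := by simp; linarith
  have h20 : (2 - s) ≠ 0 := fun h => by rw [h] at h2; simp at h2
  have e := mul_cpow_of_re (a := 1 - s') (b := 2 - s) (by simpa using hre') h2 hr
  have e2 := mul_cpow_of_re (a := 1 - s) (b := 2) (by simpa using hre) (by norm_num) hr
  rw [h, mul_comm 2 (1 - s), e2] at e
  have h3 : (2 - s) ^ (α:ℂ) ≠ 0 := by simp [Complex.cpow_eq_zero_iff, h20]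
  have h4 : (2:ℂ) ^ (α:ℂ) ≠ 0 := by simp [Complex.cpow_eq_zero_iff]
  rw [Complex.ofReal_cpow (by norm_num), Complex.cpow_neg]
  push_cast
  rw [Complex.cpow_neg]
  field_simp
  linear_combination -e

/-- Taylor coefficients of `(2 - s) ^ (-α)`. -/
def vCoef (α : ℝ) (k : ℕ) : ℝ := 2 ^ (-α) * (sgnBinom (-α) k * 2⁻¹ ^ k)

lemma vCoef_pos {α : ℝ} (hα : 0 < α) (k : ℕ) : 0 < vCoef α k := by
  have : 0 < sgnBinom (-α) k := by
    induction k with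
    | zero => simp [sgnBinom_zero]
    | succ n ih => rw [sgnBinom_succ]; have : 0 < (n:ℝ) - -α := by rw [sub_neg_eq_add]; positivity
                   positivity
  unfold vCoef; positivity

lemma hasSum_vCoef (α : ℝ) {s : ℂ} (hs : ‖s‖ ≤ 1) :
    HasSum (fun k => (vCoef α k : ℂ) * s ^ k) ((2 - s) ^ (-(α : ℂ))) := by
  have h := (hasSum_sgnBinom_of_lt (-α) (w := s / 2) (by
    rw [norm_div]; norm_num; linarith)).mul_left ((2:ℂ) ^ (-(α:ℂ)))
  have e : (2:ℂ) ^ (-(α:ℂ)) * (1 - s / 2) ^ ((-α : ℝ) : ℂ) = (2 - s) ^ (-(α:ℂ)) := by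
    rw [show (2 - s) = ((2:ℝ):ℂ) * (1 - s/2) by push_cast; ring]
    have h1 : (1 - s / 2 : ℂ) ≠ 0 := by
      intro h0
      have : s = 2 := by linear_combination (-2) * h0
      rw [this] at hs
      norm_num at hs
    rw [mul_cpow_of_arg (by norm_num) h1]
    · push_cast; rfl
    · rw [Complex.arg_ofReal_of_nonneg (by norm_num), zero_add]
      exact Complex.arg_mem_Ioc _
  rw [e] at h
  refine h.congr_fun ?_ |> fun h => h
  intro k
  simp only [vCoef]
  push_cast
  rw [Complex.ofReal_cpow (by norm_num), div_pow]
  push_cast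
  rw [inv_pow]
  ring

lemma hasSum_vCoef_one (α : ℝ) : HasSum (vCoef α) 1 := by
  have := hasSum_vCoef α (s := 1) (by simp)
  norm_num at this
  exact Complex.hasSum_ofReal.1 (by simpa using this)

lemma summable_sq_mul_vCoef {α : ℝ} (hα : 0 < α) :
    Summable (fun k : ℕ => ((k:ℝ) + 1) ^ 2 * vCoef α k) := by
  have hrec : ∀ k, vCoef α (k+1) = vCoef α k * ((k + α) / (2 * (k + 1))) := by
    intro k
    simp only [vCoef, sgnBinom_succ, pow_succ]
    field_simp
    ring
  refine summable_of_ratio_test_tendsto_lt_one (l := 1/2) (by norm_num)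
    (Filter.Eventually.of_forall fun k => ne_of_gt (mul_pos (by positivity) (vCoef_pos hα k))) ?_
  have e : (fun n : ℕ => ‖(((n + 1 : ℕ):ℝ) + 1) ^ 2 * vCoef α (n+1)‖ / ‖((n:ℝ) + 1) ^ 2 * vCoef α n‖)
      = fun n : ℕ => (1 + 1 / ((n:ℝ) + 1)) ^ 2 * (1/2 + (α - 1) / 2 * (1 / ((n:ℝ) + 1))) := by
    funext n
    have h1 := vCoef_pos hα n
    have h2 := vCoef_pos hα (n+1)
    rw [Real.norm_of_nonneg (by positivity), Real.norm_of_nonneg (by positivity), hrec]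
    push_cast
    field_simp
    ring
  rw [e]
  have h0 := tendsto_one_div_add_atTop_nhds_zero_nat (𝕜 := ℝ)
  have := ((h0.const_add 1).pow 2).mul ((h0.const_mul ((α-1)/2)).const_add (1/2))
  simpa using this

section Multipliers

variable {ι : Type*} {N : Seminorm ℂ (ι →₀ ℂ)} {m m' : ι → ℂ} {C C' : ℝ}

/-- The multiplier `m` is bounded with constant `C` for the seminorm `N` on trigonometric
polynomials (finitely supported coefficient sequences). -/
def IsMult (N : Seminorm ℂ (ι →₀ ℂ)) (m : ι → ℂ) (C : ℝ) : Prop :=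
  0 ≤ C ∧ ∀ c, N (m • c) ≤ C * N c

lemma pmul_add (m m' : ι → ℂ) (c : ι →₀ ℂ) : (m + m') • c = m • c + m' • c := by
  ext; simp; ring

lemma pmul_mul (m m' : ι → ℂ) (c : ι →₀ ℂ) : (m * m') • c = m • m' • c := by
  ext; simp; ring

lemma pmul_smul (a : ℂ) (m : ι → ℂ) (c : ι →₀ ℂ) : (a • m) • c = a • (m • c) := by
  ext; simp

lemma pmul_one (c : ι →₀ ℂ) : (1 : ι → ℂ) • c = c := by
  ext; simp

lemma pmul_comm (m m' : ι → ℂ) (c : ι →₀ ℂ) : m • m' • c = m' • m • c := by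
  ext; simp; ring

lemma IsMult.mono (h : IsMult N m C) (hC : C ≤ C') : IsMult N m C' :=
  ⟨h.1.trans hC, fun c => (h.2 c).trans (mul_le_mul_of_nonneg_right hC (apply_nonneg N c))⟩

lemma isMult_one : IsMult N (1 : ι → ℂ) 1 := by
  refine ⟨zero_le_one, fun c => ?_⟩
  rw [pmul_one, one_mul]

lemma IsMult.add (h : IsMult N m C) (h' : IsMult N m' C') : IsMult N (m + m') (C + C') := by
  refine ⟨add_nonneg h.1 h'.1, fun c => ?_⟩
  rw [pmul_add, add_mul]
  exact (map_add_le_add N _ _).trans (add_le_add (h.2 c) (h'.2 c))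

lemma IsMult.smul (a : ℂ) (h : IsMult N m C) : IsMult N (a • m) (‖a‖ * C) := by
  refine ⟨mul_nonneg (norm_nonneg _) h.1, fun c => ?_⟩
  rw [pmul_smul, map_smul_eq_mul, mul_assoc]
  exact mul_le_mul_of_nonneg_left (h.2 c) (norm_nonneg _)

lemma IsMult.neg (h : IsMult N m C) : IsMult N (-m) C := by
  simpa using h.smul (-1)

lemma IsMult.sub (h : IsMult N m C) (h' : IsMult N m' C') : IsMult N (m - m') (C + C') := by
  simpa [sub_eq_add_neg] using h.add h'.neg

lemma IsMult.mul (h : IsMult N m C) (h' : IsMult N m' C') : IsMult N (m * m') (C * C') := by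
  refine ⟨mul_nonneg h.1 h'.1, fun c => ?_⟩
  rw [pmul_mul, mul_assoc]
  exact (h.2 _).trans (mul_le_mul_of_nonneg_left (h'.2 c) h.1)

lemma IsMult.pow (h : IsMult N m C) (n : ℕ) : IsMult N (m ^ n) (C ^ n) := by
  induction n with
  | zero => simpa using isMult_one
  | succ n ih => rw [pow_succ, pow_succ]; exact ih.mul h

lemma isMult_zero : IsMult N (0 : ι → ℂ) 0 := by
  refine ⟨le_rfl, fun c => ?_⟩
  have : (0 : ι → ℂ) • c = 0 := by ext; simp
  simp [this]

lemma seminorm_sum_le {κ : Type*} (N : Seminorm ℂ (ι →₀ ℂ)) (s : Finset κ) (u : κ → ι →₀ ℂ) :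
    N (∑ k ∈ s, u k) ≤ ∑ k ∈ s, N (u k) :=
  Finset.le_sum_of_subadditive N (map_zero N).le (map_add_le_add N) s u

lemma IsMult.sum {κ : Type*} (s : Finset κ) {m : κ → ι → ℂ} {C : κ → ℝ}
    (h : ∀ k ∈ s, IsMult N (m k) (C k)) : IsMult N (∑ k ∈ s, m k) (∑ k ∈ s, C k) := by
  classical
  induction s using Finset.induction_on with
  | empty => simpa using isMult_zero
  | insert a s ha ih =>
    rw [Finset.sum_insert ha, Finset.sum_insert ha]
    exact (h a (by simp)).add (ih fun k hk => h k (by simp [hk]))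

lemma IsMult.congr (h : IsMult N m C) (e : ∀ i, m' i = m i) : IsMult N m' C := by
  have : m' = m := funext e
  rwa [this]

lemma tendsto_seminorm {κ : Type*} {l : Filter κ} (N : Seminorm ℂ (ι →₀ ℂ)) {u : κ → ι → ℂ}
    {m : ι → ℂ} (h : ∀ i, Filter.Tendsto (fun k => u k i) l (nhds (m i))) (c : ι →₀ ℂ) :
    Filter.Tendsto (fun k => N (u k • c)) l (nhds (N (m • c))) := by
  rw [tendsto_iff_norm_sub_tendsto_zero]
  have hb : ∀ k, ‖N (u k • c) - N (m • c)‖ ≤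
      ∑ i ∈ c.support, ‖u k i - m i‖ * (‖c i‖ * N (Finsupp.single i 1)) := by
    intro k
    have h1 : ‖N (u k • c) - N (m • c)‖ ≤ N (u k • c - m • c) := abs_sub_map_le_sub N _ _
    have h2 : u k • c - m • c = ∑ i ∈ c.support, ((u k i - m i) * c i) • Finsupp.single i (1:ℂ) := by
      classical
      ext j
      simp only [Finsupp.coe_sub, Finsupp.coe_pointwise_smul, Pi.sub_apply,
        smul_eq_mul, Finsupp.finsetSum_apply, Finsupp.smul_apply, Finsupp.single_apply]
      simp only [mul_ite, mul_one, mul_zero, Finset.sum_ite_eq', Finsupp.mem_support_iff, ne_eq, ite_not]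
      split_ifs with hj
      · simp [hj]
      · simp; ring
    rw [h2] at h1
    refine h1.trans ((seminorm_sum_le N _ _).trans (Finset.sum_le_sum fun i _ => ?_))
    rw [map_smul_eq_mul, norm_mul, mul_assoc]
  refine squeeze_zero (fun _ => norm_nonneg _) hb ?_
  have : Filter.Tendsto (fun k => ∑ i ∈ c.support, ‖u k i - m i‖ * (‖c i‖ * N (Finsupp.single i 1)))
      l (nhds (∑ i ∈ c.support, 0 * (‖c i‖ * N (Finsupp.single i 1)))) := by
    refine tendsto_finsetSum _ fun i _ => Filter.Tendsto.mul_const _ ?_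
    exact tendsto_iff_norm_sub_tendsto_zero.1 (h i)
  simpa using this

/-- Triangle inequality for series of multipliers. -/
lemma seminorm_le_tsum {u : ℕ → ι → ℂ} (h : ∀ i, HasSum (fun k => u k i) (m i)) (c : ι →₀ ℂ)
    (hs : Summable fun k => N (u k • c)) : N (m • c) ≤ ∑' k, N (u k • c) := by
  have ht := tendsto_seminorm N (u := fun n => ∑ k ∈ Finset.range n, u k) (m := m)
    (l := Filter.atTop) (fun i => by
      simpa [Finset.sum_apply] using (h i).tendsto_sum_nat) c
  refine le_of_tendsto ht (Filter.Eventually.of_forall fun n => ?_)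
  have : (∑ k ∈ Finset.range n, u k) • c = ∑ k ∈ Finset.range n, u k • c := by
    ext i; simp [Finset.sum_apply, Finset.sum_mul, Finsupp.finsetSum_apply]
  rw [this]
  exact (seminorm_sum_le N _ _).trans (hs.sum_le_tsum _ fun _ _ => apply_nonneg N _)

lemma IsMult.of_hasSum {u : ℕ → ι → ℂ} {C : ℕ → ℝ} {S : ℝ} (hu : ∀ k, IsMult N (u k) (C k))
    (hC : HasSum C S) (h : ∀ i, HasSum (fun k => u k i) (m i)) : IsMult N m S := by
  refine ⟨hC.nonneg fun k => (hu k).1, fun c => ?_⟩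
  have hs : Summable fun k => N (u k • c) :=
    Summable.of_nonneg_of_le (fun _ => apply_nonneg N _) (fun k => (hu k).2 c)
      (hC.summable.mul_right _)
  refine (seminorm_le_tsum h c hs).trans ?_
  rw [← hC.tsum_eq, ← tsum_mul_right]
  exact hs.tsum_le_tsum (fun k => (hu k).2 c) (hC.summable.mul_right _)

/-- Power series with absolutely summable coefficients, evaluated at a contraction. -/
lemma IsMult.powerSeries {z : ι → ℂ} (hz : IsMult N z 1) {a : ℕ → ℝ} {S : ℝ}
    (ha : HasSum (fun k => |a k|) S) (h : ∀ i, HasSum (fun k => (a k : ℂ) * z i ^ k) (m i)) :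
    IsMult N m S := by
  refine IsMult.of_hasSum (u := fun k => (a k : ℂ) • z ^ k) (fun k => ?_) ha (by simpa using h)
  have := (hz.pow k).smul (a k : ℂ)
  simpa using this

lemma IsMult.cpow_one_sub {z : ι → ℂ} (hz : IsMult N z 1) (hz1 : ∀ i, ‖z i‖ ≤ 1) {α : ℝ}
    (hα : 0 < α) : IsMult N (fun i => (1 - z i) ^ (α : ℂ)) (∑' k, |sgnBinom α k|) :=
  hz.powerSeries (summable_abs_sgnBinom hα).hasSum fun i => hasSum_sgnBinom hα (hz1 i)

end Multipliers

section Chain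

/-- The Cayley-type contraction `w / (M - (M-1) w)`. -/
def cay (M : ℝ) (w : ℂ) : ℂ := w / (M - (M - 1) * w)

lemma cay_one (w : ℂ) : cay 1 w = w := by simp [cay]

lemma cay_den_bound {M : ℝ} (hM : 1 ≤ M) (w : ℂ) :
    M - (M - 1) * ‖w‖ ≤ ‖(M - (M - 1) * w : ℂ)‖ := by
  have h := norm_sub_norm_le (M : ℂ) ((M - 1) * w)
  have h1 : ‖((M:ℂ) - 1) * w‖ = (M - 1) * ‖w‖ := by
    rw [norm_mul, ← Complex.ofReal_one, ← Complex.ofReal_sub, Complex.norm_real,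
      Real.norm_of_nonneg (by linarith)]
  rwa [h1, Complex.norm_real, Real.norm_of_nonneg (by linarith)] at h

lemma cay_den_ne {M : ℝ} (hM : 1 ≤ M) {w : ℂ} (hw : ‖w‖ ≤ 1) : (M - (M - 1) * w : ℂ) ≠ 0 := by
  rw [← norm_pos_iff]
  nlinarith [cay_den_bound hM w, norm_nonneg w]

lemma norm_cay_le {M : ℝ} (hM : 1 ≤ M) {w : ℂ} (hw : ‖w‖ ≤ 1) : ‖cay M w‖ ≤ 1 := by
  rw [cay, norm_div, div_le_one (norm_pos_iff.2 (cay_den_ne hM hw))]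
  nlinarith [cay_den_bound hM w, norm_nonneg w]

lemma one_sub_cay {M : ℝ} (hM : 1 ≤ M) {w : ℂ} (hw : ‖w‖ ≤ 1) :
    1 - cay M w = M * (1 - w) / (M - (M - 1) * w) := by
  have := cay_den_ne hM hw
  rw [cay, eq_div_iff this, sub_mul, div_mul_cancel₀ _ this]; ring

lemma cay_double {M : ℝ} (hM : 1 ≤ M) {w : ℂ} (hw : ‖w‖ ≤ 1) :
    (1 - cay (2 * M) w) * (2 - cay M w) = 2 * (1 - cay M w) := by
  have h1 := cay_den_ne hM hw
  have h2 := cay_den_ne (M := 2 * M) (by linarith) hw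
  rw [one_sub_cay hM hw, one_sub_cay (by linarith) hw, cay]
  have h3 : (2 : ℂ) - w / (M - (M - 1) * w) = (2 * M - (2 * M - 1) * w) / (M - (M - 1) * w) := by
    rw [eq_div_iff h1, sub_mul, div_mul_cancel₀ _ h1]; ring
  rw [h3]
  push_cast at h2 ⊢
  rw [div_mul_div_comm, mul_div_assoc', div_eq_div_iff (mul_ne_zero h2 h1) h1]; ring

lemma cay_ratio {M : ℝ} (hM : 1 ≤ M) : 0 ≤ 1 - 1 / M ∧ 1 - 1 / M < 1 := by
  have : 1 / M ≤ 1 := by rw [div_le_one (by linarith)]; exact hM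
  have : 0 < 1 / M := by positivity
  constructor <;> linarith

lemma hasSum_cayCoef {M : ℝ} (hM : 1 ≤ M) :
    HasSum (fun k : ℕ => 1 / M * (1 - 1 / M) ^ k) 1 := by
  have h := (hasSum_geometric_of_lt_one (cay_ratio hM).1 (cay_ratio hM).2).mul_left (1 / M)
  have hM0 : M ≠ 0 := by linarith
  simpa [hM0] using h

lemma hasSum_cay {M : ℝ} (hM : 1 ≤ M) {w : ℂ} (hw : ‖w‖ ≤ 1) :
    HasSum (fun k : ℕ => ((1 / M * (1 - 1 / M) ^ k : ℝ) : ℂ) * w ^ (k + 1)) (cay M w) := by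
  have hM0 : (M:ℂ) ≠ 0 := by norm_cast; linarith
  have hr := cay_ratio hM
  have hlt : ‖((1 - 1 / M : ℝ) : ℂ) * w‖ < 1 := by
    rw [norm_mul, Complex.norm_real, Real.norm_of_nonneg hr.1]
    nlinarith [norm_nonneg w]
  have h := (hasSum_geometric_of_norm_lt_one hlt).mul_left (1 / (M : ℂ) * w)
  have hd := cay_den_ne hM hw
  have e : 1 / (M:ℂ) * w * (1 - ((1 - 1 / M : ℝ) : ℂ) * w)⁻¹ = cay M w := by
    have : 1 - ((1 - 1 / M : ℝ) : ℂ) * w = (M - (M - 1) * w) / M := by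
      push_cast; field_simp
    rw [this, cay, inv_div]; field_simp
  rw [e] at h
  refine h.congr_fun ?_ |> fun h => h
  intro k
  push_cast
  rw [mul_pow]; ring

variable {ι : Type*} {N : Seminorm ℂ (ι →₀ ℂ)}

lemma isMult_cay {M : ℝ} (hM : 1 ≤ M) {z : ι → ℂ} (hz : IsMult N z 1) (hz1 : ∀ i, ‖z i‖ ≤ 1) :
    IsMult N (fun i => cay M (z i)) 1 := by
  refine IsMult.of_hasSum (u := fun k => ((1 / M * (1 - 1 / M) ^ k : ℝ) : ℂ) • z ^ (k + 1))
    (fun k => ?_) (hasSum_cayCoef hM) (fun i => by simpa using hasSum_cay hM (hz1 i))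
  have h := (hz.pow (k + 1)).smul ((1 / M * (1 - 1 / M) ^ k : ℝ) : ℂ)
  rw [Complex.norm_real, Real.norm_of_nonneg
    (mul_nonneg (by positivity) (pow_nonneg (cay_ratio hM).1 _))] at h
  simpa using h

/-- `(1 - s)^α` as a multiplier. -/
def oneSubPow (s : ι → ℂ) (α : ℝ) : ι → ℂ := fun i => (1 - s i) ^ (α : ℂ)

lemma oneSubPow_add (s : ι → ℂ) {α β : ℝ} (hα : 0 < α) (hβ : 0 < β) :
    oneSubPow s (α + β) = oneSubPow s β * oneSubPow s α := by
  funext i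
  simp only [oneSubPow, Pi.mul_apply]
  by_cases h : 1 - s i = 0
  · have h1 : ((α + β : ℝ) : ℂ) ≠ 0 := by exact_mod_cast (add_pos hα hβ).ne'
    have h2 : (α : ℂ) ≠ 0 := by exact_mod_cast hα.ne'
    rw [h, Complex.zero_cpow h1, Complex.zero_cpow h2, mul_zero]
  · rw [Complex.ofReal_add, Complex.cpow_add _ _ h, mul_comm]

lemma oneSubPow_natCast (s : ι → ℂ) (n : ℕ) : oneSubPow s n = (1 - s) ^ n := by
  funext i
  simp [oneSubPow]

lemma oneSubPow_add_one (s : ι → ℂ) {α : ℝ} (hα : 0 < α) :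
    oneSubPow s (α + 1) = (1 - s) * oneSubPow s α := by
  rw [oneSubPow_add s hα one_pos]
  congr 1
  have := oneSubPow_natCast s 1
  simpa using this

/-- `(2 - s)^(-α)` as a multiplier. -/
def vMult (s : ι → ℂ) (α : ℝ) : ι → ℂ := fun i => (2 - s i) ^ (-(α : ℂ))

/-- The chain `s_j` attached to a contraction `z`. -/
def chain (z : ι → ℂ) (j : ℕ) : ι → ℂ := fun i => cay (2 ^ j) (z i)

lemma one_le_two_pow_real (j : ℕ) : (1:ℝ) ≤ 2 ^ j := one_le_pow₀ (by norm_num)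

lemma chain_zero (z : ι → ℂ) : chain z 0 = z := by
  funext i; simp [chain, cay_one]

lemma isMult_chain {z : ι → ℂ} (hz : IsMult N z 1) (hz1 : ∀ i, ‖z i‖ ≤ 1) (j : ℕ) :
    IsMult N (chain z j) 1 := isMult_cay (one_le_two_pow_real j) hz hz1

lemma norm_chain_le {z : ι → ℂ} (hz1 : ∀ i, ‖z i‖ ≤ 1) (j : ℕ) (i : ι) : ‖chain z j i‖ ≤ 1 :=
  norm_cay_le (one_le_two_pow_real j) (hz1 i)

lemma vMult_chain {z : ι → ℂ} (hz1 : ∀ i, ‖z i‖ ≤ 1) (j : ℕ) {α : ℝ} (hα : 0 < α) :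
    vMult (chain z j) α * oneSubPow (chain z j) α =
      ((2 ^ (-α) : ℝ) : ℂ) • oneSubPow (chain z (j + 1)) α := by
  funext i
  refine (doubling_cpow hα (norm_chain_le hz1 j i) ?_ (norm_chain_le hz1 (j+1) i)).symm
  have := cay_double (one_le_two_pow_real j) (hz1 i)
  simp only [chain, pow_succ']
  exact this

/-- Uniform convexity inequality of power type `τ`. -/
def UnifConvex (N : Seminorm ℂ (ι →₀ ℂ)) (τ c : ℝ) : Prop :=
  ∀ u v, N ((1/2 : ℂ) • (u + v)) ^ τ + c * N ((1/2 : ℂ) • (u - v)) ^ τ ≤ (N u ^ τ + N v ^ τ) / 2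

/-- Uniform smoothness inequality of power type `θ`. -/
def UnifSmooth (N : Seminorm ℂ (ι →₀ ℂ)) (θ C : ℝ) : Prop :=
  ∀ x y, N (x + y) ^ θ + N (x - y) ^ θ ≤ 2 * N x ^ θ + 2 * C * N y ^ θ

lemma isMult_vMult_sub {s : ι → ℂ} (hs : IsMult N s 1) (hs1 : ∀ i, ‖s i‖ ≤ 1) {α μ : ℝ}
    (hα : 0 < α) (h0 : μ ≤ vCoef α 0) (h1 : μ ≤ vCoef α 1) :
    IsMult N (vMult s α - (μ : ℂ) • (1 + s)) (1 - 2 * μ) := by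
  let a : ℕ → ℝ := fun k => vCoef α k - if k < 2 then μ else 0
  have hfin : ∀ (f : ℕ → ℝ), HasSum (fun k : ℕ => if k < 2 then f k else 0) (f 0 + f 1) := by
    intro f
    have := hasSum_sum_of_ne_finset_zero (f := fun k : ℕ => if k < 2 then f k else 0)
      (s := Finset.range 2) (L := SummationFilter.unconditional ℕ) (by intro b hb; simp at hb; simp [hb])
    simpa [Finset.sum_range_succ] using this
  have hfinc : ∀ (f : ℕ → ℂ), HasSum (fun k : ℕ => if k < 2 then f k else 0) (f 0 + f 1) := by
    intro f
    have := hasSum_sum_of_ne_finset_zero (f := fun k : ℕ => if k < 2 then f k else 0)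
      (s := Finset.range 2) (L := SummationFilter.unconditional ℕ) (by intro b hb; simp at hb; simp [hb])
    simpa [Finset.sum_range_succ] using this
  have hpos : ∀ k, 0 ≤ a k := by
    intro k
    simp only [a]
    split_ifs with hk
    · interval_cases k <;> simpa using by assumption
    · simpa using (vCoef_pos hα k).le
  have ha : HasSum (fun k => |a k|) (1 - 2 * μ) := by
    simp_rw [abs_of_nonneg (hpos _)]
    have := (hasSum_vCoef_one α).sub (hfin fun _ => μ)
    rwa [← two_mul] at this
  refine hs.powerSeries ha fun i => ?_
  have := (hasSum_vCoef α (hs1 i)).sub (hfinc fun k => (μ:ℂ) * s i ^ k)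
  have e : (fun k => ((a k : ℝ) : ℂ) * s i ^ k) = fun k => (vCoef α k : ℂ) * s i ^ k -
      if k < 2 then (μ : ℂ) * s i ^ k else 0 := by
    funext k
    simp only [a]
    split_ifs <;> push_cast <;> ring
  rw [e]
  have e2 : (vMult s α - (μ : ℂ) • (1 + s)) i =
      (2 - s i) ^ (-(α : ℂ)) - ((μ : ℂ) * s i ^ 0 + (μ : ℂ) * s i ^ 1) := by
    simp [vMult]
  rw [e2]
  exact this

/-- Single step of the uniform-convexity argument. -/
lemma convex_step {τ c α : ℝ} (hτ : 1 ≤ τ) (hc : 0 < c) (hα : 0 < α) (hUC : UnifConvex N τ c) :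
    ∃ c' : ℝ, 0 < c' ∧ ∀ s : ι → ℂ, IsMult N s 1 → (∀ i, ‖s i‖ ≤ 1) → ∀ u,
      N (vMult s α • u) ^ τ + c' * N ((1 - s) • u) ^ τ ≤ N u ^ τ := by
  set μ := min (vCoef α 0) (vCoef α 1) with hμ
  have hμ0 : 0 < μ := lt_min (vCoef_pos hα 0) (vCoef_pos hα 1)
  refine ⟨2 * μ * (c * (1/2) ^ τ), by positivity, fun s hs hs1 u => ?_⟩
  have hW := isMult_vMult_sub hs hs1 hα (min_le_left _ _ : μ ≤ _) (min_le_right _ _)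
  set a := N ((1/2 : ℂ) • (u + s • u)) with ha
  have ha0 : 0 ≤ a := apply_nonneg N _
  have hb0 : 0 ≤ N u := apply_nonneg N _
  have h1 : N (vMult s α • u) ≤ (2 * μ) * a + (1 - 2 * μ) * N u := by
    have e : vMult s α • u = (2 * μ : ℂ) • ((1/2 : ℂ) • (u + s • u)) +
        (vMult s α - (μ : ℂ) • (1 + s)) • u := by
      ext i; simp; ring
    rw [e]
    refine (map_add_le_add N _ _).trans (add_le_add ?_ (hW.2 u))
    rw [map_smul_eq_mul]
    refine le_of_eq ?_
    congr 1
    rw [show (2 * μ : ℂ) = ((2 * μ : ℝ) : ℂ) by push_cast; rfl, Complex.norm_real,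
      Real.norm_of_nonneg (by positivity)]
  have h2 : N (vMult s α • u) ^ τ ≤ (2 * μ) * a ^ τ + (1 - 2 * μ) * N u ^ τ := by
    refine (Real.rpow_le_rpow (apply_nonneg N _) h1 (by linarith)).trans ?_
    have := (convexOn_rpow hτ).2 (Set.mem_Ici.2 ha0) (Set.mem_Ici.2 hb0)
      (by positivity : 0 ≤ 2 * μ) hW.1 (by ring)
    simpa using this
  have h3 := hUC u (s • u)
  have h4 : N (s • u) ^ τ ≤ N u ^ τ :=
    Real.rpow_le_rpow (apply_nonneg N _) (by simpa using hs.2 u) (by linarith)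
  have h5 : N ((1/2 : ℂ) • (u - s • u)) ^ τ = (1/2) ^ τ * N ((1 - s) • u) ^ τ := by
    have e : u - s • u = (1 - s) • u := by ext i; simp; ring
    rw [e, map_smul_eq_mul, Real.mul_rpow (norm_nonneg _) (apply_nonneg N _)]
    norm_num
  rw [h5, ← ha] at h3
  nlinarith [h2, h3, h4, hμ0]

end Chain

section ChainSums

variable {ι : Type*} {N : Seminorm ℂ (ι →₀ ℂ)}

/-- The seminorm as an extended nonnegative real. -/
def eN (N : Seminorm ℂ (ι →₀ ℂ)) (c : ι →₀ ℂ) : ℝ≥0∞ := ENNReal.ofReal (N c)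

lemma IsMult.eN_le {m : ι → ℂ} {C : ℝ} (h : IsMult N m C) (c : ι →₀ ℂ) :
    eN N (m • c) ≤ ENNReal.ofReal C * eN N c := by
  rw [eN, eN, ← ENNReal.ofReal_mul h.1]
  exact ENNReal.ofReal_le_ofReal (h.2 c)

lemma eN_add_le (c c' : ι →₀ ℂ) : eN N (c + c') ≤ eN N c + eN N c' := by
  rw [eN, eN, eN, ← ENNReal.ofReal_add (apply_nonneg N _) (apply_nonneg N _)]
  exact ENNReal.ofReal_le_ofReal (map_add_le_add N _ _)

lemma eN_ne_top (c : ι →₀ ℂ) : eN N c ≠ ⊤ := ENNReal.ofReal_ne_top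

/-- The geometric weight `2^{-a}`. -/
def gw (a : ℝ) : ℝ≥0∞ := ENNReal.ofReal (2 ^ (-a))

lemma gw_add (a b : ℝ) : gw (a + b) = gw a * gw b := by
  rw [gw, gw, gw, ← ENNReal.ofReal_mul (by positivity), ← Real.rpow_add (by norm_num)]
  congr 2; ring

lemma gw_zero : gw 0 = 1 := by simp [gw]

lemma gw_ne_top (a : ℝ) : gw a ≠ ⊤ := ENNReal.ofReal_ne_top

lemma gw_pow (a : ℝ) (n : ℕ) : gw a ^ n = gw (n * a) := by
  induction n with
  | zero => simp [gw_zero]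
  | succ n ih => rw [pow_succ, ih, ← gw_add]; congr 1; push_cast; ring

lemma gw_lt_one {a : ℝ} (ha : 0 < a) : gw a < 1 := by
  rw [gw, ENNReal.ofReal_lt_one]
  exact Real.rpow_lt_one_of_one_lt_of_neg (by norm_num) (by linarith)

lemma gw_rpow (a σ : ℝ) : gw a ^ σ = gw (a * σ) := by
  rw [gw, gw, ENNReal.ofReal_rpow_of_pos (by positivity), ← Real.rpow_mul (by norm_num)]
  congr 2; ring

lemma tsum_gw_ne_top {a : ℝ} (ha : 0 < a) : ∑' k : ℕ, gw a ^ k ≠ ⊤ := by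
  rw [ENNReal.tsum_geometric]
  simpa [tsub_eq_zero_iff_le] using gw_lt_one ha

lemma smul_eN (a : ℝ) (c : ι →₀ ℂ) : eN N (((2 ^ (-a) : ℝ) : ℂ) • c) = gw a * eN N c := by
  rw [eN, map_smul_eq_mul, Complex.norm_real, Real.norm_of_nonneg (by positivity),
    ENNReal.ofReal_mul (by positivity)]
  rfl

/-- Discrete Jensen/Hölder with weights. -/
lemma tsum_mul_rpow_le {κ : Type*} (w f : κ → ℝ≥0∞) {σ : ℝ} (hσ : 1 ≤ σ) :
    (∑' k, w k * f k) ^ σ ≤ (∑' k, w k) ^ (σ - 1) * ∑' k, w k * f k ^ σ := by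
  have hσ0 : 0 < σ := by linarith
  have h : ∑' k, w k * f k ≤ (∑' k, w k) ^ (1 - σ⁻¹) * (∑' k, w k * f k ^ σ) ^ σ⁻¹ := by
    rw [ENNReal.tsum_eq_iSup_sum]
    refine iSup_le fun s => (ENNReal.inner_le_weight_mul_Lp_of_nonneg s hσ w f).trans ?_
    have h1 : 0 ≤ 1 - σ⁻¹ := by simpa using inv_le_one_of_one_le₀ hσ
    gcongr
    · exact ENNReal.sum_le_tsum s
    · exact ENNReal.sum_le_tsum s
  refine (ENNReal.rpow_le_rpow h hσ0.le).trans (le_of_eq ?_)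
  rw [ENNReal.mul_rpow_of_nonneg _ _ hσ0.le, ← ENNReal.rpow_mul, ← ENNReal.rpow_mul,
    inv_mul_cancel₀ hσ0.ne', ENNReal.rpow_one]
  congr 2
  field_simp

lemma tsum_shift_le (g : ℕ → ℝ≥0∞) (k : ℕ) : ∑' j, g (j + k) ≤ ∑' j, g j :=
  ENNReal.tsum_comp_le_tsum_of_injective (add_left_injective k) g

/-- Discrete Hardy inequality. -/
lemma hardy {X Y : ℕ → ℝ≥0∞} {C q : ℝ≥0∞} {σ : ℝ} (hσ : 1 ≤ σ)
    (h : ∀ j, X j ≤ C * ∑' k, q ^ k * Y (j + k)) :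
    ∑' j, X j ^ σ ≤ (C * ∑' k, q ^ k) ^ σ * ∑' j, Y j ^ σ := by
  have hσ0 : 0 ≤ σ := by linarith
  set S := ∑' k : ℕ, q ^ k
  calc ∑' j, X j ^ σ ≤ ∑' j, C ^ σ * (S ^ (σ - 1) * ∑' k, q ^ k * Y (j + k) ^ σ) := by
        refine ENNReal.tsum_le_tsum fun j => (ENNReal.rpow_le_rpow (h j) hσ0).trans ?_
        rw [ENNReal.mul_rpow_of_nonneg _ _ hσ0]
        exact mul_le_mul_right (tsum_mul_rpow_le _ _ hσ) _
    _ = C ^ σ * (S ^ (σ - 1) * ∑' k, q ^ k * ∑' j, Y (j + k) ^ σ) := by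
        rw [ENNReal.tsum_mul_left, ENNReal.tsum_mul_left, ENNReal.tsum_comm]
        simp_rw [ENNReal.tsum_mul_left]
    _ ≤ C ^ σ * (S ^ (σ - 1) * ∑' k, q ^ k * ∑' j, Y j ^ σ) := by
        refine mul_le_mul_right (mul_le_mul_right (ENNReal.tsum_le_tsum fun k => ?_) _) _
        exact mul_le_mul_right (tsum_shift_le (fun j => Y j ^ σ) k) _
    _ = (C * S) ^ σ * ∑' j, Y j ^ σ := by
        rw [ENNReal.tsum_mul_right, ENNReal.mul_rpow_of_nonneg _ _ hσ0]
        have : S ^ σ = S ^ (σ - 1) * S := by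
          conv_lhs => rw [show σ = (σ - 1) + 1 by ring]
          rw [ENNReal.rpow_add_of_nonneg _ _ (by linarith) zero_le_one, ENNReal.rpow_one]
        rw [this]; ring

/-- Uniform convexity gives the square-function type lower estimate along the chain. -/
lemma chain_convex {τ c α : ℝ} (hτ : 1 ≤ τ) (hc : 0 < c) (hα : 0 < α) (hUC : UnifConvex N τ c) :
    ∃ C : ℝ≥0, ∀ z : ι → ℂ, IsMult N z 1 → (∀ i, ‖z i‖ ≤ 1) → ∀ u : ι →₀ ℂ,
      ∑' j : ℕ, (gw α ^ j * eN N (oneSubPow (chain z j) (α + 1) • u)) ^ τ ≤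
        C * eN N (oneSubPow z α • u) ^ τ := by
  obtain ⟨c', hc', hstep⟩ := convex_step hτ hc hα hUC
  have hτ0 : 0 < τ := by linarith
  refine ⟨Real.toNNReal (1 / c'), fun z hz hz1 u => ?_⟩
  set q : ℝ := 2 ^ (-α)
  have hq : 0 < q := by positivity
  set F : ℕ → ℝ := fun j => (q ^ j * N (oneSubPow (chain z j) α • u)) ^ τ
  set G : ℕ → ℝ := fun j => (q ^ j * N (oneSubPow (chain z j) (α + 1) • u)) ^ τ
  have hF0 : ∀ j, 0 ≤ F j := fun j => by positivity
  have key : ∀ j, c' * G j ≤ F j - F (j + 1) := by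
    intro j
    have h := hstep (chain z j) (isMult_chain hz hz1 j) (norm_chain_le hz1 j)
      (oneSubPow (chain z j) α • u)
    rw [← pmul_mul, ← pmul_mul, vMult_chain hz1 j hα, ← oneSubPow_add_one _ hα, pmul_smul,
      map_smul_eq_mul, Complex.norm_real, Real.norm_of_nonneg hq.le] at h
    have h2 := mul_le_mul_of_nonneg_left h (by positivity : 0 ≤ (q ^ j) ^ τ)
    simp only [F, G]
    rw [Real.mul_rpow (by positivity) (apply_nonneg N _),
      Real.mul_rpow (by positivity) (apply_nonneg N _), pow_succ, mul_assoc (q ^ j) q,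
      Real.mul_rpow (by positivity) (mul_nonneg hq.le (apply_nonneg N _))]
    linarith
  have hsum : ∀ n, ∑ j ∈ Finset.range n, G j ≤ 1 / c' * F 0 := by
    intro n
    have : c' * ∑ j ∈ Finset.range n, G j ≤ F 0 - F n := by
      rw [Finset.mul_sum, ← Finset.sum_range_sub']
      exact Finset.sum_le_sum fun j _ => key j
    rw [one_div, inv_mul_eq_div, le_div_iff₀ hc']
    linarith [hF0 n]
  have hG : ∀ j, (gw α ^ j * eN N (oneSubPow (chain z j) (α + 1) • u)) ^ τ = ENNReal.ofReal (G j) := by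
    intro j
    rw [gw, eN, ← ENNReal.ofReal_pow hq.le, ← ENNReal.ofReal_mul (by positivity),
      ENNReal.ofReal_rpow_of_nonneg (by positivity) hτ0.le]
  refine ENNReal.tsum_le_of_sum_range_le fun n => ?_
  simp_rw [hG]
  rw [← ENNReal.ofReal_sum_of_nonneg (fun j _ => by positivity)]
  refine (ENNReal.ofReal_le_ofReal (hsum n)).trans (le_of_eq ?_)
  rw [ENNReal.ofReal_mul (by positivity), eN, ENNReal.ofReal_rpow_of_nonneg (apply_nonneg N _) hτ0.le]
  simp only [F, pow_zero, one_mul, chain_zero]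
  rfl

lemma hasSum_one_sub_vMult {s : ℂ} (hs : ‖s‖ ≤ 1) {α : ℝ} (hα : 0 < α) :
    HasSum (fun k => ((vCoef α k : ℝ) : ℂ) * ∑ l ∈ Finset.range k, s ^ l)
      (∑' k, ((vCoef α k : ℝ) : ℂ) * ∑ l ∈ Finset.range k, s ^ l) ∧
    1 - (2 - s) ^ (-(α : ℂ)) =
      (1 - s) * ∑' k, ((vCoef α k : ℝ) : ℂ) * ∑ l ∈ Finset.range k, s ^ l := by
  have h1 : Summable (fun k => ((vCoef α k : ℝ) : ℂ) * ∑ l ∈ Finset.range k, s ^ l) := by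
    refine Summable.of_norm_bounded (summable_sq_mul_vCoef hα) fun k => ?_
    rw [norm_mul, Complex.norm_real, Real.norm_of_nonneg (vCoef_pos hα k).le, mul_comm]
    refine mul_le_mul_of_nonneg_right ?_ (vCoef_pos hα k).le
    refine (norm_sum_le _ _).trans ((Finset.sum_le_card_nsmul _ _ 1 fun l _ => ?_).trans ?_)
    · rw [norm_pow]; exact pow_le_one₀ (norm_nonneg _) hs
    · simp; nlinarith [(Nat.cast_nonneg k : (0:ℝ) ≤ k)]
  refine ⟨h1.hasSum, ?_⟩
  have h2 := (hasSum_vCoef α (s := 1) (by simp)).sub (hasSum_vCoef α hs)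
  have h3 := h1.hasSum.mul_left (1 - s)
  have e : (2 - 1 : ℂ) ^ (-(α : ℂ)) = 1 := by norm_num
  rw [e] at h2
  have e2 : (fun k => ((vCoef α k : ℝ) : ℂ) * 1 ^ k - (vCoef α k : ℂ) * s ^ k) =
      fun k => (1 - s) * (((vCoef α k : ℝ) : ℂ) * ∑ l ∈ Finset.range k, s ^ l) := by
    funext k
    rw [mul_left_comm, mul_comm (1 - s), geom_sum_mul_neg]
    simp; ring
  rw [e2] at h2
  exact h2.unique h3

/-- The bounded factor of `1 - V` is a multiplier. -/
lemma one_sub_vMult_factor {α : ℝ} (hα : 0 < α) : ∃ C : ℝ, ∀ s : ι → ℂ, IsMult N s 1 →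
    (∀ i, ‖s i‖ ≤ 1) → ∃ H : ι → ℂ, IsMult N H C ∧ 1 - vMult s α = (1 - s) * H := by
  have hS : Summable fun k : ℕ => vCoef α k * k := by
    refine Summable.of_nonneg_of_le (fun k => by have := vCoef_pos hα k; positivity) (fun k => ?_)
      (summable_sq_mul_vCoef hα)
    rw [mul_comm]
    exact mul_le_mul_of_nonneg_right (by nlinarith [(Nat.cast_nonneg k : (0:ℝ) ≤ k)])
      (vCoef_pos hα k).le
  refine ⟨∑' k, vCoef α k * k, fun s hs hs1 =>
    ⟨fun i => ∑' k, ((vCoef α k : ℝ) : ℂ) * ∑ l ∈ Finset.range k, s i ^ l, ?_, ?_⟩⟩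
  · refine IsMult.of_hasSum (u := fun k => ((vCoef α k : ℝ) : ℂ) • ∑ l ∈ Finset.range k, s ^ l)
      (fun k => ?_) hS.hasSum fun i => ?_
    · have := (IsMult.sum (Finset.range k) fun l _ => hs.pow l).smul ((vCoef α k : ℝ) : ℂ)
      rw [Complex.norm_real, Real.norm_of_nonneg (vCoef_pos hα k).le] at this
      simpa using this
    · simpa [Finset.sum_apply] using (hasSum_one_sub_vMult (hs1 i) hα).1
  · funext i
    exact (hasSum_one_sub_vMult (hs1 i) hα).2

lemma chain_raise_one {β : ℝ} (hβ : 0 < β) : ∃ C : ℝ≥0, ∀ z : ι → ℂ, IsMult N z 1 →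
    (∀ i, ‖z i‖ ≤ 1) → ∀ (u : ι →₀ ℂ) (i : ℕ), eN N (oneSubPow (chain z i) β • u) ≤
      C * ∑' j : ℕ, gw β ^ j * eN N (oneSubPow (chain z (i + j)) (β + 1) • u) := by
  obtain ⟨S, hS⟩ := one_sub_vMult_factor (N := N) hβ
  refine ⟨S.toNNReal, fun z hz hz1 u i => ?_⟩
  set Y : ℕ → ℝ≥0∞ := fun j => eN N (oneSubPow (chain z j) (β + 1) • u)
  set X : ℕ → ℝ≥0∞ := fun j => eN N (oneSubPow (chain z j) β • u)
  have step : ∀ j, X j ≤ gw β * X (j + 1) + ENNReal.ofReal S * Y j := by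
    intro j
    obtain ⟨H, hH, e⟩ := hS (chain z j) (isMult_chain hz hz1 j) (norm_chain_le hz1 j)
    have e1 : oneSubPow (chain z j) β • u = ((2 ^ (-β) : ℝ) : ℂ) • (oneSubPow (chain z (j+1)) β • u)
        + H • (oneSubPow (chain z j) (β + 1) • u) := by
      rw [← pmul_smul, ← vMult_chain hz1 j hβ, oneSubPow_add_one _ hβ, ← pmul_mul, ← pmul_add,
        ← mul_assoc, ← add_mul, mul_comm H, ← e]
      congr 1
      ring
    simp only [X, Y]
    conv_lhs => rw [e1]
    refine (eN_add_le _ _).trans (add_le_add ?_ (hH.eN_le _))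
    rw [smul_eN]
  have iter : ∀ n, X i ≤ gw β ^ n * X (i + n) +
      ENNReal.ofReal S * ∑ j ∈ Finset.range n, gw β ^ j * Y (i + j) := by
    intro n
    induction n with
    | zero => simp
    | succ n ih =>
      refine ih.trans ?_
      rw [Finset.sum_range_succ, mul_add, pow_succ]
      calc _ ≤ gw β ^ n * (gw β * X (i + n + 1) + ENNReal.ofReal S * Y (i + n)) + _ := by
            gcongr; exact step _
        _ = _ := by rw [add_assoc i n 1]; ring
  set B := ENNReal.ofReal (∑' k, |sgnBinom β k|) * eN N u
  have hB : B ≠ ⊤ := ENNReal.mul_ne_top ENNReal.ofReal_ne_top (eN_ne_top _)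
  have hX : ∀ j, X j ≤ B := fun j =>
    ((isMult_chain hz hz1 j).cpow_one_sub (norm_chain_le hz1 j) hβ).eN_le u
  have lim : Filter.Tendsto (fun n => gw β ^ n * B +
      ENNReal.ofReal S * ∑' j, gw β ^ j * Y (i + j)) Filter.atTop
      (nhds (0 * B + ENNReal.ofReal S * ∑' j, gw β ^ j * Y (i + j))) := by
    refine Filter.Tendsto.add_const _ ?_
    exact ENNReal.Tendsto.mul_const
      (ENNReal.tendsto_pow_atTop_nhds_zero_of_lt_one (gw_lt_one hβ)) (Or.inr hB)
  refine (ge_of_tendsto' lim fun n => (iter n).trans ?_).trans (le_of_eq ?_)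
  · gcongr
    · exact hX _
    · exact ENNReal.sum_le_tsum _
  · rw [zero_mul, zero_add]; rfl

lemma chain_raise {β : ℝ} (hβ : 0 < β) (n : ℕ) : ∃ C : ℝ≥0, ∀ z : ι → ℂ, IsMult N z 1 →
    (∀ i, ‖z i‖ ≤ 1) → ∀ (u : ι →₀ ℂ) (i : ℕ), eN N (oneSubPow (chain z i) β • u) ≤
      C * ∑' j : ℕ, gw β ^ j * eN N (oneSubPow (chain z (i + j)) (β + (n + 1 : ℕ)) • u) := by
  induction n with
  | zero => simpa using chain_raise_one hβ
  | succ n ih =>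
    obtain ⟨C, hC⟩ := ih
    obtain ⟨C', hC'⟩ := chain_raise_one (N := N) (β := β + (n + 1 : ℕ)) (by positivity)
    have hfin : ∑' k : ℕ, gw ((n + 1 : ℕ) : ℝ) ^ k ≠ ⊤ := tsum_gw_ne_top (by positivity)
    refine ⟨C * (C' * (∑' k : ℕ, gw ((n + 1 : ℕ) : ℝ) ^ k).toNNReal), fun z hz hz1 u i => ?_⟩
    refine (hC z hz hz1 u i).trans ?_
    rw [ENNReal.coe_mul, ENNReal.coe_mul, ENNReal.coe_toNNReal hfin, mul_assoc]
    refine mul_le_mul_right ?_ _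
    set Y : ℕ → ℝ≥0∞ := fun j => eN N (oneSubPow (chain z (i + j)) (β + (n + 1 + 1 : ℕ)) • u)
    calc _ ≤ ∑' j : ℕ, gw β ^ j * (C' * ∑' k : ℕ, gw (β + (n + 1 : ℕ)) ^ k * Y (j + k)) := by
          gcongr with j
          have := hC' z hz hz1 u (i + j)
          have e : β + ((n + 1 + 1 : ℕ) : ℝ) = β + (n + 1 : ℕ) + 1 := by push_cast; ring
          simp only [Y, e, ← add_assoc]
          exact this
      _ = C' * ∑' k : ℕ, gw ((n + 1 : ℕ) : ℝ) ^ k * ∑' j : ℕ, gw β ^ (j + k) * Y (j + k) := by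
          simp_rw [← ENNReal.tsum_mul_left]
          rw [ENNReal.tsum_comm]
          refine tsum_congr fun k => tsum_congr fun j => ?_
          rw [gw_add, mul_pow, pow_add]; ring
      _ ≤ C' * ∑' k : ℕ, gw ((n + 1 : ℕ) : ℝ) ^ k * ∑' j : ℕ, gw β ^ j * Y j := by
          refine mul_le_mul_right (ENNReal.tsum_le_tsum fun k => ?_) _
          exact mul_le_mul_right (tsum_shift_le (fun j => gw β ^ j * Y j) k) _
      _ = _ := by
          rw [ENNReal.tsum_mul_right, mul_assoc]

end ChainSums

section ChainSmooth

variable {ι : Type*} {N : Seminorm ℂ (ι →₀ ℂ)}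

/-- `V` loses at most `K ‖D u‖^θ` in the power `θ`. -/
def SmoothLoss (N : Seminorm ℂ (ι →₀ ℂ)) (θ : ℝ) (D V : ι → ℂ) (K : ℝ) : Prop :=
  0 ≤ K ∧ ∀ u, N u ^ θ ≤ N (V • u) ^ θ + K * N (D • u) ^ θ

lemma rpow_tangent {θ A : ℝ} (hθ : 1 ≤ θ) (hA : 0 ≤ A) :
    ∃ T : ℝ, 0 ≤ T ∧ ∀ a, 0 ≤ a → A ^ θ + T * (a - A) ≤ a ^ θ := by
  rcases hA.eq_or_lt with rfl | hA
  · exact ⟨0, le_rfl, fun a ha => by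
      rw [Real.zero_rpow (by linarith)]; simpa using Real.rpow_nonneg ha θ⟩
  · refine ⟨θ * A ^ θ / A, by positivity, fun a ha => ?_⟩
    have h := one_add_mul_self_le_rpow_one_add (s := a / A - 1) (by
      have : 0 ≤ a / A := by positivity
      linarith) hθ
    rw [add_sub_cancel, Real.div_rpow ha hA.le, le_div_iff₀ (by positivity)] at h
    refine le_trans (le_of_eq ?_) h
    field_simp

lemma SmoothLoss.mono {θ : ℝ} {D V : ι → ℂ} {K K' : ℝ} (h : SmoothLoss N θ D V K) (hK : K ≤ K') :
    SmoothLoss N θ D V K' :=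
  ⟨h.1.trans hK, fun u => (h.2 u).trans (by
    have := Real.rpow_nonneg (apply_nonneg N (D • u)) θ
    nlinarith)⟩

lemma SmoothLoss.mul {θ : ℝ} (hθ : 0 ≤ θ) {D V V' : ι → ℂ} {K K' : ℝ} (h : SmoothLoss N θ D V K)
    (h' : SmoothLoss N θ D V' K') (hV : IsMult N V 1) : SmoothLoss N θ D (V' * V) (K + K') := by
  refine ⟨add_nonneg h.1 h'.1, fun u => ?_⟩
  have h1 := h.2 u
  have h2 := h'.2 (V • u)
  have h3 : N (D • V • u) ^ θ ≤ N (D • u) ^ θ := by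
    rw [pmul_comm]
    exact Real.rpow_le_rpow (apply_nonneg N _) (by simpa using hV.2 (D • u)) hθ
  rw [pmul_mul]
  nlinarith [h'.1]

lemma SmoothLoss.pow {θ : ℝ} (hθ : 0 ≤ θ) {D V : ι → ℂ} {K : ℝ} (h : SmoothLoss N θ D V K)
    (hV : IsMult N V 1) (k : ℕ) : SmoothLoss N θ D (V ^ k) (k * K) := by
  induction k with
  | zero => exact ⟨by simp, fun u => by simp⟩
  | succ k ih =>
    have := h.mul hθ ih hV
    rw [← pow_succ] at this
    exact this.mono (by push_cast; linarith)

/-- Averages of operators with controlled loss have controlled loss. -/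
lemma SmoothLoss.mix {θ C : ℝ} (hθ : 1 ≤ θ) (hC : 0 ≤ C) (hUS : UnifSmooth N θ C)
    {D V : ι → ℂ} {Vk : ℕ → ι → ℂ} {v K L : ℕ → ℝ} (hv : ∀ k, 0 ≤ v k) (hv1 : HasSum v 1)
    (hV : ∀ i, HasSum (fun k => (v k : ℂ) * Vk k i) (V i)) (hVk : ∀ k, IsMult N (Vk k) 1)
    (hK : ∀ k, SmoothLoss N θ D (Vk k) (K k)) (hL0 : ∀ k, 0 ≤ L k)
    (hL : ∀ k u, N ((Vk k - V) • u) ≤ L k * N (D • u))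
    (hsK : Summable fun k => v k * K k) (hsL : Summable fun k => v k * L k ^ θ) :
    SmoothLoss N θ D V (∑' k, v k * K k + 2 * C * ∑' k, v k * L k ^ θ) := by
  have hθ0 : 0 ≤ θ := by linarith
  refine ⟨add_nonneg (tsum_nonneg fun k => mul_nonneg (hv k) (hK k).1)
    (mul_nonneg (by positivity) (tsum_nonneg fun k => mul_nonneg (hv k)
      (Real.rpow_nonneg (hL0 k) _))), fun u => ?_⟩
  have hVb : IsMult N V 1 := by
    refine IsMult.of_hasSum (u := fun k => (v k : ℂ) • Vk k) (fun k => ?_) hv1 (by simpa using hV)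
    have := (hVk k).smul (v k : ℂ)
    rwa [Complex.norm_real, Real.norm_of_nonneg (hv k), mul_one] at this
  set A := N (V • u) with hA
  set d := N (D • u) with hd
  set a : ℕ → ℝ := fun k => N ((2 • V - Vk k) • u) with ha
  have ha0 : ∀ k, 0 ≤ a k := fun k => apply_nonneg N _
  have hab : ∀ k, a k ≤ 3 * N u := by
    intro k
    have h1 := ((hVb.add hVb).sub (hVk k)).2 u
    rw [← two_smul ℕ V] at h1
    exact h1.trans (le_of_eq (by ring))
  obtain ⟨T, hT0, hT⟩ := rpow_tangent hθ (apply_nonneg N (V • u))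
  have hsa : Summable fun k => v k * a k :=
    Summable.of_nonneg_of_le (fun k => mul_nonneg (hv k) (ha0 k))
      (fun k => mul_le_mul_of_nonneg_left (hab k) (hv k)) (hv1.summable.mul_right _)
  have hAa : A ≤ ∑' k, v k * a k := by
    have e : ∀ k, N (((v k : ℂ) • (2 • V - Vk k)) • u) = v k * a k := by
      intro k
      rw [pmul_smul, map_smul_eq_mul, Complex.norm_real, Real.norm_of_nonneg (hv k)]
    have h := seminorm_le_tsum (N := N) (u := fun k => (v k : ℂ) • (2 • V - Vk k)) (m := V)
      (fun i => by
        have h1 := ((Complex.hasSum_ofReal.2 hv1).mul_right (2 * V i)).sub (hV i)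
        have e1 : ((1:ℝ) : ℂ) * (2 * V i) - V i = V i := by push_cast; ring
        rw [e1] at h1
        refine h1.congr_fun ?_ |> fun h => h
        intro k
        simp; ring) u (by simp_rw [e]; exact hsa)
    simp_rw [e] at h
    exact h
  have key : ∀ k, v k * (N u ^ θ + A ^ θ + T * (a k - A)) ≤
      v k * (2 * A ^ θ) + (v k * K k + 2 * C * (v k * L k ^ θ)) * d ^ θ := by
    intro k
    have h1 := hUS (V • u) ((Vk k - V) • u)
    have e1 : V • u + (Vk k - V) • u = Vk k • u := by ext i; simp; ring
    have e2 : V • u - (Vk k - V) • u = (2 • V - Vk k) • u := by ext i; simp; ring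
    rw [e1, e2] at h1
    have h2 : N ((Vk k - V) • u) ^ θ ≤ L k ^ θ * d ^ θ := by
      rw [← Real.mul_rpow (hL0 k) (apply_nonneg N _)]
      exact Real.rpow_le_rpow (apply_nonneg N _) (hL k u) hθ0
    have h3 := (hK k).2 u
    have h4 := hT (a k) (ha0 k)
    have h5 : N u ^ θ + A ^ θ + T * (a k - A) ≤ 2 * A ^ θ + (K k + 2 * C * L k ^ θ) * d ^ θ := by
      have : 2 * C * N ((Vk k - V) • u) ^ θ ≤ 2 * C * (L k ^ θ * d ^ θ) :=
        mul_le_mul_of_nonneg_left h2 (by positivity)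
      simp only [a] at h4 ⊢
      linarith
    have := mul_le_mul_of_nonneg_left h5 (hv k)
    linarith
  have s1 : HasSum (fun k => v k * (N u ^ θ + A ^ θ + T * (a k - A)))
      (1 * (N u ^ θ + A ^ θ - T * A) + T * ∑' k, v k * a k) := by
    have := (hv1.mul_right (N u ^ θ + A ^ θ - T * A)).add (hsa.hasSum.mul_left T)
    refine this.congr_fun ?_ |> fun h => h
    intro k; ring
  have s2 := (hv1.mul_right (2 * A ^ θ)).add
    ((hsK.hasSum.add (hsL.hasSum.mul_left (2 * C))).mul_right (d ^ θ))
  have := hasSum_le key s1 s2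
  nlinarith [mul_le_mul_of_nonneg_left hAa hT0]

lemma rpow_le_sq {L θ : ℝ} (hL : 1 ≤ L) (hθ : θ ≤ 2) : L ^ θ ≤ L ^ 2 := by
  rw [← Real.rpow_natCast L 2]
  exact Real.rpow_le_rpow_of_exponent_le hL (by simpa using hθ)

lemma hasSum_geom_sq {M : ℝ} (hM : 1 ≤ M) :
    Summable (fun k : ℕ => 1 / M * (1 - 1 / M) ^ k * (3 + (k + 1) / M) ^ 2) ∧
    ∑' k : ℕ, 1 / M * (1 - 1 / M) ^ k * (3 + (k + 1) / M) ^ 2 ≤ 22 := by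
  have hM0 : 0 < M := by linarith
  have hr := cay_ratio hM
  have h1 := hasSum_choose_mul_geometric_of_norm_lt_one 2 (r := 1 - 1 / M)
    (by rw [Real.norm_of_nonneg hr.1]; exact hr.2)
  have h2 := ((hasSum_cayCoef hM).mul_right 18).add (h1.mul_left (1 / M * (4 / M ^ 2)))
  have e : 1 * 18 + 1 / M * (4 / M ^ 2) * (1 / (1 - (1 - 1 / M)) ^ (2 + 1)) = 22 := by
    simp only [sub_sub_cancel, one_div, inv_pow]; field_simp; norm_num; ring
  rw [e] at h2
  have hle : ∀ k : ℕ, 1 / M * (1 - 1 / M) ^ k * (3 + (k + 1) / M) ^ 2 ≤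
      1 / M * (1 - 1 / M) ^ k * 18 +
        1 / M * (4 / M ^ 2) * (((k + 2).choose 2 : ℕ) * (1 - 1 / M) ^ k) := by
    intro k
    have hc : (((k + 2).choose 2 : ℕ) : ℝ) = (k + 2) * (k + 1) / 2 := by
      rw [Nat.cast_choose_two]; push_cast; ring
    have hp := pow_nonneg hr.1 k
    have hq : (3 + ((k:ℝ) + 1) / M) ^ 2 ≤ 18 + 4 / M ^ 2 * ((k + 2) * (k + 1) / 2) := by
      have hx : 4 / M ^ 2 * (((k:ℝ) + 2) * (k + 1) / 2) = 2 * (((k:ℝ) + 1) / M) ^ 2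
          + 2 * (k + 1) / M ^ 2 := by
        field_simp; ring
      rw [hx]
      have : 0 ≤ 2 * ((k:ℝ) + 1) / M ^ 2 := by positivity
      nlinarith [sq_nonneg (((k:ℝ) + 1) / M - 3)]
    rw [hc]
    have := mul_le_mul_of_nonneg_left hq (mul_nonneg (by positivity : 0 ≤ 1 / M) hp)
    linarith
  have hs := Summable.of_nonneg_of_le (fun k : ℕ => mul_nonneg (mul_nonneg
    (by positivity : 0 ≤ 1 / M) (pow_nonneg hr.1 k)) (sq_nonneg _)) hle h2.summable
  refine ⟨hs, ?_⟩
  rw [← h2.tsum_eq]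
  exact hs.tsum_le_tsum hle h2.summable

lemma smoothLoss_cay {θ C : ℝ} (hθ : 1 ≤ θ) (hθ2 : θ ≤ 2) (hC : 0 ≤ C) (hUS : UnifSmooth N θ C)
    {z : ι → ℂ} (hz : ∀ c, N (z • c) = N c) (hz1 : ∀ i, ‖z i‖ ≤ 1) {M : ℝ} (hM : 1 ≤ M) :
    SmoothLoss N θ (1 - fun i => cay M (z i)) (fun i => cay M (z i)) (44 * C) := by
  have hM0 : 0 < M := by linarith
  have hzm : IsMult N z 1 := ⟨zero_le_one, fun c => by rw [hz, one_mul]⟩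
  have hzk : ∀ k c, N (z ^ k • c) = N c := by
    intro k c
    induction k with
    | zero => rw [pow_zero, pmul_one]
    | succ k ih => rw [pow_succ', pmul_mul, hz, ih]
  have hr := cay_ratio hM
  have hv : ∀ k : ℕ, 0 ≤ 1 / M * (1 - 1 / M) ^ k := fun k =>
    mul_nonneg (by positivity) (pow_nonneg hr.1 k)
  have hL1 : ∀ k : ℕ, 1 ≤ 3 + ((k:ℝ) + 1) / M := fun k => by
    have : 0 ≤ ((k:ℝ) + 1) / M := by positivity
    linarith
  have hle : ∀ k : ℕ, 1 / M * (1 - 1 / M) ^ k * (3 + ((k:ℝ) + 1) / M) ^ θ ≤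
      1 / M * (1 - 1 / M) ^ k * (3 + ((k:ℝ) + 1) / M) ^ 2 := fun k =>
    mul_le_mul_of_nonneg_left (rpow_le_sq (hL1 k) hθ2) (hv k)
  obtain ⟨hs2, hs22⟩ := hasSum_geom_sq hM
  have hsL : Summable fun k : ℕ => 1 / M * (1 - 1 / M) ^ k * (3 + ((k:ℝ) + 1) / M) ^ θ :=
    Summable.of_nonneg_of_le (fun k => mul_nonneg (hv k) (Real.rpow_nonneg (by linarith [hL1 k]) _))
      hle hs2
  have h := SmoothLoss.mix (N := N) hθ hC hUS (D := 1 - fun i => cay M (z i))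
    (V := fun i => cay M (z i)) (Vk := fun k => z ^ (k + 1)) (K := fun _ => 0)
    (L := fun k => 3 + ((k:ℝ) + 1) / M) hv (hasSum_cayCoef hM)
    (fun i => by simpa using hasSum_cay hM (hz1 i))
    (fun k => by simpa using hzm.pow (k + 1))
    (fun k => ⟨le_rfl, fun u => by rw [hzk]; simp⟩) (fun k => by linarith [hL1 k])
    (fun k u => ?_) (by simp) hsL
  · refine h.mono ?_
    have := hsL.tsum_le_tsum hle hs2
    simp only [mul_zero, tsum_zero, zero_add]
    nlinarith
  · have hm : IsMult N (1 - ((1 - 1 / M : ℝ) : ℂ) • (1 - z ^ (k + 1)) -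
        ((1 / M : ℝ) : ℂ) • ∑ l ∈ Finset.range (k + 1), z ^ l) (3 + ((k:ℝ) + 1) / M) := by
      have h1 := (isMult_one.sub (by simpa using hzm.pow (k+1) : IsMult N (z ^ (k+1)) 1)).smul
        ((1 - 1 / M : ℝ) : ℂ)
      have h2 := (IsMult.sum (Finset.range (k + 1)) fun l _ => hzm.pow l).smul ((1 / M : ℝ) : ℂ)
      have h3 := (isMult_one.sub h1).sub h2
      refine h3.mono ?_
      rw [Complex.norm_real, Complex.norm_real, Real.norm_of_nonneg hr.1,
        Real.norm_of_nonneg (by positivity)]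
      simp only [one_pow, Finset.sum_const, Finset.card_range, nsmul_eq_mul, mul_one]
      push_cast
      have : 0 < 1 / M := by positivity
      have e : 1 / M * ((k:ℝ) + 1) = (k + 1) / M := by ring
      linarith
    have e : (z ^ (k + 1) - fun i => cay M (z i)) = (1 - ((1 - 1 / M : ℝ) : ℂ) • (1 - z ^ (k + 1)) -
        ((1 / M : ℝ) : ℂ) • ∑ l ∈ Finset.range (k + 1), z ^ l) * (1 - fun i => cay M (z i)) := by
      funext i
      have hd := cay_den_ne hM (hz1 i)
      have hMc : (M : ℂ) ≠ 0 := by exact_mod_cast hM0.ne'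
      have hg := geom_sum_mul_neg (z i) (k + 1)
      simp only [Pi.sub_apply, Pi.mul_apply, Pi.pow_apply, Pi.one_apply, Pi.smul_apply, smul_eq_mul,
        Finset.sum_apply]
      rw [one_sub_cay hM (hz1 i), mul_div_assoc', eq_div_iff hd, sub_mul, cay,
        div_mul_cancel₀ _ hd]
      push_cast
      have e3 : (M:ℂ) * (1 / M) = 1 := by field_simp
      linear_combination ((∑ l ∈ Finset.range (k+1), z i ^ l) * (1 - z i) - (1 - z i ^ (k + 1)) * (1 - z i)) * e3 + hg
    rw [e, pmul_mul]
    exact hm.2 _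

lemma smooth_step {θ C α : ℝ} (hθ : 1 ≤ θ) (hθ2 : θ ≤ 2) (hα : 0 < α) (hC : 0 ≤ C)
    (hUS : UnifSmooth N θ C) {K : ℝ} (hK0 : 0 ≤ K) : ∃ K' : ℝ, ∀ s : ι → ℂ, IsMult N s 1 →
      (∀ i, ‖s i‖ ≤ 1) → SmoothLoss N θ (1 - s) s K → SmoothLoss N θ (1 - s) (vMult s α) K' := by
  obtain ⟨S, hS⟩ := one_sub_vMult_factor (N := N) hα
  set S' := |S| + 1
  have hle : ∀ k : ℕ, vCoef α k * (S' * ((k:ℝ) + 1)) ^ θ ≤ S' ^ 2 * (((k:ℝ) + 1) ^ 2 * vCoef α k) := by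
    intro k
    have h1 : 1 ≤ S' * ((k:ℝ) + 1) := by
      have h2 : 1 ≤ S' := by simp [S']
      nlinarith [(Nat.cast_nonneg k : (0:ℝ) ≤ k)]
    have := mul_le_mul_of_nonneg_left (rpow_le_sq h1 hθ2) (vCoef_pos hα k).le
    linarith
  have hsL : Summable fun k : ℕ => vCoef α k * (S' * ((k:ℝ) + 1)) ^ θ :=
    Summable.of_nonneg_of_le (fun k => mul_nonneg (vCoef_pos hα k).le
      (Real.rpow_nonneg (by positivity) _)) hle ((summable_sq_mul_vCoef hα).mul_left _)
  have hsK : Summable fun k : ℕ => vCoef α k * (k * K) := by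
    refine Summable.of_nonneg_of_le (fun k => by have := vCoef_pos hα k; positivity) (fun k => ?_)
      ((summable_sq_mul_vCoef hα).mul_left K)
    have h1 : (k:ℝ) ≤ ((k:ℝ) + 1) ^ 2 := by nlinarith [(Nat.cast_nonneg k : (0:ℝ) ≤ k)]
    have := mul_le_mul_of_nonneg_right h1 (mul_nonneg (vCoef_pos hα k).le hK0)
    linarith
  refine ⟨∑' k, vCoef α k * (k * K) + 2 * C * ∑' k : ℕ, vCoef α k * (S' * ((k:ℝ) + 1)) ^ θ,
    fun s hs hs1 hsl => ?_⟩
  obtain ⟨H, hH, e⟩ := hS s hs hs1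
  refine SmoothLoss.mix (Vk := fun k => s ^ k) (K := fun k => k * K)
    (L := fun k => S' * ((k:ℝ) + 1)) hθ hC hUS (fun k => (vCoef_pos hα k).le) (hasSum_vCoef_one α)
    (fun i => hasSum_vCoef α (hs1 i)) (fun k => by simpa using hs.pow k)
    (fun k => hsl.pow (by linarith) hs k) (fun k => by positivity) (fun k u => ?_) hsK hsL
  have h1 := hH.sub (IsMult.sum (Finset.range k) fun l _ => hs.pow l)
  have e1 : s ^ k - vMult s α = (H - ∑ l ∈ Finset.range k, s ^ l) * (1 - s) := by
    have := geom_sum_mul_neg s k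
    rw [sub_mul, this, mul_comm H, ← e]; ring
  rw [e1, pmul_mul]
  refine (h1.mono ?_).2 _
  simp only [one_pow, Finset.sum_const, Finset.card_range, nsmul_eq_mul, mul_one]
  have h2 := le_abs_self S
  have h3 : 0 ≤ |S| * (k:ℝ) := by positivity
  simp only [S']
  nlinarith

/-- Uniform smoothness gives the upper square-function type estimate along the chain. -/
lemma chain_smooth {θ C α : ℝ} (hθ : 1 ≤ θ) (hθ2 : θ ≤ 2) (hα : 0 < α) (hC : 0 ≤ C)
    (hUS : UnifSmooth N θ C) : ∃ C' : ℝ≥0, ∀ z : ι → ℂ, (∀ c, N (z • c) = N c) →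
      (∀ i, ‖z i‖ ≤ 1) → ∀ u : ι →₀ ℂ, eN N (oneSubPow z α • u) ^ θ ≤
        C' * ∑' j : ℕ, (gw α ^ j * eN N (oneSubPow (chain z j) (α + 1) • u)) ^ θ := by
  have hθ0 : 0 < θ := by linarith
  obtain ⟨K, hK⟩ := smooth_step (N := N) hθ hθ2 hα hC hUS (K := 44 * C) (by positivity)
  refine ⟨K.toNNReal, fun z hz hz1 u => ?_⟩
  have hzm : IsMult N z 1 := ⟨zero_le_one, fun c => by rw [hz, one_mul]⟩
  set Y : ℕ → ℝ≥0∞ := fun j => eN N (oneSubPow (chain z j) (α + 1) • u)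
  set X : ℕ → ℝ≥0∞ := fun j => eN N (oneSubPow (chain z j) α • u)
  have step : ∀ j, X j ^ θ ≤ (gw α * X (j + 1)) ^ θ + ENNReal.ofReal K * Y j ^ θ := by
    intro j
    have h1 := hK (chain z j) (isMult_chain hzm hz1 j) (norm_chain_le hz1 j)
      (smoothLoss_cay hθ hθ2 hC hUS hz hz1 (one_le_two_pow_real j))
    have h2 := h1.2 (oneSubPow (chain z j) α • u)
    rw [← pmul_mul, ← pmul_mul, vMult_chain hz1 j hα, ← oneSubPow_add_one _ hα, pmul_smul] at h2
    simp only [X, Y]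
    rw [← smul_eN]
    simp only [eN]
    rw [ENNReal.ofReal_rpow_of_nonneg (apply_nonneg N _) hθ0.le,
      ENNReal.ofReal_rpow_of_nonneg (apply_nonneg N _) hθ0.le,
      ENNReal.ofReal_rpow_of_nonneg (apply_nonneg N _) hθ0.le, ← ENNReal.ofReal_mul h1.1,
      ← ENNReal.ofReal_add (by positivity) (mul_nonneg h1.1 (by positivity))]
    exact ENNReal.ofReal_le_ofReal h2
  have iter : ∀ n, X 0 ^ θ ≤ (gw α ^ n * X n) ^ θ +
      ENNReal.ofReal K * ∑ j ∈ Finset.range n, (gw α ^ j * Y j) ^ θ := by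
    intro n
    induction n with
    | zero => simp
    | succ n ih =>
      refine ih.trans ?_
      rw [Finset.sum_range_succ, mul_add, pow_succ]
      calc _ ≤ (gw α ^ n) ^ θ * ((gw α * X (n + 1)) ^ θ + ENNReal.ofReal K * Y n ^ θ) + _ := by
            rw [ENNReal.mul_rpow_of_nonneg _ _ hθ0.le]
            gcongr; exact step _
        _ = _ := by
            rw [ENNReal.mul_rpow_of_nonneg _ (Y n) hθ0.le, mul_assoc (gw α ^ n),
              ENNReal.mul_rpow_of_nonneg (gw α ^ n) _ hθ0.le]
            ring
  set B := ENNReal.ofReal (∑' k, |sgnBinom α k|) * eN N u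
  have hB : B ≠ ⊤ := ENNReal.mul_ne_top ENNReal.ofReal_ne_top (eN_ne_top _)
  have hX : ∀ j, X j ≤ B := fun j =>
    ((isMult_chain hzm hz1 j).cpow_one_sub (norm_chain_le hz1 j) hα).eN_le u
  have lim : Filter.Tendsto (fun n => (gw α ^ n * B) ^ θ +
      ENNReal.ofReal K * ∑' j, (gw α ^ j * Y j) ^ θ) Filter.atTop
      (nhds ((0 * B) ^ θ + ENNReal.ofReal K * ∑' j, (gw α ^ j * Y j) ^ θ)) := by
    refine Filter.Tendsto.add_const _ ?_
    refine (ENNReal.continuous_rpow_const.tendsto _).comp ?_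
    exact ENNReal.Tendsto.mul_const
      (ENNReal.tendsto_pow_atTop_nhds_zero_of_lt_one (gw_lt_one hα)) (Or.inr hB)
  have e0 : eN N (oneSubPow z α • u) = X 0 := by simp only [X, chain_zero]
  rw [e0]
  refine (ge_of_tendsto' lim fun n => (iter n).trans ?_).trans (le_of_eq ?_)
  · gcongr
    · exact hX _
    · exact ENNReal.sum_le_tsum _
  · rw [zero_mul, ENNReal.zero_rpow_of_pos hθ0, zero_add]; rfl

end ChainSmooth

section TranslationMultipliers

variable {ι : Type*} {N : Seminorm ℂ (ι →₀ ℂ)}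

/-- Norming functional for a seminorm. -/
lemma exists_norming (N : Seminorm ℂ (ι →₀ ℂ)) (v : ι →₀ ℂ) :
    ∃ g : (ι →₀ ℂ) →ₗ[ℂ] ℂ, g v = (N v : ℂ) ∧ ∀ x, ‖g x‖ ≤ N x := by
  by_cases hv : v = 0
  · exact ⟨0, by simp [hv], fun x => by simp⟩
  let f : Module.Dual ℂ (Submodule.span ℂ {v}) :=
    (N v : ℂ) • ((LinearEquiv.toSpanNonzeroSingleton ℂ (ι →₀ ℂ) v hv).symm : _ →ₗ[ℂ] ℂ)
  have hf : ∀ a, f (LinearEquiv.toSpanNonzeroSingleton ℂ (ι →₀ ℂ) v hv a) = N v * a := by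
    intro a
    rw [LinearMap.smul_apply, LinearEquiv.coe_coe, LinearEquiv.symm_apply_apply, smul_eq_mul]
  obtain ⟨g, hg, hgN⟩ := Module.Dual.exists_extension_of_le_seminorm (p := N) _ f (by
    rintro ⟨x, hx⟩
    obtain ⟨a, rfl⟩ := Submodule.mem_span_singleton.1 hx
    have e : (⟨a • v, hx⟩ : Submodule.span ℂ {v}) =
        LinearEquiv.toSpanNonzeroSingleton ℂ (ι →₀ ℂ) v hv a := Subtype.ext (by simp)
    rw [e, hf, norm_mul, Complex.norm_real, Real.norm_of_nonneg (apply_nonneg N v), mul_comm,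
      ← map_smul_eq_mul]
    rfl)
  refine ⟨g, ?_, hgN⟩
  have h1 := hg ⟨v, Submodule.mem_span_singleton_self v⟩
  have e : (⟨v, Submodule.mem_span_singleton_self v⟩ : Submodule.span ℂ {v}) =
      LinearEquiv.toSpanNonzeroSingleton ℂ (ι →₀ ℂ) v hv 1 := Subtype.ext (by simp)
  rw [e, hf, mul_one, ← e] at h1
  exact h1

/-- Minkowski's integral inequality for multipliers. -/
lemma seminorm_integral_le {μ : Measure ℝ} {w : ℝ → ι → ℂ} {R : ℝ → ℝ} {m : ι → ℂ}
    (hw : ∀ i, Integrable (fun s => w s i) μ) (hm : ∀ i, m i = ∫ s, w s i ∂μ)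
    (hR : Integrable R μ) (c : ι →₀ ℂ) (h : ∀ᵐ s ∂μ, N (w s • c) ≤ R s) :
    N (m • c) ≤ ∫ s, R s ∂μ := by
  obtain ⟨g, hg, hgN⟩ := exists_norming N (m • c)
  have key : ∀ u : ι → ℂ, g (u • c) = ∑ i ∈ c.support, u i * (c i * g (Finsupp.single i 1)) := by
    intro u
    have : u • c = ∑ i ∈ c.support, (u i * c i) • Finsupp.single i (1:ℂ) := by
      ext j
      simp only [Finsupp.coe_pointwise_smul, Pi.smul_apply', smul_eq_mul, Finsupp.finsetSum_apply,
        Finsupp.smul_apply]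
      rw [Finset.sum_eq_single j]
      · simp
      · intro b _ hb; simp [hb]
      · intro hj; simp [Finsupp.notMem_support_iff.1 hj]
    rw [this, map_sum]
    refine Finset.sum_congr rfl fun i _ => ?_
    rw [map_smul, smul_eq_mul, mul_assoc]
  have e : g (m • c) = ∫ s, g (w s • c) ∂μ := by
    simp_rw [key]
    rw [integral_finsetSum _ fun i _ => (hw i).mul_const _]
    refine Finset.sum_congr rfl fun i _ => ?_
    rw [integral_mul_const, hm]
  have h1 : N (m • c) = ‖g (m • c)‖ := by
    rw [hg, Complex.norm_real, Real.norm_of_nonneg (apply_nonneg N _)]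
  rw [h1, e]
  exact norm_integral_le_of_norm_le hR (h.mono fun s hs => (hgN _).trans hs)

lemma isMult_integral {μ : Measure ℝ} {w : ℝ → ι → ℂ} {R : ℝ → ℝ} {m : ι → ℂ} {C : ℝ}
    (hw : ∀ i, Integrable (fun s => w s i) μ) (hm : ∀ i, m i = ∫ s, w s i ∂μ)
    (hR : Integrable R μ) (h : ∀ᵐ s ∂μ, IsMult N (w s) (R s)) (hC : ∫ s, R s ∂μ ≤ C) :
    IsMult N m C := by
  refine ⟨le_trans (integral_nonneg_of_ae (h.mono fun s hs => hs.1)) hC, fun c => ?_⟩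
  refine (seminorm_integral_le hw hm (hR.mul_const (N c)) c (h.mono fun s hs => hs.2 c)).trans ?_
  rw [integral_mul_const]
  exact mul_le_mul_of_nonneg_right hC (apply_nonneg N c)

lemma isMult_intervalIntegral {w : ℝ → ι → ℂ} {m : ι → ℂ} {C : ℝ}
    (hw : ∀ i, Continuous (fun s => w s i)) (hm : ∀ i, m i = ∫ s in (0:ℝ)..1, w s i)
    (h : ∀ s, 0 ≤ s → s ≤ 1 → IsMult N (w s) C) : IsMult N m C := by
  refine isMult_integral (μ := volume.restrict (Set.Ioc 0 1)) (w := w) (R := fun _ => C)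
    (fun i => ((hw i).intervalIntegrable 0 1).1) (fun i => ?_) (integrable_const _) ?_ ?_
  · rw [hm, intervalIntegral.integral_of_le zero_le_one]
  · exact (ae_restrict_iff' measurableSet_Ioc).2 (Filter.Eventually.of_forall fun s hs =>
      h s hs.1.le hs.2)
  · simp

/-- Symbol of the translation by `-h` along the frequency map `φ`. -/
def tr (φ : ι → ℤ) (h : ℝ) : ι → ℂ := fun i => Complex.exp (-(h * (φ i * Complex.I)))

/-- Symbol of `tD(1+tD)⁻¹`. -/
def psi (φ : ι → ℤ) (t : ℝ) : ι → ℂ := fun i => t * (φ i * Complex.I) / (1 + t * (φ i * Complex.I))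

/-- Symbol of `(1+tD)⁻¹`. -/
def res (φ : ι → ℤ) (t : ℝ) : ι → ℂ := fun i => 1 / (1 + t * (φ i * Complex.I))

/-- Symbol of the averaging operator over `[0,h]`. -/
def avg (φ : ι → ℤ) (h : ℝ) : ι → ℂ := fun i => ∫ s in (0:ℝ)..1, tr φ (s * h) i

variable {φ : ι → ℤ}

lemma norm_tr (h : ℝ) (i : ι) : ‖tr φ h i‖ = 1 := by
  rw [tr, Complex.norm_exp]; simp

lemma continuous_tr (h : ℝ) (i : ι) : Continuous fun s : ℝ => tr φ (s * h) i := by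
  unfold tr; fun_prop

lemma tr_add (h h' : ℝ) : tr φ (h + h') = tr φ h * tr φ h' := by
  funext i
  simp only [tr, Pi.mul_apply, ← Complex.exp_add]
  congr 1; push_cast; ring

lemma tr_nat_mul (k : ℕ) (h : ℝ) : tr φ (k * h) = tr φ h ^ k := by
  funext i
  simp only [tr, Pi.pow_apply, ← Complex.exp_nat_mul]
  congr 1; push_cast; ring

lemma tr_zero : tr φ 0 = 1 := by funext i; simp [tr]

lemma one_add_ne (t : ℝ) (n : ℤ) : (1 + t * (n * Complex.I) : ℂ) ≠ 0 := by
  intro h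
  have := congrArg Complex.re h
  simp at this

lemma one_sub_res (t : ℝ) : 1 - res φ t = psi φ t := by
  funext i
  have := one_add_ne t (φ i)
  simp only [res, psi, Pi.sub_apply, Pi.one_apply]
  rw [eq_div_iff this, sub_mul, div_mul_cancel₀ _ this]; ring

lemma mul_avg (h : ℝ) (i : ι) : h * (φ i * Complex.I) * avg φ h i = 1 - tr φ h i := by
  by_cases h0 : (h:ℂ) * (φ i * Complex.I) = 0
  · rw [h0, zero_mul, tr, h0]; simp
  · have e : ∀ s : ℝ, tr φ (s * h) i = Complex.exp (-(h * (φ i * Complex.I)) * s) := by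
      intro s; simp only [tr]; congr 1; push_cast; ring
    simp_rw [avg, e]
    rw [integral_exp_mul_complex (neg_ne_zero.2 h0), div_neg, mul_neg, mul_div_cancel₀ _ h0]
    simp [tr]

/-- Invariance of the seminorm under all translations along `φ`. -/
def TransInv (N : Seminorm ℂ (ι →₀ ℂ)) (φ : ι → ℤ) : Prop :=
  ∀ (h : ℝ) (c : ι →₀ ℂ), N (tr φ h • c) = N c

namespace TransInv

variable (hN : TransInv N φ)
include hN

lemma isMult_tr (h : ℝ) : IsMult N (tr φ h) 1 :=
  ⟨zero_le_one, fun c => by rw [hN, one_mul]⟩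

lemma isMult_avg (h : ℝ) : IsMult N (avg φ h) 1 :=
  isMult_intervalIntegral (w := fun s => tr φ (s * h)) (continuous_tr h) (fun _ => rfl)
    fun _ _ _ => hN.isMult_tr _

lemma isMult_res (t : ℝ) : IsMult N (res φ t) 1 := by
  have e : ∀ i, ∀ s : ℝ, (Real.exp (-s) : ℂ) * tr φ (s * t) i =
      Complex.exp (-(1 + t * (φ i * Complex.I)) * s) := by
    intro i s
    simp only [tr]
    push_cast
    rw [← Complex.exp_add]
    congr 1; ring
  have hre : ∀ i, (-(1 + t * (φ i * Complex.I)) : ℂ).re < 0 := by intro i; simp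
  refine isMult_integral (μ := volume.restrict (Set.Ioi 0))
    (w := fun s => ((Real.exp (-s) : ℝ) : ℂ) • tr φ (s * t)) (R := fun s => Real.exp (-s))
    (fun i => ?_) (fun i => ?_) ?_ (Filter.Eventually.of_forall fun s => ?_) ?_
  · simp only [Pi.smul_apply, smul_eq_mul, e]
    exact integrableOn_exp_mul_complex_Ioi (hre i) 0
  · simp only [Pi.smul_apply, smul_eq_mul, e]
    rw [integral_exp_mul_complex_Ioi (hre i)]
    simp only [res, Complex.ofReal_zero, mul_zero, Complex.exp_zero]
    rw [neg_div_neg_eq]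
  · have := integrableOn_exp_mul_Ioi (a := -1) (by norm_num) 0
    simpa [IntegrableOn] using this
  · have := (hN.isMult_tr (s * t)).smul ((Real.exp (-s) : ℝ) : ℂ)
    rwa [Complex.norm_real, Real.norm_of_nonneg (Real.exp_pos _).le, mul_one] at this
  · exact integral_exp_neg_Ioi_zero.le

lemma isMult_psi (t : ℝ) : IsMult N (psi φ t) 2 := by
  rw [← one_sub_res]
  exact (isMult_one.sub (hN.isMult_res t)).mono (by norm_num)

/-- Comparison of the chain with the resolvent family. -/
lemma one_sub_chain_factor {h δ : ℝ} (hδ : 0 < δ) (hh : |h| ≤ δ) (j : ℕ) :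
    ∃ B, IsMult N B 3 ∧ 1 - chain (tr φ h) j = B * psi φ (2 ^ j * δ) := by
  set M : ℝ := 2 ^ j with hM
  have hM1 : 1 ≤ M := one_le_two_pow_real j
  have hz1 : ∀ i, ‖tr φ h i‖ ≤ 1 := fun i => (norm_tr h i).le
  have hV := (hN.isMult_tr (-h)).mul (isMult_cay hM1 (hN.isMult_tr h) hz1)
  have hB := (((hN.isMult_avg h).mul hV).smul ((h / δ : ℝ) : ℂ)).add
    (isMult_one.sub (isMult_chain (hN.isMult_tr h) hz1 j))
  refine ⟨_, hB.mono ?_, ?_⟩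
  · rw [Complex.norm_real, Real.norm_eq_abs, abs_div, abs_of_pos hδ]
    have : |h| / δ ≤ 1 := by rw [div_le_one hδ]; exact hh
    linarith
  · funext i
    have hd := cay_den_ne hM1 (hz1 i)
    have h1 := one_add_ne (M * δ) (φ i)
    have hu := mul_avg (φ := φ) h i
    have hinv : tr φ (-h) i * tr φ h i = 1 := by
      rw [← Pi.mul_apply, ← tr_add]; simp [tr_zero]
    have hδ' : (δ:ℂ) ≠ 0 := by exact_mod_cast hδ.ne'
    simp only [Pi.sub_apply, Pi.mul_apply, Pi.one_apply, Pi.add_apply, Pi.smul_apply, smul_eq_mul,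
      chain, ← hM]
    rw [one_sub_cay hM1 (hz1 i)]
    have e1 : ((h / δ : ℝ) : ℂ) * (avg φ h i * (tr φ (-h) i * cay M (tr φ h i))) =
        h / δ * avg φ h i / (M - (M - 1) * tr φ h i) := by
      rw [cay, mul_div_assoc', hinv]; push_cast; ring
    rw [e1, psi, ← add_div, div_mul_div_comm, div_eq_div_iff hd (mul_ne_zero hd h1)]
    have e2 : (h:ℂ) / δ * avg φ h i * (((M * δ : ℝ) : ℂ) * (φ i * Complex.I)) =
        M * (1 - tr φ h i) := by
      rw [← hu]; push_cast; field_simp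
    linear_combination (-(M - (M - 1) * tr φ h i)) * e2

lemma psi_mul_avg_factor {δ : ℝ} (j : ℕ) :
    ∃ B, IsMult N B 3 ∧ psi φ (2 ^ j * δ) * avg φ δ = B * (1 - chain (tr φ δ) j) := by
  set M : ℝ := 2 ^ j with hM
  have hM1 : 1 ≤ M := one_le_two_pow_real j
  have hM0 : (M:ℂ) ≠ 0 := by exact_mod_cast (by linarith : (M:ℝ) ≠ 0)
  have hz1 : ∀ i, ‖tr φ δ i‖ ≤ 1 := fun i => (norm_tr δ i).le
  have hB := (hN.isMult_res (M * δ)).add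
    (((hN.isMult_avg δ).mul (hN.isMult_psi (M * δ))).smul ((1 - 1 / M : ℝ) : ℂ))
  refine ⟨_, hB.mono ?_, ?_⟩
  · rw [Complex.norm_real, Real.norm_of_nonneg (cay_ratio hM1).1]
    linarith [(cay_ratio hM1).2]
  · funext i
    have hd := cay_den_ne hM1 (hz1 i)
    have h1 := one_add_ne (M * δ) (φ i)
    have hu := mul_avg (φ := φ) δ i
    simp only [Pi.sub_apply, Pi.mul_apply, Pi.one_apply, Pi.add_apply, Pi.smul_apply, smul_eq_mul,
      chain, ← hM]
    rw [one_sub_cay hM1 (hz1 i), psi, res]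
    have e : (1 / (1 + ((M * δ : ℝ) : ℂ) * (φ i * Complex.I)) + ((1 - 1 / M : ℝ) : ℂ) * (avg φ δ i *
        (((M * δ : ℝ) : ℂ) * (φ i * Complex.I) / (1 + ((M * δ : ℝ) : ℂ) * (φ i * Complex.I))))) =
        (M - (M - 1) * tr φ δ i) / (1 + ((M * δ : ℝ) : ℂ) * (φ i * Complex.I)) := by
      rw [mul_div_assoc', mul_div_assoc', ← add_div]
      congr 1
      have e3 : (M:ℂ) * (1 / M) = 1 := by field_simp
      push_cast
      linear_combination (M - 1) * hu - δ * (φ i * Complex.I) * avg φ δ i * e3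
    rw [e, div_mul_div_comm, div_mul_eq_mul_div, div_eq_div_iff h1 (mul_ne_zero h1 hd)]
    push_cast
    linear_combination (M * (M - (M - 1) * tr φ δ i) * (1 + M * δ * (φ i * Complex.I))) * hu

lemma one_sub_avg_factor (hφ : ∀ i, φ i ≠ 0) {δ : ℝ} (hδ : 0 < δ) :
    ∃ B, IsMult N B 3 ∧ 1 - avg φ δ = B * psi φ δ := by
  have hl : ∀ i, (δ * (φ i * Complex.I) : ℂ) ≠ 0 := fun i => by simp [hφ i, hδ.ne']
  have hG : IsMult N (fun i => (1 - avg φ δ i) / (δ * (φ i * Complex.I))) 1 := by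
    refine isMult_intervalIntegral (w := fun s i => (1 - tr φ (s * δ) i) / (δ * (φ i * Complex.I)))
      (fun i => (continuous_const.sub (continuous_tr δ i)).div_const _) (fun i => ?_)
      fun s hs hs1 => ?_
    · rw [intervalIntegral.integral_div, intervalIntegral.integral_sub (by simp)
        ((continuous_tr δ i).intervalIntegrable _ _)]
      simp [avg]
    · refine (((hN.isMult_avg (s * δ)).smul (s : ℂ)).congr fun i => ?_).mono
        (C := ‖(s:ℂ)‖ * 1) ?_
      · rw [div_eq_iff (hl i), ← mul_avg, Pi.smul_apply, smul_eq_mul]; push_cast; ring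
      · rw [Complex.norm_real, Real.norm_of_nonneg hs]; linarith
  refine ⟨_, (hG.add (isMult_one.sub (hN.isMult_avg δ))).mono (by norm_num), ?_⟩
  funext i
  have h1 := one_add_ne δ (φ i)
  simp only [Pi.sub_apply, Pi.mul_apply, Pi.one_apply, Pi.add_apply, psi]
  rw [mul_div_assoc', eq_div_iff h1, add_mul, div_mul_cancel₀ _ (hl i)]
  ring

lemma psi_inv_bound (hφ : ∀ i, φ i ≠ 0) {t : ℝ} (ht : 0 < t) :
    ∃ B, IsMult N B (1 + 2 * π / t) ∧ 1 = B * psi φ t := by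
  have hl : ∀ i, ((φ i:ℂ) * Complex.I) ≠ 0 := fun i => by simp [hφ i]
  have ht' : (t:ℂ) ≠ 0 := by exact_mod_cast ht.ne'
  have hper : ∀ i, avg φ (2 * π) i = 0 := by
    intro i
    have h := mul_avg (φ := φ) (2 * π) i
    have e : tr φ (2 * π) i = 1 := by
      rw [tr, Complex.exp_eq_one_iff]
      exact ⟨-φ i, by push_cast; ring⟩
    rw [e, sub_self] at h
    have hp : ((2 * π : ℝ) : ℂ) ≠ 0 := by exact_mod_cast (by positivity : (2 * π : ℝ) ≠ 0)
    rcases mul_eq_zero.1 h with h | h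
    · exact absurd h (mul_ne_zero hp (hl i))
    · exact h
  have hG : IsMult N (fun i => 1 / ((φ i:ℂ) * Complex.I)) (2 * π) := by
    refine isMult_intervalIntegral (w := fun s i => (1 - tr φ (s * (2 * π)) i) / (φ i * Complex.I))
      (fun i => (continuous_const.sub (continuous_tr _ i)).div_const _) (fun i => ?_)
      fun s hs hs1 => ?_
    · rw [intervalIntegral.integral_div, intervalIntegral.integral_sub (by simp)
        ((continuous_tr _ i).intervalIntegrable _ _)]
      have := hper i
      simp only [avg] at this
      rw [this]; simp
    · refine (((hN.isMult_avg (s * (2 * π))).smul ((s * (2 * π) : ℝ) : ℂ)).congr fun i => ?_).mono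
        (C := ‖((s * (2 * π) : ℝ):ℂ)‖ * 1) ?_
      · rw [div_eq_iff (hl i), ← mul_avg, Pi.smul_apply, smul_eq_mul]; ring
      · rw [Complex.norm_real, Real.norm_of_nonneg (by positivity)]
        nlinarith [Real.pi_pos]
  refine ⟨1 + ((1 / t : ℝ) : ℂ) • fun i => 1 / ((φ i:ℂ) * Complex.I), ?_, ?_⟩
  · refine (isMult_one.add (hG.smul ((1 / t : ℝ) : ℂ))).mono ?_
    rw [Complex.norm_real, Real.norm_of_nonneg (by positivity)]
    exact (by ring : 1 + 1 / t * (2 * π) = 1 + 2 * π / t).le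
  · funext i
    have h1 := one_add_ne t (φ i)
    have h0 : (φ i:ℂ) ≠ 0 := by exact_mod_cast hφ i
    simp only [Pi.mul_apply, Pi.one_apply, Pi.add_apply, Pi.smul_apply, smul_eq_mul, psi]
    rw [mul_div_assoc', eq_div_iff h1]
    push_cast
    field_simp
    ring

end TransInv

end TranslationMultipliers

section OneDim

variable {ι : Type*} {N : Seminorm ℂ (ι →₀ ℂ)} {φ : ι → ℤ}

lemma eN_factor {m B m' : ι → ℂ} {C : ℝ} (hB : IsMult N B C) (h : m = B * m') (c : ι →₀ ℂ) :
    eN N (m • c) ≤ ENNReal.ofReal C * eN N (m' • c) := by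
  rw [h, pmul_mul]
  exact hB.eN_le _

lemma eN_factor_pow {m B m' : ι → ℂ} {C : ℝ} (hB : IsMult N B C) (h : m = B * m') (n : ℕ)
    (c : ι →₀ ℂ) : eN N (m ^ n • c) ≤ ENNReal.ofReal C ^ n * eN N (m' ^ n • c) := by
  rw [← ENNReal.ofReal_pow hB.1]
  exact eN_factor (hB.pow n) (by rw [h, mul_pow]) c

/-- Raising the order of `1 - s` only costs a constant. -/
lemma eN_oneSubPow_le {β γ : ℝ} (hβ : 0 < β) (hγ : 0 < γ) {s : ι → ℂ} (hs : IsMult N s 1)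
    (hs1 : ∀ i, ‖s i‖ ≤ 1) (c : ι →₀ ℂ) : eN N (oneSubPow s (β + γ) • c) ≤
      ENNReal.ofReal (∑' k, |sgnBinom γ k|) * eN N (oneSubPow s β • c) := by
  rw [oneSubPow_add s hβ hγ, pmul_mul]
  exact (hs.cpow_one_sub hs1 hγ).eN_le _

lemma eN_oneSub_pow_le {β : ℝ} (hβ : 0 < β) {n : ℕ} (hn : β < n) {s : ι → ℂ} (hs : IsMult N s 1)
    (hs1 : ∀ i, ‖s i‖ ≤ 1) (c : ι →₀ ℂ) : eN N ((1 - s) ^ n • c) ≤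
      ENNReal.ofReal (∑' k, |sgnBinom (n - β) k|) * eN N (oneSubPow s β • c) := by
  rw [← oneSubPow_natCast]
  have := eN_oneSubPow_le (N := N) hβ (sub_pos.2 hn) hs hs1 c
  rwa [add_sub_cancel] at this

lemma eN_oneSubPow_add_nat_le {β : ℝ} (hβ : 0 < β) {n : ℕ} (hn : 0 < n) {s : ι → ℂ}
    (hs : IsMult N s 1) (hs1 : ∀ i, ‖s i‖ ≤ 1) (c : ι →₀ ℂ) :
    eN N (oneSubPow s (β + n) • c) ≤
      ENNReal.ofReal (∑' k, |sgnBinom β k|) * eN N ((1 - s) ^ n • c) := by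
  have := eN_oneSubPow_le (N := N) (β := n) (γ := β) (by exact_mod_cast hn) hβ hs hs1 c
  rwa [oneSubPow_natCast, add_comm (n:ℝ)] at this

namespace TransInv

variable (hN : TransInv N φ)
include hN

lemma eN_chain_le_psi {β : ℝ} (hβ : 0 < β) {n : ℕ} (hn : 0 < n) {h δ : ℝ} (hδ : 0 < δ)
    (hh : |h| ≤ δ) (j : ℕ) (c : ι →₀ ℂ) : eN N (oneSubPow (chain (tr φ h) j) (β + n) • c) ≤
      ENNReal.ofReal (∑' k, |sgnBinom β k|) * 3 ^ n * eN N (psi φ (2 ^ j * δ) ^ n • c) := by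
  have hz1 : ∀ i, ‖tr φ h i‖ ≤ 1 := fun i => (norm_tr h i).le
  obtain ⟨B, hB, e⟩ := hN.one_sub_chain_factor hδ hh j
  refine (eN_oneSubPow_add_nat_le hβ hn (isMult_chain (hN.isMult_tr h) hz1 j)
    (norm_chain_le hz1 j) c).trans ?_
  rw [mul_assoc]
  refine mul_le_mul_right ?_ _
  simpa using eN_factor_pow hB e n c

/-- Differences of order `β` are controlled by weighted resolvent differences. -/
lemma diff_le_tsum_psi {β : ℝ} (hβ : 0 < β) {n : ℕ} (hn : 0 < n) : ∃ C : ℝ≥0, ∀ (h δ : ℝ), 0 < δ →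
    |h| ≤ δ → ∀ c : ι →₀ ℂ, eN N (oneSubPow (tr φ h) β • c) ≤
      C * ∑' k : ℕ, gw β ^ k * eN N (psi φ (2 ^ k * δ) ^ n • c) := by
  obtain ⟨m, rfl⟩ : ∃ m, n = m + 1 := Nat.exists_eq_add_one_of_ne_zero hn.ne'
  obtain ⟨C, hC⟩ := chain_raise (N := N) hβ m
  set K : ℝ≥0∞ := ENNReal.ofReal (∑' k, |sgnBinom β k|) * 3 ^ (m + 1)
  have hK : K ≠ ⊤ := ENNReal.mul_ne_top ENNReal.ofReal_ne_top (by simp)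
  refine ⟨C * K.toNNReal, fun h δ hδ hh c => ?_⟩
  have h1 := hC (tr φ h) (hN.isMult_tr h) (fun i => (norm_tr h i).le) c 0
  rw [chain_zero] at h1
  refine h1.trans ?_
  rw [ENNReal.coe_mul, ENNReal.coe_toNNReal hK, mul_assoc]
  refine mul_le_mul_right ?_ _
  rw [← ENNReal.tsum_mul_left]
  refine ENNReal.tsum_le_tsum fun j => ?_
  rw [zero_add, mul_left_comm K]
  exact mul_le_mul_right (hN.eN_chain_le_psi hβ hn hδ hh j c) _

/-- Upper estimate under uniform smoothness. -/
lemma diff_rpow_le_tsum_psi {θ S α : ℝ} (hθ : 1 ≤ θ) (hθ2 : θ ≤ 2) (hα : 0 < α) (hS : 0 ≤ S)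
    (hUS : UnifSmooth N θ S) {n : ℕ} (hn : 0 < n) : ∃ C : ℝ≥0, ∀ (h δ : ℝ), 0 < δ →
    |h| ≤ δ → ∀ c : ι →₀ ℂ, eN N (oneSubPow (tr φ h) α • c) ^ θ ≤
      C * ∑' j : ℕ, (gw α ^ j * eN N (psi φ (2 ^ j * δ) ^ n • c)) ^ θ := by
  obtain ⟨m, rfl⟩ : ∃ m, n = m + 1 := Nat.exists_eq_add_one_of_ne_zero hn.ne'
  obtain ⟨C₁, hC₁⟩ := chain_smooth (N := N) hθ hθ2 hα hS hUS
  have hα1 : 0 < α + 1 := by linarith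
  obtain ⟨C₂, hC₂⟩ := chain_raise (N := N) hα1 m
  set K : ℝ≥0∞ := ENNReal.ofReal (∑' k, |sgnBinom (α + 1) k|) * 3 ^ (m + 1)
  have hK : K ≠ ⊤ := ENNReal.mul_ne_top ENNReal.ofReal_ne_top (by simp)
  have hD : (C₂ * K * ∑' k : ℕ, gw 1 ^ k) ^ θ ≠ ⊤ :=
    ENNReal.rpow_ne_top_of_nonneg (by linarith) (ENNReal.mul_ne_top
      (ENNReal.mul_ne_top ENNReal.coe_ne_top hK) (tsum_gw_ne_top one_pos))
  refine ⟨C₁ * ((C₂ * K * ∑' k : ℕ, gw 1 ^ k) ^ θ).toNNReal, fun h δ hδ hh c => ?_⟩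
  have hz1 : ∀ i, ‖tr φ h i‖ ≤ 1 := fun i => (norm_tr h i).le
  refine (hC₁ (tr φ h) (hN h) hz1 c).trans ?_
  rw [ENNReal.coe_mul, ENNReal.coe_toNNReal hD, mul_assoc]
  refine mul_le_mul_right (hardy hθ fun j => ?_) _
  refine (mul_le_mul_right (hC₂ (tr φ h) (hN.isMult_tr h) hz1 c j) _).trans ?_
  rw [mul_left_comm, mul_assoc]
  refine mul_le_mul_right ?_ _
  rw [← ENNReal.tsum_mul_left, ← ENNReal.tsum_mul_left]
  refine ENNReal.tsum_le_tsum fun k => ?_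
  refine (mul_le_mul_right (mul_le_mul_right (hN.eN_chain_le_psi hα1 hn hδ hh (j + k) c) _)
    _).trans (le_of_eq ?_)
  rw [gw_add, mul_pow, pow_add (gw α), pow_add (2 : ℝ), mul_assoc (2 ^ j)]
  simp only [K]
  ring

/-- Low-frequency terms are controlled by the resolvent difference at a fixed scale. -/
lemma eN_le_psi (hφ : ∀ i, φ i ≠ 0) {t : ℝ} (ht : 1 / 4 ≤ t) (n : ℕ) (c : ι →₀ ℂ) :
    eN N c ≤ 33 ^ n * eN N (psi φ t ^ n • c) := by
  obtain ⟨B, hB, e⟩ := hN.psi_inv_bound hφ (by linarith : 0 < t)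
  have hB' : IsMult N B 33 := by
    refine hB.mono ?_
    have : 2 * π / t ≤ 32 := by
      rw [div_le_iff₀ (by linarith)]
      nlinarith [Real.pi_lt_four]
    linarith
  have := eN_factor_pow hB' e n c
  rw [one_pow, pmul_one] at this
  simpa using this

/-- Finite version of the upper estimate. -/
lemma diff_rpow_le_sum_psi (hφ : ∀ i, φ i ≠ 0) {θ S α : ℝ} (hθ : 1 ≤ θ) (hθ2 : θ ≤ 2) (hα : 0 < α)
    (hS : 0 ≤ S) (hUS : UnifSmooth N θ S) {n : ℕ} (hn : 0 < n) : ∃ C : ℝ≥0, ∀ (h δ : ℝ) (J : ℕ),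
    0 < δ → |h| ≤ δ → 1 / 4 ≤ 2 ^ J * δ → ∀ c : ι →₀ ℂ, eN N (oneSubPow (tr φ h) α • c) ^ θ ≤
      C * ∑ j ∈ Finset.range (J + 1), (gw α ^ j * eN N (psi φ (2 ^ j * δ) ^ n • c)) ^ θ := by
  obtain ⟨C, hC⟩ := hN.diff_rpow_le_tsum_psi hθ hθ2 hα hS hUS hn
  have hθ0 : 0 ≤ θ := by linarith
  set G : ℝ≥0∞ := ∑' k : ℕ, gw (α * θ) ^ k
  set K : ℝ≥0∞ := (66 ^ n) ^ θ * G
  have hK : K ≠ ⊤ := ENNReal.mul_ne_top (ENNReal.rpow_ne_top_of_nonneg hθ0 (by simp))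
    (tsum_gw_ne_top (by positivity))
  refine ⟨C * K.toNNReal, fun h δ J hδ hh hJ c => (hC h δ hδ hh c).trans ?_⟩
  rw [ENNReal.coe_mul, ENNReal.coe_toNNReal hK, mul_assoc]
  refine mul_le_mul_right ?_ _
  set a : ℕ → ℝ≥0∞ := fun j => (gw α ^ j * eN N (psi φ (2 ^ j * δ) ^ n • c)) ^ θ with ha
  have hG1 : 1 ≤ G := by
    exact (pow_zero _).symm.le.trans (ENNReal.le_tsum (f := fun k : ℕ => gw (α * θ) ^ k) 0)
  have h66 : ∀ j, eN N (psi φ (2 ^ j * δ) ^ n • c) ≤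
      66 ^ n * eN N (psi φ (2 ^ J * δ) ^ n • c) := by
    intro j
    refine (((hN.isMult_psi (2 ^ j * δ)).pow n).eN_le c).trans ?_
    refine (mul_le_mul_right (hN.eN_le_psi hφ hJ n c) _).trans (le_of_eq ?_)
    rw [← mul_assoc, ENNReal.ofReal_pow (by norm_num), ← mul_pow]
    norm_num
  have htail : ∀ k, a (J + k) ≤ (66 ^ n) ^ θ * gw (α * θ) ^ k * a J := by
    intro k
    simp only [ha]
    have : gw (α * θ) ^ k = (gw α ^ k) ^ θ := by
      rw [← gw_rpow, ← ENNReal.rpow_natCast, ← ENNReal.rpow_natCast, ← ENNReal.rpow_mul,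
        ← ENNReal.rpow_mul, mul_comm]
    rw [this, ← ENNReal.mul_rpow_of_nonneg _ _ hθ0, ← ENNReal.mul_rpow_of_nonneg _ _ hθ0]
    refine ENNReal.rpow_le_rpow ((mul_le_mul_right (h66 (J + k)) _).trans (le_of_eq ?_)) hθ0
    rw [pow_add]; ring
  have h66' : (1:ℝ≥0∞) ≤ (66 ^ n) ^ θ := by
    refine ENNReal.one_le_rpow (one_le_pow₀ (by norm_num)) (by linarith)
  calc ∑' j, a j = ∑ j ∈ Finset.range J, a j + ∑' k, a (J + k) := by
        rw [← ENNReal.summable.sum_add_tsum_nat_add' (f := a) (k := J)]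
        simp_rw [add_comm J]
    _ ≤ K * ∑ j ∈ Finset.range J, a j + K * a J := by
        refine add_le_add ?_ ?_
        · exact le_mul_of_one_le_left zero_le (one_le_mul h66' hG1)
        · refine (ENNReal.tsum_le_tsum htail).trans (le_of_eq ?_)
          rw [ENNReal.tsum_mul_right, ENNReal.tsum_mul_left]
    _ = _ := by rw [Finset.sum_range_succ, mul_add]

/-- Lower estimate under uniform convexity. -/
lemma tsum_psi_rpow_le (hφ : ∀ i, φ i ≠ 0) {τ S α : ℝ} (hτ : 1 ≤ τ) (hα : 0 < α) (hS : 0 < S)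
    (hUC : UnifConvex N τ S) {n : ℕ} (hn : α + 1 < n) : ∃ C : ℝ≥0, ∀ δ : ℝ, 0 < δ →
    ∀ c : ι →₀ ℂ, ∑' j : ℕ, (gw α ^ j * eN N (psi φ (2 ^ j * δ) ^ n • c)) ^ τ ≤
      C * (eN N (oneSubPow (tr φ δ) α • c) + eN N (psi φ δ ^ n • c)) ^ τ := by
  have hτ0 : 0 ≤ τ := by linarith
  obtain ⟨C₁, hC₁⟩ := chain_convex (N := N) hτ hS hα hUC
  set q : ℝ := 3 ^ n * ∑ k ∈ Finset.range n, 2 ^ k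
  set K₁ : ℝ≥0∞ := ENNReal.ofReal q * ENNReal.ofReal (∑' k, |sgnBinom (n - (α + 1)) k|)
  set K₂ : ℝ≥0∞ := 2 ^ n * (ENNReal.ofReal ((∑ k ∈ Finset.range n, 1) ^ n) * 3 ^ n)
  have hK₁ : K₁ ^ τ ≠ ⊤ := ENNReal.rpow_ne_top_of_nonneg hτ0
    (ENNReal.mul_ne_top ENNReal.ofReal_ne_top ENNReal.ofReal_ne_top)
  have hK₂ : K₂ ^ τ ≠ ⊤ := ENNReal.rpow_ne_top_of_nonneg hτ0
    (ENNReal.mul_ne_top (by simp) (ENNReal.mul_ne_top ENNReal.ofReal_ne_top (by simp)))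
  set K : ℝ≥0∞ := 2 ^ (τ - 1) * (K₁ ^ τ * C₁ + K₂ ^ τ * ∑' j : ℕ, gw (α * τ) ^ j)
  have hK : K ≠ ⊤ := by
    refine ENNReal.mul_ne_top (ENNReal.rpow_ne_top_of_nonneg (by linarith) (by simp))
      (ENNReal.add_ne_top.2 ⟨ENNReal.mul_ne_top hK₁ ENNReal.coe_ne_top, ENNReal.mul_ne_top hK₂
        (tsum_gw_ne_top (by positivity))⟩)
  refine ⟨K.toNNReal, fun δ hδ c => ?_⟩
  rw [ENNReal.coe_toNNReal hK]
  have hz1 : ∀ i, ‖tr φ δ i‖ ≤ 1 := fun i => (norm_tr δ i).le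
  set U := avg φ δ
  have hU : IsMult N U 1 := hN.isMult_avg δ
  have hUn : IsMult N (U ^ n) 1 := by simpa using hU.pow n
  set Q : ι → ℂ := ∑ k ∈ Finset.range n, (1 - U ^ n) ^ k
  have hQ : IsMult N Q (∑ k ∈ Finset.range n, 2 ^ k) :=
    IsMult.sum _ fun k _ => ((isMult_one.sub hUn).mono (by norm_num)).pow k
  have hQe : Q * U ^ n = 1 - (1 - U ^ n) ^ n := by
    have := geom_sum_mul_neg (1 - U ^ n) n
    rwa [sub_sub_cancel] at this
  have h1 : ∀ j : ℕ, eN N ((psi φ (2 ^ j * δ) ^ n * (U ^ n * Q)) • c) ≤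
      K₁ * eN N (oneSubPow (chain (tr φ δ) j) (α + 1) • c) := by
    intro j
    obtain ⟨B, hB, e⟩ := hN.psi_mul_avg_factor (δ := δ) j
    refine (eN_factor ((hB.pow n).mul hQ)
      (m' := (1 - chain (tr φ δ) j) ^ n) ?_ c).trans ?_
    · rw [← mul_assoc, ← mul_pow, e, mul_pow]; ring
    · rw [mul_assoc]
      exact mul_le_mul_right (eN_oneSub_pow_le (by linarith) hn
        (isMult_chain (hN.isMult_tr δ) hz1 j) (norm_chain_le hz1 j) c) _
  have h2 : ∀ j : ℕ, eN N ((psi φ (2 ^ j * δ) ^ n * (1 - U ^ n) ^ n) • c) ≤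
      K₂ * eN N (psi φ δ ^ n • c) := by
    intro j
    obtain ⟨B, hB, e⟩ := hN.one_sub_avg_factor hφ hδ
    have e2 : (1 - U ^ n) ^ n = (∑ k ∈ Finset.range n, U ^ k) ^ n * (1 - U) ^ n := by
      rw [← mul_pow, geom_sum_mul_neg]
    have hs : IsMult N (∑ k ∈ Finset.range n, U ^ k) (∑ k ∈ Finset.range n, 1) :=
      IsMult.sum _ fun k _ => by simpa using hU.pow k
    rw [pmul_mul]
    refine (((hN.isMult_psi (2 ^ j * δ)).pow n).eN_le _).trans ?_
    rw [mul_assoc, ENNReal.ofReal_pow (by norm_num), ENNReal.ofReal_ofNat]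
    refine mul_le_mul_right ?_ _
    refine (eN_factor (hs.pow n) e2 c).trans ?_
    rw [mul_assoc]
    refine mul_le_mul_right ?_ _
    simpa using eN_factor_pow hB e n c
  have h3 : ∀ j : ℕ, (gw α ^ j * eN N (psi φ (2 ^ j * δ) ^ n • c)) ^ τ ≤
      2 ^ (τ - 1) * (K₁ ^ τ * (gw α ^ j * eN N (oneSubPow (chain (tr φ δ) j) (α + 1) • c)) ^ τ +
        K₂ ^ τ * (gw (α * τ) ^ j * eN N (psi φ δ ^ n • c) ^ τ)) := by
    intro j
    have e : psi φ (2 ^ j * δ) ^ n = psi φ (2 ^ j * δ) ^ n * (U ^ n * Q) +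
        psi φ (2 ^ j * δ) ^ n * (1 - U ^ n) ^ n := by
      rw [mul_comm (U ^ n), hQe]; ring
    have h4 : eN N (psi φ (2 ^ j * δ) ^ n • c) ≤
        K₁ * eN N (oneSubPow (chain (tr φ δ) j) (α + 1) • c) + K₂ * eN N (psi φ δ ^ n • c) := by
      rw [e, pmul_add]
      exact (eN_add_le _ _).trans (add_le_add (h1 j) (h2 j))
    have e5 : gw (α * τ) ^ j = (gw α ^ j) ^ τ := by
      rw [← gw_rpow, ← ENNReal.rpow_natCast, ← ENNReal.rpow_natCast, ← ENNReal.rpow_mul,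
        ← ENNReal.rpow_mul, mul_comm]
    rw [e5, ← ENNReal.mul_rpow_of_nonneg _ _ hτ0, ← ENNReal.mul_rpow_of_nonneg _ _ hτ0,
      ← ENNReal.mul_rpow_of_nonneg _ _ hτ0]
    refine le_trans (ENNReal.rpow_le_rpow ((mul_le_mul_right h4 _).trans (le_of_eq ?_)) hτ0)
      (ENNReal.rpow_add_le_mul_rpow_add_rpow _ _ hτ)
    ring
  refine (ENNReal.tsum_le_tsum h3).trans ?_
  rw [ENNReal.tsum_mul_left, ENNReal.tsum_add, ENNReal.tsum_mul_left, ENNReal.tsum_mul_left,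
    ENNReal.tsum_mul_right, mul_assoc]
  refine mul_le_mul_right ?_ _
  have h6 := hC₁ (tr φ δ) (hN.isMult_tr δ) hz1 c
  rw [add_mul, mul_assoc, mul_assoc]
  refine add_le_add (mul_le_mul_right (h6.trans (mul_le_mul_right ?_ _)) _)
    (mul_le_mul_right (mul_le_mul_right ?_ _) _)
  · exact ENNReal.rpow_le_rpow le_self_add hτ0
  · exact ENNReal.rpow_le_rpow le_add_self hτ0

end TransInv

end OneDim

section ResolventByDifferences

variable {ι : Type*} {N : Seminorm ℂ (ι →₀ ℂ)} {φ : ι → ℤ}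

/-- Symbol of the average of the differences of order `n` over steps in `[0,t]`. -/
def avgDiff (φ : ι → ℤ) (n : ℕ) (t : ℝ) : ι → ℂ := fun i => ∫ s in (0:ℝ)..1, (1 - tr φ (s * t) i) ^ n

lemma continuous_one_sub_tr_pow (n : ℕ) (t : ℝ) (i : ι) :
    Continuous fun s : ℝ => (1 - tr φ (s * t) i) ^ n :=
  (continuous_const.sub (continuous_tr t i)).pow n

lemma avgDiff_eq (n : ℕ) (t : ℝ) (i : ι) : avgDiff φ n t i =
    1 + ∑ k ∈ Finset.range n, (-1) ^ (k + 1) * (n.choose (k + 1) : ℂ) *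
      avg φ (((k + 1 : ℕ) : ℝ) * t) i := by
  have e : ∀ s : ℝ, (1 - tr φ (s * t) i) ^ n = ∑ k ∈ Finset.range (n + 1),
      (-1) ^ k * (n.choose k : ℂ) * tr φ (s * ((k : ℝ) * t)) i := by
    intro s
    rw [sub_eq_neg_add, add_pow]
    refine Finset.sum_congr rfl fun k _ => ?_
    have : tr φ (s * ((k : ℝ) * t)) i = tr φ (s * t) i ^ k := by
      rw [← Pi.pow_apply, ← tr_nat_mul]; congr 1; ring
    rw [this, neg_pow]; ring
  simp_rw [avgDiff, e]
  rw [intervalIntegral.integral_finsetSum fun k _ =>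
    ((continuous_tr _ i).const_mul _).intervalIntegrable _ _]
  rw [Finset.sum_range_succ', add_comm]
  congr 1
  · simp [tr_zero]
  · refine Finset.sum_congr rfl fun k _ => ?_
    rw [intervalIntegral.integral_const_mul, avg]

namespace TransInv

variable (hN : TransInv N φ)
include hN

lemma isMult_avgDiff (n : ℕ) (t : ℝ) : IsMult N (avgDiff φ n t) (2 ^ n) := by
  refine isMult_intervalIntegral (w := fun s => (1 - tr φ (s * t)) ^ n)
    (continuous_one_sub_tr_pow n t) (fun _ => rfl) fun s _ _ => ?_
  exact ((isMult_one.sub (hN.isMult_tr _)).mono (by norm_num)).pow n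

lemma psi_mul_avgDiff_factor (n : ℕ) : ∃ C : ℝ, ∀ t : ℝ, ∃ B, IsMult N B C ∧
    psi φ t * (1 - avgDiff φ n t) = B * (1 - tr φ t) := by
  refine ⟨_, fun t => ⟨res φ t * -∑ k ∈ Finset.range n,
    (((-1) ^ (k + 1) * (n.choose (k + 1) : ℂ)) / ((k + 1 : ℕ) : ℂ)) •
      ∑ l ∈ Finset.range (k + 1), tr φ t ^ l,
    (hN.isMult_res t).mul (IsMult.neg (IsMult.sum _ fun k _ => IsMult.smul _
      (IsMult.sum _ fun l _ => (hN.isMult_tr t).pow l))), ?_⟩⟩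
  funext i
  simp only [Pi.mul_apply, Pi.sub_apply, Pi.one_apply, Pi.neg_apply, Finset.sum_apply,
    Pi.smul_apply, Pi.pow_apply, smul_eq_mul, avgDiff_eq]
  have e1 : ∀ k : ℕ, t * (φ i * Complex.I) * ((-1) ^ (k + 1) * (n.choose (k + 1) : ℂ) *
      avg φ (((k + 1 : ℕ) : ℝ) * t) i) = ((-1) ^ (k + 1) * (n.choose (k + 1) : ℂ)) /
        ((k + 1 : ℕ) : ℂ) * (∑ l ∈ Finset.range (k + 1), tr φ t i ^ l) * (1 - tr φ t i) := by
    intro k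
    have hk : ((k + 1 : ℕ) : ℂ) ≠ 0 := by exact_mod_cast Nat.succ_ne_zero k
    have h := mul_avg (φ := φ) (((k + 1 : ℕ) : ℝ) * t) i
    rw [tr_nat_mul, Pi.pow_apply, ← geom_sum_mul_neg] at h
    rw [mul_assoc _ _ (1 - tr φ t i), ← h, div_mul_eq_mul_div, eq_div_iff hk]
    push_cast
    ring
  rw [psi, res, sub_add_cancel_left, mul_neg, mul_neg, neg_mul, div_mul_eq_mul_div, Finset.mul_sum,
    Finset.sum_congr rfl fun k _ => e1 k, ← Finset.sum_mul, one_div, div_eq_inv_mul, mul_assoc]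

/-- Resolvent differences are controlled by differences with steps at most `t`. -/
lemma psi_pow_le_of_diff_le {β : ℝ} (hβ : 0 < β) {n : ℕ} (hn : β < n) : ∃ C : ℝ≥0, ∀ t : ℝ, 0 < t →
    ∀ (c : ι →₀ ℂ) (R : ℝ≥0∞), (∀ h : ℝ, |h| ≤ t → eN N (oneSubPow (tr φ h) β • c) ≤ R) →
      eN N (psi φ t ^ n • c) ≤ C * R := by
  obtain ⟨D, hD⟩ := hN.psi_mul_avgDiff_factor n
  set K : ℝ≥0∞ := ENNReal.ofReal (∑' k, |sgnBinom (n - β) k|)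
  set K₁ : ℝ≥0∞ := ENNReal.ofReal (2 ^ n * ∑ k ∈ Finset.range n, (1 + 2 ^ n) ^ k)
  set K₂ : ℝ≥0∞ := ENNReal.ofReal (D ^ n)
  have hK : K₁ * K + K₂ * K ≠ ⊤ := by simp [K, K₁, K₂, ENNReal.mul_eq_top]
  refine ⟨(K₁ * K + K₂ * K).toNNReal + 1, fun t ht c R hR => ?_⟩
  have hz1 : ∀ h, ∀ i, ‖tr φ h i‖ ≤ 1 := fun h i => (norm_tr h i).le
  rcases eq_or_ne R ⊤ with rfl | hRt
  · rw [ENNReal.mul_top (by simp)]; exact le_top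
  have hd : ∀ h : ℝ, |h| ≤ t → eN N ((1 - tr φ h) ^ n • c) ≤ K * R := fun h hh =>
    (eN_oneSub_pow_le hβ hn (hN.isMult_tr h) (hz1 h) c).trans (mul_le_mul_right (hR h hh) _)
  set A := avgDiff φ n t with hAdef
  have hQ : IsMult N (1 - A) (1 + 2 ^ n) := isMult_one.sub (hN.isMult_avgDiff n t)
  have hS : IsMult N (∑ k ∈ Finset.range n, (1 - A) ^ k)
      (∑ k ∈ Finset.range n, (1 + 2 ^ n) ^ k) := IsMult.sum _ fun k _ => hQ.pow k
  have hKR : K * R ≠ ⊤ := ENNReal.mul_ne_top ENNReal.ofReal_ne_top hRt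
  have hA : eN N (A • c) ≤ K * R := by
    rw [← ENNReal.ofReal_toReal hKR]
    refine ENNReal.ofReal_le_ofReal ?_
    have := seminorm_integral_le (N := N) (μ := volume.restrict (Set.Ioc 0 1))
      (w := fun s => (1 - tr φ (s * t)) ^ n) (R := fun _ => (K * R).toReal) (m := A)
      (fun i => ((continuous_one_sub_tr_pow n t i).intervalIntegrable 0 1).1) (fun i => ?_)
      (integrable_const _) c ?_
    · simpa using this
    · rw [hAdef, avgDiff, intervalIntegral.integral_of_le zero_le_one]; rfl
    · refine (ae_restrict_iff' measurableSet_Ioc).2 (Filter.Eventually.of_forall fun s hs => ?_)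
      have h1 : |s * t| ≤ t := by
        rw [abs_of_nonneg (mul_nonneg hs.1.le ht.le)]
        nlinarith [hs.2]
      have := hd _ h1
      exact (ENNReal.ofReal_le_iff_le_toReal hKR).1 this
  obtain ⟨B, hB, e⟩ := hD t
  have hsplit : psi φ t ^ n = psi φ t ^ n * (∑ k ∈ Finset.range n, (1 - A) ^ k) * A +
      (psi φ t * (1 - A)) ^ n := by
    have := geom_sum_mul_neg (1 - A) n
    rw [sub_sub_cancel] at this
    rw [mul_assoc, this, mul_pow]; ring
  rw [hsplit, e, mul_pow, pmul_add]
  refine (eN_add_le _ _).trans ?_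
  rw [ENNReal.coe_add, ENNReal.coe_toNNReal hK]
  refine le_trans ?_ (mul_le_mul_left le_self_add _)
  rw [add_mul, mul_assoc K₁, mul_assoc K₂]
  refine add_le_add ?_ ?_
  · refine (eN_factor (((hN.isMult_psi t).pow n).mul hS) (by rw [mul_assoc]) c).trans ?_
    exact mul_le_mul_right hA _
  · refine (eN_factor (hB.pow n) rfl c).trans (mul_le_mul_right (hd t ?_) _)
    rw [abs_of_pos ht]

end TransInv

end ResolventByDifferences

section TwoDim

/-- Hardy's inequality for double sequences. -/
lemma hardy_two {σ : ℝ} (hσ : 1 ≤ σ) {X Y : ℕ → ℕ → ℝ≥0∞} {C q r : ℝ≥0∞}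
    (h : ∀ j k, X j k ≤ C * ∑' a : ℕ, q ^ a * ∑' b : ℕ, r ^ b * Y (j + a) (k + b)) :
    ∑' j, ∑' k, X j k ^ σ ≤
      (C * ∑' a : ℕ, q ^ a) ^ σ * ((1 * ∑' b : ℕ, r ^ b) ^ σ * ∑' j, ∑' k, Y j k ^ σ) := by
  set Z : ℕ → ℕ → ℝ≥0∞ := fun j k => ∑' b : ℕ, r ^ b * Y j (k + b)
  calc ∑' j, ∑' k, X j k ^ σ = ∑' k, ∑' j, X j k ^ σ := ENNReal.tsum_comm
    _ ≤ ∑' k, (C * ∑' a : ℕ, q ^ a) ^ σ * ∑' j, Z j k ^ σ :=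
        ENNReal.tsum_le_tsum fun k => hardy hσ fun j => h j k
    _ = (C * ∑' a : ℕ, q ^ a) ^ σ * ∑' j, ∑' k, Z j k ^ σ := by
        rw [ENNReal.tsum_mul_left, ENNReal.tsum_comm]
    _ ≤ _ := by
        refine mul_le_mul_right ?_ _
        rw [← ENNReal.tsum_mul_left]
        exact ENNReal.tsum_le_tsum fun j => hardy hσ fun k => (one_mul _).symm.le

variable {ι : Type*} {N : Seminorm ℂ (ι →₀ ℂ)} {φ ψ : ι → ℤ}

/-- Mixed modulus of smoothness of a trigonometric polynomial, on the side of coefficients. -/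
def coefMod (N : Seminorm ℂ (ι →₀ ℂ)) (φ ψ : ι → ℤ) (a b t u : ℝ) (c : ι →₀ ℂ) : ℝ≥0∞ :=
  ⨆ (h : ℝ) (_ : |h| ≤ t) (k : ℝ) (_ : |k| ≤ u),
    eN N (oneSubPow (tr φ h) a • oneSubPow (tr ψ k) b • c)

lemma le_coefMod {a b t u h k : ℝ} (hh : |h| ≤ t) (hk : |k| ≤ u) (c : ι →₀ ℂ) :
    eN N (oneSubPow (tr φ h) a • oneSubPow (tr ψ k) b • c) ≤ coefMod N φ ψ a b t u c :=
  le_iSup_of_le h (le_iSup_of_le hh (le_iSup_of_le k (le_iSup_of_le hk le_rfl)))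

lemma coefMod_le {a b t u : ℝ} {c : ι →₀ ℂ} {R : ℝ≥0∞} (H : ∀ h k : ℝ, |h| ≤ t → |k| ≤ u →
    eN N (oneSubPow (tr φ h) a • oneSubPow (tr ψ k) b • c) ≤ R) : coefMod N φ ψ a b t u c ≤ R :=
  iSup_le fun h => iSup_le fun hh => iSup_le fun k => iSup_le fun hk => H h k hh hk

variable (hφ : TransInv N φ) (hψ : TransInv N ψ)
include hφ hψ

/-- Double resolvent differences are controlled by the mixed modulus. -/
lemma psi_psi_le_coefMod {a b : ℝ} (ha : 0 < a) (hb : 0 < b) {n : ℕ} (han : a < n) (hbn : b < n) :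
    ∃ C : ℝ≥0, 1 ≤ C ∧ ∀ t u : ℝ, 0 < t → 0 < u → ∀ c : ι →₀ ℂ,
      (∀ k, |k| ≤ u → eN N (psi φ t ^ n • oneSubPow (tr ψ k) b • c) ≤
        C * coefMod N φ ψ a b t u c) ∧
      (∀ h, |h| ≤ t → eN N (oneSubPow (tr φ h) a • psi ψ u ^ n • c) ≤
        C * coefMod N φ ψ a b t u c) ∧
      eN N (psi φ t ^ n • psi ψ u ^ n • c) ≤ C * coefMod N φ ψ a b t u c := by
  obtain ⟨C₁, h₁⟩ := hφ.psi_pow_le_of_diff_le ha han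
  obtain ⟨C₂, h₂⟩ := hψ.psi_pow_le_of_diff_le hb hbn
  have hC₁ : (C₁:ℝ≥0∞) ≤ ((C₁ + 1) * (C₂ + 1) : ℝ≥0) := by
    refine ENNReal.coe_le_coe.2 (le_self_add.trans (le_mul_of_one_le_right zero_le le_add_self))
  have hC₂ : (C₂:ℝ≥0∞) ≤ ((C₁ + 1) * (C₂ + 1) : ℝ≥0) := by
    refine ENNReal.coe_le_coe.2 (le_self_add.trans (le_mul_of_one_le_left zero_le le_add_self))
  have hC₃ : (C₁:ℝ≥0∞) * C₂ ≤ ((C₁ + 1) * (C₂ + 1) : ℝ≥0) := by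
    rw [← ENNReal.coe_mul]
    exact ENNReal.coe_le_coe.2 (mul_le_mul' le_self_add le_self_add)
  refine ⟨(C₁ + 1) * (C₂ + 1), one_le_mul le_add_self le_add_self, fun t u ht hu c => ?_⟩
  have h3 : ∀ h, |h| ≤ t → eN N (oneSubPow (tr φ h) a • psi ψ u ^ n • c) ≤
      C₂ * coefMod N φ ψ a b t u c := fun h hh => by
    rw [pmul_comm]
    refine h₂ u hu _ _ fun k hk => ?_
    rw [pmul_comm]
    exact le_coefMod hh hk c
  refine ⟨fun k hk => ?_, fun h hh => (h3 h hh).trans (mul_le_mul_left hC₂ _), ?_⟩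
  · exact (h₁ t ht _ _ fun h hh => le_coefMod hh hk c).trans (mul_le_mul_left hC₁ _)
  · refine (h₁ t ht _ _ h3).trans ?_
    rw [← mul_assoc]
    exact mul_le_mul_left hC₃ _

/-- The sharp Marchaud inequality on the side of coefficients. -/
lemma tsum_coefMod_rpow_le (hφ0 : ∀ i, φ i ≠ 0) (hψ0 : ∀ i, ψ i ≠ 0) {τ S : ℝ} (hτ : 1 ≤ τ)
    (hS : 0 < S) (hUC : UnifConvex N τ S) {a b a' b' : ℝ} (ha : 0 < a) (hb : 0 < b) (haa : a < a')
    (hbb : b < b') : ∃ C : ℝ≥0, ∀ t u : ℝ, 0 < t → 0 < u → ∀ c : ι →₀ ℂ,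
      ∑' j : ℕ, ∑' k : ℕ, (gw a ^ j * gw b ^ k *
        coefMod N φ ψ a' b' (2 ^ j * t) (2 ^ k * u) c) ^ τ ≤
      C * coefMod N φ ψ a b t u c ^ τ := by
  have hτ0 : 0 ≤ τ := by linarith
  obtain ⟨n, hn⟩ := exists_nat_gt (max a b + 1)
  have hna : a + 1 < n := by linarith [le_max_left a b]
  have hnb : b + 1 < n := by linarith [le_max_right a b]
  have hn0 : 0 < n := by
    have : (0:ℝ) < n := by linarith
    exact_mod_cast this
  obtain ⟨A₁, hA₁⟩ := hφ.diff_le_tsum_psi (ha.trans haa) hn0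
  obtain ⟨A₂, hA₂⟩ := hψ.diff_le_tsum_psi (hb.trans hbb) hn0
  obtain ⟨B₁, hB₁⟩ := hφ.tsum_psi_rpow_le hφ0 hτ ha hS hUC hna
  obtain ⟨B₂, hB₂⟩ := hψ.tsum_psi_rpow_le hψ0 hτ hb hS hUC hnb
  obtain ⟨D, hD1, hD⟩ := psi_psi_le_coefMod hφ hψ ha hb (by linarith : a < n) (by linarith : b < n)
  set K : ℝ≥0∞ := ((A₁ * A₂ : ℝ≥0) * ∑' i : ℕ, gw (a' - a) ^ i) ^ τ *
    ((1 * ∑' i : ℕ, gw (b' - b) ^ i) ^ τ *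
      (B₂ * (2 ^ (τ - 1) * (B₁ * (2 * D : ℝ≥0∞) ^ τ + B₁ * (2 * D : ℝ≥0∞) ^ τ))))
  have hDt : (2 * D : ℝ≥0∞) ^ τ ≠ ⊤ := ENNReal.rpow_ne_top_of_nonneg hτ0
    (ENNReal.mul_ne_top (by simp) ENNReal.coe_ne_top)
  have hK : K ≠ ⊤ := by
    refine ENNReal.mul_ne_top (ENNReal.rpow_ne_top_of_nonneg hτ0 (ENNReal.mul_ne_top
      ENNReal.coe_ne_top (tsum_gw_ne_top (by linarith)))) (ENNReal.mul_ne_top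
      (ENNReal.rpow_ne_top_of_nonneg hτ0 (ENNReal.mul_ne_top (by simp)
      (tsum_gw_ne_top (by linarith)))) (ENNReal.mul_ne_top ENNReal.coe_ne_top
      (ENNReal.mul_ne_top (ENNReal.rpow_ne_top_of_nonneg (by linarith) (by simp)) ?_)))
    exact ENNReal.add_ne_top.2 ⟨ENNReal.mul_ne_top ENNReal.coe_ne_top hDt,
      ENNReal.mul_ne_top ENNReal.coe_ne_top hDt⟩
  refine ⟨K.toNNReal, fun t u ht hu c => ?_⟩
  rw [ENNReal.coe_toNNReal hK]
  set W := coefMod N φ ψ a b t u c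
  set P : ℕ → ℕ → ℝ≥0∞ := fun j k => eN N (psi φ (2 ^ j * t) ^ n • psi ψ (2 ^ k * u) ^ n • c)
  obtain ⟨hD2, hD3, hD4⟩ := hD t u ht hu c
  have hgw : ∀ x x' : ℝ, ∀ j i : ℕ, gw x ^ j * gw x' ^ i = gw (x' - x) ^ i * gw x ^ (j + i) := by
    intro x x' j i
    have : gw x' = gw (x' - x) * gw x := by rw [← gw_add]; congr 1; ring
    rw [this, mul_pow, pow_add]; ring
  have h1 : ∀ j k, gw a ^ j * gw b ^ k * coefMod N φ ψ a' b' (2 ^ j * t) (2 ^ k * u) c ≤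
      (A₁ * A₂ : ℝ≥0) * ∑' i : ℕ, gw (a' - a) ^ i * ∑' l : ℕ, gw (b' - b) ^ l *
        (gw a ^ (j + i) * gw b ^ (k + l) * P (j + i) (k + l)) := by
    intro j k
    have h2 : coefMod N φ ψ a' b' (2 ^ j * t) (2 ^ k * u) c ≤
        A₁ * ∑' i : ℕ, gw a' ^ i * (A₂ * ∑' l : ℕ, gw b' ^ l * P (j + i) (k + l)) := by
      refine coefMod_le fun h h' hh hh' => ?_
      refine (hA₁ h _ (by positivity) hh _).trans (mul_le_mul_right
        (ENNReal.tsum_le_tsum fun i => mul_le_mul_right ?_ _) _)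
      rw [pmul_comm]
      refine (hA₂ h' _ (by positivity) hh' _).trans (le_of_eq ?_)
      congr 2 with l
      rw [pmul_comm, ← mul_assoc (2 ^ i), ← mul_assoc (2 ^ l), ← pow_add, ← pow_add, add_comm i,
        add_comm l]
    refine (mul_le_mul_right h2 _).trans (le_of_eq ?_)
    rw [ENNReal.coe_mul, mul_left_comm, mul_assoc (A₁ : ℝ≥0∞)]
    refine congrArg _ ?_
    rw [← ENNReal.tsum_mul_left, ← ENNReal.tsum_mul_left]
    refine tsum_congr fun i => ?_
    rw [← ENNReal.tsum_mul_left, ← ENNReal.tsum_mul_left, ← ENNReal.tsum_mul_left,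
      ← ENNReal.tsum_mul_left, ← ENNReal.tsum_mul_left]
    refine tsum_congr fun l => ?_
    have e1 := hgw a a' j i
    have e2 := hgw b b' k l
    calc gw a ^ j * gw b ^ k * (gw a' ^ i * (A₂ * (gw b' ^ l * P (j + i) (k + l))))
        = A₂ * (gw a ^ j * gw a' ^ i) * (gw b ^ k * gw b' ^ l) * P (j + i) (k + l) := by ring
      _ = _ := by rw [e1, e2]; ring
  refine (hardy_two (Y := fun j k => gw a ^ j * gw b ^ k * P j k) hτ h1).trans ?_
  simp only [K]
  rw [mul_assoc, mul_assoc (_ ^ τ)]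
  refine mul_le_mul_right (mul_le_mul_right ?_ _) _
  have e2D : (2 * D : ℝ≥0∞) * W = D * W + D * W := by ring
  have hW : W ≤ D * W := le_mul_of_one_le_left zero_le (by exact_mod_cast hD1)
  have hD2' := hD2 u (abs_of_pos hu).le
  have hD3' := hD3 t (abs_of_pos ht).le
  have h3 : ∀ j, ∑' k, (gw a ^ j * gw b ^ k * P j k) ^ τ ≤ B₂ * (2 ^ (τ - 1) *
      ((gw a ^ j * eN N (psi φ (2 ^ j * t) ^ n • oneSubPow (tr ψ u) b • c)) ^ τ +
        (gw a ^ j * eN N (psi φ (2 ^ j * t) ^ n • psi ψ u ^ n • c)) ^ τ)) := by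
    intro j
    have e : ∀ k, (gw a ^ j * gw b ^ k * P j k) ^ τ = (gw a ^ j) ^ τ *
        (gw b ^ k * eN N (psi ψ (2 ^ k * u) ^ n • psi φ (2 ^ j * t) ^ n • c)) ^ τ := by
      intro k
      rw [mul_assoc, ENNReal.mul_rpow_of_nonneg _ _ hτ0, pmul_comm]
    simp_rw [e]
    rw [ENNReal.tsum_mul_left]
    refine (mul_le_mul_right (hB₂ u hu _) _).trans ?_
    rw [mul_left_comm, ← ENNReal.mul_rpow_of_nonneg _ _ hτ0, mul_add, pmul_comm,
      pmul_comm (psi ψ u ^ n)]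
    exact mul_le_mul_right (ENNReal.rpow_add_le_mul_rpow_add_rpow _ _ hτ) _
  refine (ENNReal.tsum_le_tsum h3).trans ?_
  rw [ENNReal.tsum_mul_left, ENNReal.tsum_mul_left, ENNReal.tsum_add, mul_assoc (B₂ : ℝ≥0∞),
    mul_assoc (2 ^ (τ - 1)), add_mul, mul_assoc (B₁ : ℝ≥0∞), ← ENNReal.mul_rpow_of_nonneg _ _ hτ0]
  refine mul_le_mul_right (mul_le_mul_right (add_le_add ?_ ?_) _) _
  · refine (hB₁ t ht _).trans (mul_le_mul_right (ENNReal.rpow_le_rpow ?_ hτ0) _)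
    rw [e2D]
    exact add_le_add ((le_coefMod (abs_of_pos ht).le (abs_of_pos hu).le c).trans hW) hD2'
  · refine (hB₁ t ht _).trans (mul_le_mul_right (ENNReal.rpow_le_rpow ?_ hτ0) _)
    rw [e2D]
    exact add_le_add hD3' hD4

/-- The sharp Jackson-type inequality on the side of coefficients. -/
lemma coefMod_rpow_le_sum (hφ0 : ∀ i, φ i ≠ 0) (hψ0 : ∀ i, ψ i ≠ 0) {θ S : ℝ} (hθ : 1 ≤ θ)
    (hθ2 : θ ≤ 2) (hS : 0 ≤ S) (hUS : UnifSmooth N θ S) {a b a' b' : ℝ} (ha : 0 < a) (hb : 0 < b)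
    (haa : a < a') (hbb : b < b') : ∃ C : ℝ≥0, ∀ (t u : ℝ) (J J' : ℕ), 0 < t → 0 < u →
      1 / 4 ≤ 2 ^ J * t → 1 / 4 ≤ 2 ^ J' * u → ∀ c : ι →₀ ℂ, coefMod N φ ψ a b t u c ^ θ ≤
        C * ∑ j ∈ Finset.range (J + 1), ∑ k ∈ Finset.range (J' + 1), (gw a ^ j * gw b ^ k *
          coefMod N φ ψ a' b' (2 ^ j * t) (2 ^ k * u) c) ^ θ := by
  have hθ0 : 0 ≤ θ := by linarith
  obtain ⟨n, hn⟩ := exists_nat_gt (max a' b')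
  have hna : a' < n := by linarith [le_max_left a' b']
  have hnb : b' < n := by linarith [le_max_right a' b']
  have hn0 : 0 < n := by
    have : (0:ℝ) < n := by linarith
    exact_mod_cast this
  obtain ⟨A₁, hA₁⟩ := hφ.diff_rpow_le_sum_psi hφ0 hθ hθ2 ha hS hUS hn0
  obtain ⟨A₂, hA₂⟩ := hψ.diff_rpow_le_sum_psi hψ0 hθ hθ2 hb hS hUS hn0
  obtain ⟨D, hD1, hD⟩ := psi_psi_le_coefMod hφ hψ (ha.trans haa) (hb.trans hbb) hna hnb
  set K : ℝ≥0∞ := A₁ * A₂ * (D : ℝ≥0∞) ^ θ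
  have hK : K ≠ ⊤ := ENNReal.mul_ne_top (ENNReal.mul_ne_top ENNReal.coe_ne_top ENNReal.coe_ne_top)
    (ENNReal.rpow_ne_top_of_nonneg hθ0 ENNReal.coe_ne_top)
  refine ⟨K.toNNReal, fun t u J J' ht hu hJ hJ' c => ?_⟩
  rw [ENNReal.coe_toNNReal hK, ← ENNReal.le_rpow_inv_iff (by linarith : 0 < θ)]
  refine coefMod_le fun h k hh hk => ?_
  rw [ENNReal.le_rpow_inv_iff (by linarith : 0 < θ)]
  refine (hA₁ h t J ht hh hJ _).trans ?_
  simp only [K]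
  rw [mul_assoc, mul_assoc]
  refine mul_le_mul_right ?_ _
  rw [Finset.mul_sum, Finset.mul_sum]
  refine Finset.sum_le_sum fun j _ => ?_
  rw [ENNReal.mul_rpow_of_nonneg _ _ hθ0, pmul_comm]
  refine (mul_le_mul_right (hA₂ k u J' hu hk hJ' _) _).trans ?_
  rw [mul_left_comm]
  refine mul_le_mul_right ?_ _
  rw [Finset.mul_sum, Finset.mul_sum]
  refine Finset.sum_le_sum fun l _ => ?_
  rw [← ENNReal.mul_rpow_of_nonneg _ _ hθ0, ← ENNReal.mul_rpow_of_nonneg _ _ hθ0, pmul_comm]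
  refine ENNReal.rpow_le_rpow ?_ hθ0
  refine (mul_le_mul_right (mul_le_mul_right
    (hD (2 ^ j * t) (2 ^ l * u) (by positivity) (by positivity) c).2.2 _) _).trans (le_of_eq ?_)
  ring

end TwoDim

section ScalarInequalities

lemma rpow_eq_sq_rpow_half {a : ℝ} (ha : 0 ≤ a) (p : ℝ) : a ^ p = (a ^ 2) ^ (p / 2) := by
  rw [← Real.rpow_natCast, ← Real.rpow_mul ha]; congr 1; push_cast; ring

lemma rpow_midpoint_le {k a b : ℝ} (hk : 1 ≤ k) (ha : 0 ≤ a) (hb : 0 ≤ b) :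
    ((a + b) / 2) ^ k ≤ (a ^ k + b ^ k) / 2 := by
  have := (convexOn_rpow hk).2 (Set.mem_Ici.2 ha) (Set.mem_Ici.2 hb)
    (by norm_num : (0:ℝ) ≤ 1 / 2) (by norm_num : (0:ℝ) ≤ 1 / 2) (by norm_num)
  simp only [smul_eq_mul] at this
  rw [show (a + b) / 2 = 1 / 2 * a + 1 / 2 * b by ring]
  linarith

lemma le_rpow_midpoint {k a b : ℝ} (hk0 : 0 ≤ k) (hk : k ≤ 1) (ha : 0 ≤ a) (hb : 0 ≤ b) :
    (a ^ k + b ^ k) / 2 ≤ ((a + b) / 2) ^ k := by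
  have := (Real.concaveOn_rpow hk0 hk).2 (Set.mem_Ici.2 ha) (Set.mem_Ici.2 hb)
    (by norm_num : (0:ℝ) ≤ 1 / 2) (by norm_num : (0:ℝ) ≤ 1 / 2) (by norm_num)
  simp only [smul_eq_mul] at this
  rw [show (a + b) / 2 = 1 / 2 * a + 1 / 2 * b by ring]
  linarith

lemma parallelogram_half (x y : ℂ) : (‖x + y‖ ^ 2 + ‖x - y‖ ^ 2) / 2 = ‖x‖ ^ 2 + ‖y‖ ^ 2 := by
  have := parallelogram_law_with_norm ℝ x y
  linarith

lemma clarkson_scalar {p : ℝ} (hp : 2 ≤ p) (x y : ℂ) :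
    ‖x‖ ^ p + ‖y‖ ^ p ≤ (‖x + y‖ ^ p + ‖x - y‖ ^ p) / 2 := by
  have hk : 1 ≤ p / 2 := by linarith
  rw [rpow_eq_sq_rpow_half (norm_nonneg x), rpow_eq_sq_rpow_half (norm_nonneg y),
    rpow_eq_sq_rpow_half (norm_nonneg (x + y)), rpow_eq_sq_rpow_half (norm_nonneg (x - y))]
  refine (Real.add_rpow_le_rpow_add (by positivity) (by positivity) hk).trans ?_
  rw [← parallelogram_half]
  exact rpow_midpoint_le hk (by positivity) (by positivity)

lemma clarkson_scalar' {p : ℝ} (hp0 : 0 ≤ p) (hp : p ≤ 2) (x y : ℂ) :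
    (‖x + y‖ ^ p + ‖x - y‖ ^ p) / 2 ≤ ‖x‖ ^ p + ‖y‖ ^ p := by
  have hk : p / 2 ≤ 1 := by linarith
  rw [rpow_eq_sq_rpow_half (norm_nonneg x), rpow_eq_sq_rpow_half (norm_nonneg y),
    rpow_eq_sq_rpow_half (norm_nonneg (x + y)), rpow_eq_sq_rpow_half (norm_nonneg (x - y))]
  refine (le_rpow_midpoint (by positivity) hk (by positivity) (by positivity)).trans ?_
  rw [parallelogram_half]
  exact Real.rpow_add_le_add_rpow (by positivity) (by positivity) (by positivity) hk

lemma hasSum_sgnBinom_real {k : ℝ} (hk : 0 < k) {s : ℝ} (hs : |s| ≤ 1) :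
    HasSum (fun ν => sgnBinom k ν * s ^ ν) ((1 - s) ^ k) := by
  have h := hasSum_sgnBinom hk (w := (s : ℂ)) (by simpa using hs)
  have e : (1 - (s:ℂ)) ^ (k:ℂ) = (((1 - s) ^ k : ℝ) : ℂ) := by
    rw [Complex.ofReal_cpow (by linarith [(abs_le.1 hs).2])]; push_cast; rfl
  rw [e] at h
  exact_mod_cast h

lemma symm_rpow_le {k : ℝ} (hk : 0 < k) {s : ℝ} (hs : |s| ≤ 1) :
    ((1 + s) ^ k + (1 - s) ^ k) / 2 ≤ 1 + (∑' ν, |sgnBinom k ν|) * s ^ 2 := by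
  have h1 := hasSum_sgnBinom_real hk hs
  have h2 := hasSum_sgnBinom_real hk (s := -s) (by simpa using hs)
  rw [sub_neg_eq_add] at h2
  have h3 := (h2.add h1).div_const 2
  have h4 := (hasSum_ite_eq (0:ℕ) (1:ℝ)).add ((summable_abs_sgnBinom hk).hasSum.mul_right (s ^ 2))
  refine hasSum_le (fun ν => ?_) h3 h4
  match ν with
  | 0 => simp [sgnBinom_zero]; positivity
  | 1 => simp; positivity
  | ν + 2 =>
    have e : |s ^ (ν + 2)| ≤ s ^ 2 := by
      rw [abs_pow, pow_add, sq_abs]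
      exact mul_le_of_le_one_left (sq_nonneg s) (pow_le_one₀ (abs_nonneg s) hs)
    have e' : |(-s) ^ (ν + 2)| ≤ s ^ 2 := by
      rwa [abs_pow, abs_neg, ← abs_pow]
    simp only [Nat.add_eq_zero_iff, OfNat.ofNat_ne_zero, and_false, if_false, zero_add]
    have h5 : sgnBinom k (ν + 2) * s ^ (ν + 2) ≤ |sgnBinom k (ν + 2)| * s ^ 2 :=
      (le_abs_self _).trans (by rw [abs_mul]; exact mul_le_mul_of_nonneg_left e (abs_nonneg _))
    have h6 : sgnBinom k (ν + 2) * (-s) ^ (ν + 2) ≤ |sgnBinom k (ν + 2)| * s ^ 2 :=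
      (le_abs_self _).trans (by rw [abs_mul]; exact mul_le_mul_of_nonneg_left e' (abs_nonneg _))
    linarith

/-- Two-point smoothness inequality. -/
lemma smooth_scalar {q : ℝ} (hq : 2 ≤ q) : ∃ C : ℝ, 1 ≤ C ∧ ∀ x y : ℂ,
    (‖x + y‖ ^ q + ‖x - y‖ ^ q) / 2 ≤ (‖x‖ ^ 2 + C * ‖y‖ ^ 2) ^ (q / 2) := by
  have hk : 1 ≤ q / 2 := by linarith
  set k := q / 2
  set K := ∑' ν, |sgnBinom k ν|
  have hK : 0 ≤ K := tsum_nonneg fun _ => abs_nonneg _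
  refine ⟨1 + 4 * K, by linarith, fun x y => ?_⟩
  rw [rpow_eq_sq_rpow_half (norm_nonneg (x + y)), rpow_eq_sq_rpow_half (norm_nonneg (x - y))]
  have hpar := parallelogram_half x y
  set P := ‖x‖ ^ 2 + ‖y‖ ^ 2 with hP
  have hP0 : 0 ≤ P := by positivity
  rcases hP0.eq_or_lt with h0 | h0
  · have hx : x = 0 := by
      have : ‖x‖ ^ 2 = 0 := by nlinarith [sq_nonneg ‖x‖, sq_nonneg ‖y‖]
      simpa using this
    have hy : y = 0 := by
      have : ‖y‖ ^ 2 = 0 := by nlinarith [sq_nonneg ‖x‖, sq_nonneg ‖y‖]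
      simpa using this
    have hk0 : k ≠ 0 := by linarith
    simp only [hx, hy]
    norm_num [Real.zero_rpow hk0, k]
  set s := (‖x + y‖ ^ 2 - P) / P with hs
  have hPs : P * s = ‖x + y‖ ^ 2 - P := by rw [hs]; field_simp
  have e1 : ‖x + y‖ ^ 2 = P * (1 + s) := by linarith
  have e2 : ‖x - y‖ ^ 2 = P * (1 - s) := by linarith
  have hs1 : |s| ≤ 1 := by
    rw [abs_le]
    constructor
    · nlinarith [sq_nonneg ‖x + y‖]
    · nlinarith [sq_nonneg ‖x - y‖]
  have hsq : P * s ^ 2 ≤ 4 * ‖y‖ ^ 2 := by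
    have b1 : P * s ≤ 2 * ‖x‖ * ‖y‖ := by nlinarith [norm_add_le x y, norm_nonneg (x + y)]
    have b2 : -(P * s) ≤ 2 * ‖x‖ * ‖y‖ := by nlinarith [norm_sub_le x y, norm_nonneg (x - y)]
    have b3 : (P * s) ^ 2 ≤ (2 * ‖x‖ * ‖y‖) ^ 2 := sq_le_sq' (by linarith) b1
    have b4 : P * (P * s ^ 2) ≤ P * (4 * ‖y‖ ^ 2) := by nlinarith [sq_nonneg (‖y‖ ^ 2)]
    exact le_of_mul_le_mul_left b4 h0
  have hs' := abs_le.1 hs1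
  rw [e1, e2, Real.mul_rpow hP0 (by linarith), Real.mul_rpow hP0 (by linarith), ← mul_add,
    mul_div_assoc]
  calc P ^ k * (((1 + s) ^ k + (1 - s) ^ k) / 2) ≤ P ^ k * (1 + K * s ^ 2) :=
        mul_le_mul_of_nonneg_left (symm_rpow_le (by linarith) hs1) (by positivity)
    _ ≤ P ^ k * (1 + K * s ^ 2) ^ k := by
        refine mul_le_mul_of_nonneg_left ?_ (by positivity)
        exact Real.self_le_rpow_of_one_le (by nlinarith [mul_nonneg hK (sq_nonneg s)]) hk
    _ = (P * (1 + K * s ^ 2)) ^ k := by rw [Real.mul_rpow hP0 (by positivity)]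
    _ ≤ _ := Real.rpow_le_rpow (by positivity) (by nlinarith [mul_nonneg hK (sq_nonneg s)])
        (by linarith)

/-- Two-point convexity inequality, dual to `smooth_scalar`. -/
lemma convex_scalar {p : ℝ} (hp1 : 1 < p) (hp : p ≤ 2) : ∃ c : ℝ, 0 < c ∧ c ≤ 1 ∧ ∀ x y : ℂ,
    (‖x‖ ^ 2 + c * ‖y‖ ^ 2) ^ (p / 2) ≤ (‖x + y‖ ^ p + ‖x - y‖ ^ p) / 2 := by
  have hpq := Real.HolderConjugate.conjExponent hp1
  set q := p.conjExponent
  have hp0 : 0 < p := by linarith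
  have hq : 2 ≤ q := by
    have : q = p / (p - 1) := rfl
    rw [this, le_div_iff₀ (by linarith)]; linarith
  obtain ⟨C, hC1, hC⟩ := smooth_scalar hq
  have hc1 : 1 / C ≤ 1 := by rw [div_le_one (by linarith)]; exact hC1
  have hc0 : 0 < 1 / C := by positivity
  refine ⟨1 / C, hc0, hc1, fun x y => ?_⟩
  set c := 1 / C with hc
  have hCc : C * c = 1 := by rw [hc]; field_simp
  set M := ‖x‖ ^ 2 + c * ‖y‖ ^ 2 with hM
  have hM0 : 0 ≤ M := by positivity
  set D := (‖x + y‖ ^ p + ‖x - y‖ ^ p) / 2 with hD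
  have hD0 : 0 ≤ D := by positivity
  rcases hM0.eq_or_lt with h0 | h0
  · rw [← h0, Real.zero_rpow (by positivity)]; exact hD0
  have hdual := hC x (c * y)
  have hcy : ‖(c:ℂ) * y‖ ^ 2 = c ^ 2 * ‖y‖ ^ 2 := by
    rw [norm_mul, Complex.norm_real, Real.norm_of_nonneg hc0.le, mul_pow]
  have e1 : ‖x‖ ^ 2 + C * ‖(c:ℂ) * y‖ ^ 2 = M := by
    rw [hcy, hM]
    linear_combination (c * ‖y‖ ^ 2) * hCc
  rw [e1] at hdual
  set E := (‖x + c * y‖ ^ q + ‖x - c * y‖ ^ q) / 2 with hE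
  have hE0 : 0 ≤ E := by positivity
  have hpair : 2 * M ≤ ‖x + c * y‖ * ‖x + y‖ + ‖x - c * y‖ * ‖x - y‖ := by
    have i1 : inner ℝ (x + c * y) (x + y) + inner ℝ (x - c * y) (x - y) = 2 * M := by
      have e : (c:ℂ) * y = c • y := by simp
      rw [e]
      simp only [inner_add_left, inner_add_right, inner_sub_left, inner_sub_right, inner_smul_left,
        real_inner_self_eq_norm_sq, hM]
      simp
      ring
    rw [← i1]
    exact add_le_add (real_inner_le_norm _ _) (real_inner_le_norm _ _)
  have hhol := Real.inner_le_Lp_mul_Lq (Finset.univ : Finset (Fin 2))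
    ![‖x + c * y‖, ‖x - c * y‖] ![‖x + y‖, ‖x - y‖] hpq.symm
  simp only [Fin.sum_univ_two, Matrix.cons_val_zero, Matrix.cons_val_one, abs_norm] at hhol
  have eE : ‖x + c * y‖ ^ q + ‖x - c * y‖ ^ q = 2 * E := by rw [hE]; ring
  have eD : ‖x + y‖ ^ p + ‖x - y‖ ^ p = 2 * D := by rw [hD]; ring
  have hq0 : 0 < q := by linarith
  rw [eE, eD, Real.mul_rpow zero_le_two hE0, Real.mul_rpow zero_le_two hD0] at hhol
  have e2 : (2:ℝ) ^ (1 / q) * 2 ^ (1 / p) = 2 := by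
    rw [← Real.rpow_add two_pos]
    have : 1 / q + 1 / p = 1 := by
      have := hpq.symm.inv_add_inv_eq_one
      rwa [one_div, one_div]
    rw [this, Real.rpow_one]
  have hE2 : E ^ (1 / q) ≤ M ^ (1 / 2 : ℝ) := by
    refine (Real.rpow_le_rpow hE0 hdual (by positivity)).trans (le_of_eq ?_)
    rw [← Real.rpow_mul hM0]
    congr 1; field_simp
  have h3 : M ≤ M ^ (1 / 2 : ℝ) * D ^ (1 / p) := by
    have h4 : 2 * M ≤ 2 * (E ^ (1 / q) * D ^ (1 / p)) := by
      refine (hpair.trans hhol).trans (le_of_eq ?_)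
      rw [mul_mul_mul_comm, e2]
    have h5 : E ^ (1 / q) * D ^ (1 / p) ≤ M ^ (1 / 2 : ℝ) * D ^ (1 / p) :=
      mul_le_mul_of_nonneg_right hE2 (by positivity)
    linarith
  have hMM : M = M ^ (1 / 2 : ℝ) * M ^ (1 / 2 : ℝ) := by
    rw [← Real.rpow_add h0]; norm_num
  have h6 : M ^ (1 / 2 : ℝ) ≤ D ^ (1 / p) := by
    have hpos : 0 < M ^ (1 / 2 : ℝ) := by positivity
    exact le_of_mul_le_mul_left (hMM ▸ h3) hpos
  calc M ^ (p / 2) = (M ^ (1 / 2 : ℝ)) ^ p := by rw [← Real.rpow_mul hM0]; congr 1; ring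
    _ ≤ (D ^ (1 / p)) ^ p := Real.rpow_le_rpow (by positivity) h6 hp0.le
    _ = D := by rw [← Real.rpow_mul hD0, one_div, inv_mul_cancel₀ hp0.ne', Real.rpow_one]

end ScalarInequalities

section LpGeometry

/-- The seminorm is the `L_p` norm of the functions `T c`. -/
structure IsLpSeminorm {ι X : Type*} [MeasurableSpace X] (N : Seminorm ℂ (ι →₀ ℂ)) (μ : Measure X)
    (T : (ι →₀ ℂ) →ₗ[ℂ] X → ℂ) (p : ℝ) : Prop where
  rpow_eq : ∀ c, N c ^ p = ∫ z, ‖T c z‖ ^ p ∂μ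
  integrable : ∀ c, Integrable (fun z => ‖T c z‖ ^ p) μ

variable {ι X : Type*} [MeasurableSpace X] {N : Seminorm ℂ (ι →₀ ℂ)} {μ : Measure X}
  {T : (ι →₀ ℂ) →ₗ[ℂ] X → ℂ} {p : ℝ}

namespace IsLpSeminorm

variable (h : IsLpSeminorm N μ T p)
include h

lemma integral_midpoint (x y : ι →₀ ℂ) : (N (x + y) ^ p + N (x - y) ^ p) / 2 =
    ∫ z, (‖T x z + T y z‖ ^ p + ‖T x z - T y z‖ ^ p) / 2 ∂μ := by
  have h1 := h.integrable (x + y)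
  have h2 := h.integrable (x - y)
  rw [h.rpow_eq, h.rpow_eq, ← integral_add h1 h2, ← integral_div]
  simp [map_add, map_sub]

lemma integrable_midpoint (x y : ι →₀ ℂ) :
    Integrable (fun z => (‖T x z + T y z‖ ^ p + ‖T x z - T y z‖ ^ p) / 2) μ := by
  have h1 := h.integrable (x + y)
  have h2 := h.integrable (x - y)
  have := (h1.add h2).div_const 2
  simpa [map_add, map_sub] using this

lemma integral_weighted (x y : ι →₀ ℂ) (a b : ℝ) : a * N x ^ p + b * N y ^ p =
    ∫ z, (a * ‖T x z‖ ^ p + b * ‖T y z‖ ^ p) ∂μ := by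
  rw [h.rpow_eq, h.rpow_eq, integral_add ((h.integrable x).const_mul a)
    ((h.integrable y).const_mul b), integral_const_mul, integral_const_mul]

lemma integrable_weighted (x y : ι →₀ ℂ) (a b : ℝ) :
    Integrable (fun z => a * ‖T x z‖ ^ p + b * ‖T y z‖ ^ p) μ :=
  ((h.integrable x).const_mul a).add ((h.integrable y).const_mul b)

omit h in
lemma unifConvex_of {τ c : ℝ}
    (H : ∀ x y, N x ^ τ + c * N y ^ τ ≤ (N (x + y) ^ τ + N (x - y) ^ τ) / 2) :
    UnifConvex N τ c := by
  intro u v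
  have := H ((1/2 : ℂ) • (u + v)) ((1/2 : ℂ) • (u - v))
  rwa [← smul_add, ← smul_sub, show u + v + (u - v) = (2:ℂ) • u by rw [two_smul]; abel,
    show u + v - (u - v) = (2:ℂ) • v by rw [two_smul]; abel, smul_smul, smul_smul,
    show (1/2:ℂ) * 2 = 1 by norm_num, one_smul, one_smul] at this

lemma unifConvex_of_two_le (hp : 2 ≤ p) : UnifConvex N p 1 := by
  refine unifConvex_of fun x y => ?_
  rw [h.integral_midpoint, ← one_mul (N x ^ p), h.integral_weighted]
  refine integral_mono (h.integrable_weighted x y 1 1) (h.integrable_midpoint x y) fun z => ?_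
  simp only [one_mul]
  exact clarkson_scalar hp _ _

lemma unifSmooth_of_le_two (hp0 : 0 ≤ p) (hp : p ≤ 2) : UnifSmooth N p 1 := by
  intro x y
  have : (N (x + y) ^ p + N (x - y) ^ p) / 2 ≤ 1 * N x ^ p + 1 * N y ^ p := by
    rw [h.integral_midpoint, h.integral_weighted]
    refine integral_mono (h.integrable_midpoint x y) (h.integrable_weighted x y 1 1) fun z => ?_
    simp only [one_mul]
    exact clarkson_scalar' hp0 hp _ _
  linarith

omit h in
lemma weights {A B : ℝ} (hA : 0 < A) (hB : 0 < B) : 0 < A / (A + B) ∧ 0 < B / (A + B) ∧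
    A / (A + B) + B / (A + B) = 1 ∧ A / (A / (A + B)) = A + B ∧ B / (B / (A + B)) = A + B := by
  refine ⟨by positivity, by positivity, ?_, ?_, ?_⟩ <;> field_simp

omit h in
lemma weighted_eq {A B k a b s : ℝ} (hA : 0 < A) (hB : 0 < B) (ha : 0 ≤ a) (hb : 0 ≤ b)
    (hs : 0 ≤ s) : A / (A + B) * (a ^ 2 / (A / (A + B))) ^ k +
      B / (A + B) * (s * b ^ 2 / (B / (A + B))) ^ k =
    A / (A + B) * (1 / (A / (A + B))) ^ k * a ^ (2 * k) +
      B / (A + B) * (s / (B / (A + B))) ^ k * b ^ (2 * k) := by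
  obtain ⟨h1, h2, -⟩ := weights hA hB
  rw [rpow_eq_sq_rpow_half ha (2 * k), rpow_eq_sq_rpow_half hb (2 * k), mul_div_cancel_left₀ _
    (two_ne_zero' ℝ), mul_assoc, mul_assoc, ← Real.mul_rpow (by positivity) (by positivity),
    ← Real.mul_rpow (by positivity) (by positivity), one_div_mul_eq_div,
    div_mul_eq_mul_div s]

lemma unifSmooth_of_two_le (hp : 2 ≤ p) : ∃ C, 0 ≤ C ∧ UnifSmooth N 2 C := by
  obtain ⟨C, hC1, hC⟩ := smooth_scalar hp
  refine ⟨C, by linarith, fun x y => ?_⟩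
  have hk : 1 ≤ p / 2 := by linarith
  have hp2 : 2 * (p / 2) = p := by ring
  have hx := apply_nonneg N x
  have hy := apply_nonneg N y
  have n1 := apply_nonneg N (x + y)
  have n2 := apply_nonneg N (x - y)
  have a1 := map_add_le_add N x y
  have a2 : N (x - y) ≤ N x + N y := map_sub_le_add N x y
  simp only [Real.rpow_two]
  rcases hx.eq_or_lt with hx0 | hx0
  · nlinarith
  rcases hy.eq_or_lt with hy0 | hy0
  · nlinarith
  set A := N x ^ 2 with hA
  set B := C * N y ^ 2 with hB
  have hA0 : 0 < A := by positivity
  have hB0 : 0 < B := by positivity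
  obtain ⟨w1, w2, w3, w4, w5⟩ := weights hA0 hB0
  have key : (N (x + y) ^ p + N (x - y) ^ p) / 2 ≤ (A + B) ^ (p / 2) := by
    have e : (A + B) ^ (p / 2) = A / (A + B) * (1 / (A / (A + B))) ^ (p / 2) * N x ^ p +
        B / (A + B) * (C / (B / (A + B))) ^ (p / 2) * N y ^ p := by
      have := weighted_eq (k := p / 2) hA0 hB0 hx hy (by linarith : 0 ≤ C)
      rw [hp2] at this
      rw [← this, ← hA, ← hB, w4, w5, ← add_mul, w3, one_mul]
    rw [e, h.integral_midpoint, h.integral_weighted]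
    refine integral_mono (h.integrable_midpoint x y) (h.integrable_weighted x y _ _) fun z => ?_
    have h1 := weighted_eq (k := p / 2) hA0 hB0 (norm_nonneg (T x z)) (norm_nonneg (T y z))
      (by linarith : 0 ≤ C)
    rw [hp2] at h1
    simp only
    rw [← h1]
    refine (hC _ _).trans ?_
    have h2 := (convexOn_rpow hk).2
      (Set.mem_Ici.2 (by positivity : 0 ≤ ‖T x z‖ ^ 2 / (A / (A + B))))
      (Set.mem_Ici.2 (by positivity : 0 ≤ C * ‖T y z‖ ^ 2 / (B / (A + B)))) w1.le w2.le w3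
    simp only [smul_eq_mul] at h2
    rwa [mul_div_cancel₀ _ w1.ne', mul_div_cancel₀ _ w2.ne'] at h2
  rw [rpow_eq_sq_rpow_half n1, rpow_eq_sq_rpow_half n2] at key
  have h3 := (rpow_midpoint_le hk (sq_nonneg (N (x + y))) (sq_nonneg (N (x - y)))).trans key
  have h4 := (Real.rpow_le_rpow_iff (by positivity) (by positivity) (by linarith)).1 h3
  linarith

lemma unifConvex_of_le_two (hp1 : 1 < p) (hp : p ≤ 2) : ∃ c, 0 < c ∧ UnifConvex N 2 c := by
  obtain ⟨c, hc0, hc1, hc⟩ := convex_scalar hp1 hp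
  refine ⟨c, hc0, unifConvex_of fun x y => ?_⟩
  have hk : p / 2 ≤ 1 := by linarith
  have hk0 : 0 < p / 2 := by linarith
  have hp2 : 2 * (p / 2) = p := by ring
  have hx := apply_nonneg N x
  have hy := apply_nonneg N y
  have n1 := apply_nonneg N (x + y)
  have n2 := apply_nonneg N (x - y)
  have a1 : 2 * N x ≤ N (x + y) + N (x - y) := by
    have := map_add_le_add N (x + y) (x - y)
    rw [show x + y + (x - y) = (2:ℂ) • x by rw [two_smul]; abel, map_smul_eq_mul] at this
    simpa using this
  have a2 : 2 * N y ≤ N (x + y) + N (x - y) := by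
    have := map_sub_le_add N (x + y) (x - y)
    rw [show x + y - (x - y) = (2:ℂ) • y by rw [two_smul]; abel, map_smul_eq_mul] at this
    simpa using this
  simp only [Real.rpow_two]
  have b : ∀ a, 0 ≤ a → 2 * a ≤ N (x + y) + N (x - y) →
      a ^ 2 ≤ (N (x + y) ^ 2 + N (x - y) ^ 2) / 2 := fun a ha0 ha => by
    nlinarith [sq_nonneg (N (x + y) - N (x - y))]
  have b1 := b _ hx a1
  have b2 := b _ hy a2
  rcases hx.eq_or_lt with hx0 | hx0
  · rw [← hx0]; nlinarith [sq_nonneg (N y)]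
  rcases hy.eq_or_lt with hy0 | hy0
  · rw [← hy0]; linarith
  set A := N x ^ 2 with hA
  set B := c * N y ^ 2 with hB
  have hA0 : 0 < A := by positivity
  have hB0 : 0 < B := by positivity
  obtain ⟨w1, w2, w3, w4, w5⟩ := weights hA0 hB0
  have key : (A + B) ^ (p / 2) ≤ (N (x + y) ^ p + N (x - y) ^ p) / 2 := by
    have e : (A + B) ^ (p / 2) = A / (A + B) * (1 / (A / (A + B))) ^ (p / 2) * N x ^ p +
        B / (A + B) * (c / (B / (A + B))) ^ (p / 2) * N y ^ p := by
      have := weighted_eq (k := p / 2) hA0 hB0 hx hy hc0.le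
      rw [hp2] at this
      rw [← this, ← hA, ← hB, w4, w5, ← add_mul, w3, one_mul]
    rw [e, h.integral_midpoint, h.integral_weighted]
    refine integral_mono (h.integrable_weighted x y _ _) (h.integrable_midpoint x y) fun z => ?_
    have h1 := weighted_eq (k := p / 2) hA0 hB0 (norm_nonneg (T x z)) (norm_nonneg (T y z)) hc0.le
    rw [hp2] at h1
    simp only
    rw [← h1]
    refine le_trans ?_ (hc _ _)
    have h2 := (Real.concaveOn_rpow hk0.le hk).2
      (Set.mem_Ici.2 (by positivity : 0 ≤ ‖T x z‖ ^ 2 / (A / (A + B))))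
      (Set.mem_Ici.2 (by positivity : 0 ≤ c * ‖T y z‖ ^ 2 / (B / (A + B)))) w1.le w2.le w3
    simp only [smul_eq_mul] at h2
    rwa [mul_div_cancel₀ _ w1.ne', mul_div_cancel₀ _ w2.ne'] at h2
  rw [rpow_eq_sq_rpow_half n1, rpow_eq_sq_rpow_half n2] at key
  have h3 := key.trans (le_rpow_midpoint hk0.le hk (sq_nonneg (N (x + y))) (sq_nonneg (N (x - y))))
  exact (Real.rpow_le_rpow_iff (by positivity) (by positivity) hk0).1 h3

lemma exists_unifConvex (hp : 1 < p) : ∃ c, 0 < c ∧ UnifConvex N (max 2 p) c := by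
  rcases le_total 2 p with h2 | h2
  · rw [max_eq_right h2]; exact ⟨1, one_pos, h.unifConvex_of_two_le h2⟩
  · rw [max_eq_left h2]; exact h.unifConvex_of_le_two hp h2

lemma exists_unifSmooth (hp : 1 < p) : ∃ C, 0 ≤ C ∧ UnifSmooth N (min 2 p) C := by
  rcases le_total 2 p with h2 | h2
  · rw [min_eq_left h2]; exact h.unifSmooth_of_two_le h2
  · rw [min_eq_right h2]; exact ⟨1, zero_le_one, h.unifSmooth_of_le_two (by linarith) h2⟩

end IsLpSeminorm

end LpGeometry

section PeriodSquare

/-- Lebesgue measure on the period square. -/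
def sqMeasure : Measure (ℝ × ℝ) :=
  (volume.restrict (Set.Ioc (0:ℝ) (2 * π))).prod (volume.restrict (Set.Ioc (0:ℝ) (2 * π)))

instance : IsFiniteMeasure sqMeasure := by unfold sqMeasure; infer_instance

/-- Functions of two variables which are `2π`-periodic in each variable. -/
def BiPeriodic {E : Type*} (F : ℝ × ℝ → E) : Prop :=
  (∀ x y, F (x + 2 * π, y) = F (x, y)) ∧ ∀ x y, F (x, y + 2 * π) = F (x, y)

lemma lintegral_periodic_add {g : ℝ → ℝ≥0∞} (hp : Function.Periodic g (2 * π)) (a : ℝ) :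
    ∫⁻ x in Set.Ioc (0:ℝ) (2 * π), g (x + a) = ∫⁻ x in Set.Ioc (0:ℝ) (2 * π), g x := by
  have e : ∫⁻ x in Set.Ioc (0:ℝ) (2 * π), g (x + a) =
      ∫⁻ x in Set.Ioc (0 + a) (2 * π + a), g x := by
    have h := (measurePreserving_add_right volume a).setLIntegral_comp_preimage_emb
      (measurableEmbedding_addRight a) g (Set.Ioc (0 + a) (2 * π + a))
    rw [← h]
    congr 2
    ext x; simp
  have h0 : Set.Ioc (0 + a) (2 * π + a) = Set.Ioc a (a + 2 * π) := by
    rw [zero_add, add_comm]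
  have h1 : Set.Ioc (0:ℝ) (2 * π) = Set.Ioc 0 (0 + 2 * π) := by rw [zero_add]
  rw [e, h0, h1]
  exact IsAddFundamentalDomain.setLIntegral_eq (G := AddSubgroup.zmultiples (2 * π))
    (isAddFundamentalDomain_Ioc two_pi_pos a) (isAddFundamentalDomain_Ioc two_pi_pos 0) g
    hp.map_vadd_zmultiples

lemma lintegral_biPeriodic_add {F : ℝ × ℝ → ℝ≥0∞} (hF : Measurable F) (hp : BiPeriodic F)
    (a b : ℝ) : ∫⁻ z, F (z.1 + a, z.2 + b) ∂sqMeasure = ∫⁻ z, F z ∂sqMeasure := by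
  have hF' : Measurable fun z : ℝ × ℝ => F (z.1 + a, z.2 + b) := by fun_prop
  unfold sqMeasure
  rw [lintegral_prod _ hF'.aemeasurable, lintegral_prod _ hF.aemeasurable]
  simp only
  have h1 : ∀ x, ∫⁻ y in Set.Ioc (0:ℝ) (2 * π), F (x + a, y + b) =
      ∫⁻ y in Set.Ioc (0:ℝ) (2 * π), F (x + a, y) := fun x =>
    lintegral_periodic_add (g := fun y => F (x + a, y)) (fun y => hp.2 _ y) b
  simp_rw [h1]
  exact lintegral_periodic_add (g := fun x => ∫⁻ y in Set.Ioc (0:ℝ) (2 * π), F (x, y))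
    (fun x => by simp only [hp.1]) a

lemma eLpNorm_eq_of_pos {X E : Type*} [MeasurableSpace X] {μ : Measure X} [ENorm E] {p : ℝ}
    (hp : 0 < p) (g : X → E) :
    eLpNorm g (ENNReal.ofReal p) μ = (∫⁻ z, ‖g z‖ₑ ^ p ∂μ) ^ (1 / p) := by
  rw [eLpNorm_eq_lintegral_rpow_enorm_toReal (by simpa using hp) ENNReal.ofReal_ne_top,
    ENNReal.toReal_ofReal hp.le]

lemma eLpNorm_biPeriodic_add {E : Type*} [TopologicalSpace E] [ContinuousENorm E]
    [MeasurableSpace E] [OpensMeasurableSpace E] {p : ℝ} (hp : 0 < p) {g : ℝ × ℝ → E}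
    (hg : Measurable g) (hper : BiPeriodic g) (a b : ℝ) :
    eLpNorm (fun z : ℝ × ℝ => g (z.1 + a, z.2 + b)) (ENNReal.ofReal p) sqMeasure =
      eLpNorm g (ENNReal.ofReal p) sqMeasure := by
  rw [eLpNorm_eq_of_pos hp, eLpNorm_eq_of_pos hp,
    ← lintegral_biPeriodic_add (F := fun z => ‖g z‖ₑ ^ p) (hg.enorm.pow_const p)
    ⟨fun x y => by simp only [hper.1], fun x y => by simp only [hper.2]⟩ a b]

/-- Minkowski's inequality for countable sums. -/
lemma eLpNorm_tsum_le_tsum {X : Type*} [MeasurableSpace X] {μ : Measure X} {p : ℝ} (hp : 1 ≤ p)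
    {F : ℕ → X → ℝ≥0∞} (hF : ∀ n, Measurable (F n)) :
    eLpNorm (fun z => ∑' n, F n z) (ENNReal.ofReal p) μ ≤
      ∑' n, eLpNorm (F n) (ENNReal.ofReal p) μ := by
  have hp0 : 0 < p := by linarith
  have hq : 1 ≤ ENNReal.ofReal p := by simpa using hp
  rw [eLpNorm_eq_of_pos hp0]
  simp only [enorm_eq_self]
  have e : ∀ z, (∑' n, F n z) ^ p = ⨆ n, (∑ i ∈ Finset.range n, F i z) ^ p := by
    intro z
    rw [ENNReal.tsum_eq_iSup_nat]
    exact (ENNReal.orderIsoRpow p hp0).map_iSup _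
  simp_rw [e]
  rw [lintegral_iSup (fun n => (Finset.measurable_fun_sum _ fun i _ => hF i).pow_const p)
    (fun m n hmn z => ENNReal.rpow_le_rpow (Finset.sum_le_sum_of_subset
      (Finset.range_mono hmn)) hp0.le)]
  have e2 := (ENNReal.orderIsoRpow (1 / p) (by positivity)).map_iSup
    fun n => ∫⁻ z, (∑ i ∈ Finset.range n, F i z) ^ p ∂μ
  simp only [ENNReal.orderIsoRpow_apply] at e2
  rw [e2]
  refine iSup_le fun n => ?_
  have h := eLpNorm_sum_le (p := ENNReal.ofReal p) (μ := μ) (f := F) (s := Finset.range n)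
    (fun i _ => (hF i).aestronglyMeasurable) hq
  rw [eLpNorm_eq_of_pos hp0] at h
  simp only [Finset.sum_apply, enorm_eq_self] at h
  exact h.trans (ENNReal.sum_le_tsum _)

end PeriodSquare

section TrigonometricPolynomials

variable {ι : Type*} (φ ψ : ι → ℤ)

/-- The trigonometric polynomial with frequencies `(φ i, ψ i)` and given coefficients. -/
def trigPoly : (ι →₀ ℂ) →ₗ[ℂ] ℝ × ℝ → ℂ :=
  Finsupp.linearCombination ℂ fun i z =>
    Complex.exp ((z.1 * φ i + z.2 * ψ i : ℝ) * Complex.I)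

lemma trigPoly_apply (c : ι →₀ ℂ) (z : ℝ × ℝ) : trigPoly φ ψ c z =
    ∑ i ∈ c.support, c i * Complex.exp ((z.1 * φ i + z.2 * ψ i : ℝ) * Complex.I) := by
  simp [trigPoly, Finsupp.linearCombination_apply, Finsupp.sum, Finset.sum_apply]

lemma trigPoly_smul_apply (w : ι → ℂ) (c : ι →₀ ℂ) (z : ℝ × ℝ) : trigPoly φ ψ (w • c) z =
    ∑ i ∈ c.support, w i * (c i * Complex.exp ((z.1 * φ i + z.2 * ψ i : ℝ) * Complex.I)) := by
  rw [trigPoly_apply]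
  have hs : (w • c).support ⊆ c.support := fun i hi => by
    simp only [Finsupp.mem_support_iff] at hi ⊢
    intro h; simp [h] at hi
  rw [Finset.sum_subset hs fun i _ hi => by rw [Finsupp.notMem_support_iff.1 hi, zero_mul]]
  exact Finset.sum_congr rfl fun i _ => by simp [mul_assoc]

lemma continuous_trigPoly (c : ι →₀ ℂ) : Continuous (trigPoly φ ψ c) := by
  have : trigPoly φ ψ c = fun z => ∑ i ∈ c.support,
      c i * Complex.exp ((z.1 * φ i + z.2 * ψ i : ℝ) * Complex.I) :=
    funext fun z => trigPoly_apply φ ψ c z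
  rw [this]; fun_prop

lemma norm_trigPoly_le (c : ι →₀ ℂ) (z : ℝ × ℝ) : ‖trigPoly φ ψ c z‖ ≤ ∑ i ∈ c.support, ‖c i‖ := by
  rw [trigPoly_apply]
  refine (norm_sum_le _ _).trans (Finset.sum_le_sum fun i _ => ?_)
  rw [norm_mul, Complex.norm_exp_ofReal_mul_I, mul_one]

lemma memLp_trigPoly (c : ι →₀ ℂ) (q : ℝ≥0∞) : MemLp (trigPoly φ ψ c) q sqMeasure :=
  MemLp.of_bound (continuous_trigPoly φ ψ c).aestronglyMeasurable _
    (Filter.Eventually.of_forall (norm_trigPoly_le φ ψ c))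

lemma trigPoly_shift (c : ι →₀ ℂ) (a b : ℝ) (z : ℝ × ℝ) : trigPoly φ ψ c (z.1 + a, z.2 + b) =
    trigPoly φ ψ (tr φ (-a) • tr ψ (-b) • c) z := by
  rw [← mul_smul, trigPoly_smul_apply, trigPoly_apply]
  refine Finset.sum_congr rfl fun i _ => ?_
  simp only [Pi.mul_apply, tr]
  rw [mul_left_comm, ← Complex.exp_add, ← Complex.exp_add]
  congr 2; push_cast; ring

lemma biPeriodic_trigPoly (c : ι →₀ ℂ) : BiPeriodic (trigPoly φ ψ c) := by
  constructor <;> intro x y <;> rw [trigPoly_apply, trigPoly_apply] <;>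
    refine Finset.sum_congr rfl fun i _ => ?_
  · rw [← Complex.exp_periodic.int_mul (φ i) (((x * φ i + y * ψ i : ℝ)) * Complex.I)]
    congr 2; push_cast; ring
  · rw [← Complex.exp_periodic.int_mul (ψ i) (((x * φ i + y * ψ i : ℝ)) * Complex.I)]
    congr 2; push_cast; ring

variable {p : ℝ} (hp : 1 ≤ p)

/-- The `L_p` norm of a trigonometric polynomial as a seminorm of its coefficients. -/
def trigNorm : Seminorm ℂ (ι →₀ ℂ) :=
  Seminorm.of (fun c => (eLpNorm (trigPoly φ ψ c) (ENNReal.ofReal p) sqMeasure).toReal)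
    (fun c d => by
      have hc := memLp_trigPoly φ ψ c (ENNReal.ofReal p)
      have hd := memLp_trigPoly φ ψ d (ENNReal.ofReal p)
      rw [map_add, ← ENNReal.toReal_add hc.2.ne hd.2.ne]
      exact ENNReal.toReal_mono (ENNReal.add_ne_top.2 ⟨hc.2.ne, hd.2.ne⟩)
        (eLpNorm_add_le hc.1 hd.1 (by simpa using hp)))
    (fun a c => by
      rw [map_smul, eLpNorm_const_smul, ENNReal.toReal_mul, toReal_enorm])

lemma eN_trigNorm (c : ι →₀ ℂ) :
    eN (trigNorm φ ψ hp) c = eLpNorm (trigPoly φ ψ c) (ENNReal.ofReal p) sqMeasure :=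
  ENNReal.ofReal_toReal (memLp_trigPoly φ ψ c _).2.ne

lemma trigNorm_eq (c : ι →₀ ℂ) :
    trigNorm φ ψ hp c = (eLpNorm (trigPoly φ ψ c) (ENNReal.ofReal p) sqMeasure).toReal := rfl

lemma isLpSeminorm_trigNorm : IsLpSeminorm (trigNorm φ ψ hp) sqMeasure (trigPoly φ ψ) p := by
  have hp0 : 0 < p := by linarith
  have hi : ∀ c, Integrable (fun z => ‖trigPoly φ ψ c z‖ ^ p) sqMeasure := fun c => by
    have h := (memLp_trigPoly φ ψ c (ENNReal.ofReal p)).integrable_norm_rpow (by simpa using hp0)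
      ENNReal.ofReal_ne_top
    rwa [ENNReal.toReal_ofReal hp0.le] at h
  refine ⟨fun c => ?_, hi⟩
  rw [trigNorm_eq, eLpNorm_eq_of_pos hp0, ENNReal.toReal_rpow, ← ENNReal.rpow_mul,
    one_div_mul_cancel hp0.ne', ENNReal.rpow_one, integral_eq_lintegral_of_nonneg_ae
    (Filter.Eventually.of_forall fun z => by positivity) (hi c).1]
  congr 2
  funext z
  rw [← ENNReal.ofReal_rpow_of_nonneg (norm_nonneg _) hp0.le, ofReal_norm]

lemma trigNorm_shift (c : ι →₀ ℂ) (a b : ℝ) :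
    trigNorm φ ψ hp (tr φ a • tr ψ b • c) = trigNorm φ ψ hp c := by
  rw [trigNorm_eq, trigNorm_eq, ← eLpNorm_biPeriodic_add (by linarith)
    (continuous_trigPoly φ ψ c).measurable (biPeriodic_trigPoly φ ψ c) (-a) (-b)]
  simp_rw [trigPoly_shift, neg_neg]

lemma transInv_trigNorm_left : TransInv (trigNorm φ ψ hp) φ := fun h c => by
  simpa [tr_zero] using trigNorm_shift φ ψ hp c h 0

lemma transInv_trigNorm_right : TransInv (trigNorm φ ψ hp) ψ := fun h c => by
  simpa [tr_zero] using trigNorm_shift φ ψ hp c 0 h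

end TrigonometricPolynomials

section Transfer

lemma enorm_tsum_sub_le {b u : ℕ → ℝ} {v : ℕ → ℂ} {V : ℂ}
    (hV : HasSum (fun n => (b n : ℂ) * v n) V) :
    ‖((∑' n, b n * u n : ℝ) : ℂ) - V‖ₑ ≤ ∑' n, ‖b n‖ₑ * ‖(u n : ℂ) - v n‖ₑ := by
  by_cases htop : ∑' n, ‖b n‖ₑ * ‖(u n : ℂ) - v n‖ₑ = ⊤
  · rw [htop]; exact le_top
  have e : ∀ n, ‖b n‖ₑ * ‖(u n : ℂ) - v n‖ₑ = ‖(b n : ℂ) * ((u n : ℂ) - v n)‖ₑ := fun n => by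
    rw [enorm_mul, ← ofReal_norm (b n : ℂ), Complex.norm_real, ofReal_norm]
  simp_rw [e] at htop ⊢
  have hs : Summable fun n => (b n : ℂ) * ((u n : ℂ) - v n) :=
    (tsum_enorm_ne_top_iff_summable_norm.1 htop).of_norm
  have hu : HasSum (fun n => ((b n * u n : ℝ) : ℂ))
      ((∑' n, (b n : ℂ) * ((u n : ℂ) - v n)) + V) := by
    refine (hs.hasSum.add hV).congr_fun fun n => ?_
    push_cast; ring
  rw [Complex.ofReal_tsum, hu.tsum_eq, add_sub_cancel_right]
  exact enorm_tsum_le_tsum_enorm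

lemma measurable_diffX {g : ℝ → ℝ → ℝ} (hg : Measurable (Function.uncurry g)) (α h : ℝ) :
    Measurable (Function.uncurry (diffX α h g)) := by
  refine Measurable.tsum (f := fun ν (z : ℝ × ℝ) =>
    (-1 : ℝ) ^ ν * fracBinom α ν * g (z.1 + (α - (ν : ℝ)) * h) z.2) fun ν => ?_
  refine measurable_const.mul (hg.comp (f := fun z : ℝ × ℝ =>
    (z.1 + (α - (ν : ℝ)) * h, z.2)) (by fun_prop))

lemma measurable_diffY {g : ℝ → ℝ → ℝ} (hg : Measurable (Function.uncurry g)) (α h : ℝ) :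
    Measurable (Function.uncurry (diffY α h g)) := by
  refine Measurable.tsum (f := fun ν (z : ℝ × ℝ) =>
    (-1 : ℝ) ^ ν * fracBinom α ν * g z.1 (z.2 + (α - (ν : ℝ)) * h)) fun ν => ?_
  refine measurable_const.mul (hg.comp (f := fun z : ℝ × ℝ =>
    (z.1, z.2 + (α - (ν : ℝ)) * h)) (by fun_prop))

lemma Lp2Norm_eq_eLpNorm {p : ℝ} (hp : 0 < p) {g : ℝ → ℝ → ℝ}
    (hg : Measurable (Function.uncurry g)) : Lp2Norm p g =
      eLpNorm (fun z : ℝ × ℝ => (g z.1 z.2 : ℂ)) (ENNReal.ofReal p) sqMeasure := by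
  have e : ∀ x y, ENNReal.ofReal (|g x y| ^ p) = ‖(g x y : ℂ)‖ₑ ^ p := fun x y => by
    rw [← ENNReal.ofReal_rpow_of_nonneg (abs_nonneg _) hp.le, ← ofReal_norm, Complex.norm_real,
      Real.norm_eq_abs]
  have hm : Measurable fun z : ℝ × ℝ => ‖(g z.1 z.2 : ℂ)‖ₑ ^ p :=
    (Complex.measurable_ofReal.comp hg).enorm.pow_const p
  rw [eLpNorm_eq_of_pos hp, Lp2Norm, sqMeasure, lintegral_prod _ hm.aemeasurable]
  simp_rw [e]

/-- The sum of the absolute values of the coefficients of a fractional difference. -/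
def diffConst (α : ℝ) : ℝ≥0∞ := ∑' ν, ‖sgnBinom α ν‖ₑ

lemma diffConst_ne_top {α : ℝ} (hα : 0 < α) : diffConst α ≠ ⊤ :=
  tsum_enorm_ne_top_iff_summable_norm.2 (summable_abs_sgnBinom hα)

/-- Weighted sums of translates in direction `v`. -/
def shiftSum (α h : ℝ) (v : ℝ × ℝ) (G : ℝ × ℝ → ℝ≥0∞) (z : ℝ × ℝ) : ℝ≥0∞ :=
  ∑' ν : ℕ, ‖sgnBinom α ν‖ₑ *
    G (z.1 + (α - ν) * h * v.1, z.2 + (α - ν) * h * v.2)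

lemma shiftSum_mono {α h : ℝ} {v : ℝ × ℝ} {G H : ℝ × ℝ → ℝ≥0∞} (hGH : ∀ z, G z ≤ H z)
    (z : ℝ × ℝ) : shiftSum α h v G z ≤ shiftSum α h v H z :=
  ENNReal.tsum_le_tsum fun _ => mul_le_mul_right (hGH _) _

lemma measurable_shiftSum {α h : ℝ} {v : ℝ × ℝ} {G : ℝ × ℝ → ℝ≥0∞} (hG : Measurable G) :
    Measurable (shiftSum α h v G) :=
  Measurable.tsum fun ν => measurable_const.mul
    (hG.comp (f := fun z : ℝ × ℝ => (z.1 + (α - ν) * h * v.1, z.2 + (α - ν) * h * v.2))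
      (by fun_prop))

lemma biPeriodic_shiftSum {α h : ℝ} {v : ℝ × ℝ} {G : ℝ × ℝ → ℝ≥0∞} (hG : BiPeriodic G) :
    BiPeriodic (shiftSum α h v G) := by
  constructor <;> intro x y <;> unfold shiftSum <;> simp only [add_right_comm _ (2 * π)]
  · simp only [hG.1]
  · simp only [hG.2]

lemma eLpNorm_shiftSum_le {p : ℝ} (hp : 1 ≤ p) {α h : ℝ} {v : ℝ × ℝ} {G : ℝ × ℝ → ℝ≥0∞}
    (hG : Measurable G) (hper : BiPeriodic G) :
    eLpNorm (shiftSum α h v G) (ENNReal.ofReal p) sqMeasure ≤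
      diffConst α * eLpNorm G (ENNReal.ofReal p) sqMeasure := by
  have hp0 : 0 < p := by linarith
  have hm : ∀ ν : ℕ, Measurable fun z : ℝ × ℝ =>
      G (z.1 + (α - ν) * h * v.1, z.2 + (α - ν) * h * v.2) := fun ν => by fun_prop
  unfold shiftSum
  refine (eLpNorm_tsum_le_tsum hp fun ν => measurable_const.mul (hm ν)).trans ?_
  rw [diffConst, ← ENNReal.tsum_mul_right]
  refine ENNReal.tsum_le_tsum fun ν => le_of_eq ?_
  rw [← eLpNorm_biPeriodic_add hp0 hG hper ((α - ν) * h * v.1) ((α - ν) * h * v.2),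
    eLpNorm_eq_of_pos hp0, eLpNorm_eq_of_pos hp0]
  simp only [enorm_eq_self, Pi.mul_apply, ENNReal.mul_rpow_of_nonneg _ _ hp0.le]
  rw [lintegral_const_mul _ ((hm ν).pow_const p), ENNReal.mul_rpow_of_nonneg _ _ (by positivity),
    ← ENNReal.rpow_mul, mul_one_div_cancel hp0.ne', ENNReal.rpow_one]

variable {ι : Type*} (φ ψ : ι → ℤ)

lemma hasSum_sgnBinom_tr {χ : ι → ℤ} {α : ℝ} (hα : 0 < α) (h : ℝ) (i : ι) :
    HasSum (fun ν : ℕ => (sgnBinom α ν : ℂ) * tr χ (-((α - ν) * h)) i)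
      ((tr χ (-(α * h)) * oneSubPow (tr χ h) α) i) := by
  have h1 := (hasSum_sgnBinom hα (norm_tr (φ := χ) h i).le).mul_left (tr χ (-(α * h)) i)
  refine h1.congr_fun fun ν => ?_
  have : -((α - ν) * h) = -(α * h) + ν * h := by ring
  rw [this, tr_add, tr_nat_mul, Pi.mul_apply, Pi.pow_apply]
  ring

lemma hasSum_trigPoly {α : ℝ} {m : ι → ℂ} {w : ℕ → ι → ℂ}
    (h : ∀ i, HasSum (fun ν : ℕ => (sgnBinom α ν : ℂ) * w ν i) (m i)) (c : ι →₀ ℂ) (z : ℝ × ℝ) :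
    HasSum (fun ν : ℕ => (sgnBinom α ν : ℂ) * trigPoly φ ψ (w ν • c) z)
      (trigPoly φ ψ (m • c) z) := by
  simp_rw [trigPoly_smul_apply, Finset.mul_sum, ← mul_assoc]
  exact hasSum_sum fun i _ => ((h i).mul_right _).mul_right _

lemma enorm_diffX_sub_le {α : ℝ} (hα : 0 < α) (h : ℝ) (g : ℝ → ℝ → ℝ) (c : ι →₀ ℂ) (z : ℝ × ℝ) :
    ‖(diffX α h g z.1 z.2 : ℂ) -
        trigPoly φ ψ ((tr φ (-(α * h)) * oneSubPow (tr φ h) α) • c) z‖ₑ ≤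
      shiftSum α h (1, 0) (fun w => ‖(g w.1 w.2 : ℂ) - trigPoly φ ψ c w‖ₑ) z := by
  have h1 := enorm_tsum_sub_le (u := fun ν : ℕ => g (z.1 + (α - ν) * h) z.2)
    (hasSum_trigPoly φ ψ (fun i => hasSum_sgnBinom_tr (χ := φ) hα h i) c z)
  refine h1.trans (le_of_eq (tsum_congr fun ν => ?_))
  simp only [mul_one, mul_zero]
  rw [trigPoly_shift, neg_zero, tr_zero, one_smul, add_zero]

lemma enorm_diffY_sub_le {α : ℝ} (hα : 0 < α) (h : ℝ) (g : ℝ → ℝ → ℝ) (c : ι →₀ ℂ) (z : ℝ × ℝ) :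
    ‖(diffY α h g z.1 z.2 : ℂ) -
        trigPoly φ ψ ((tr ψ (-(α * h)) * oneSubPow (tr ψ h) α) • c) z‖ₑ ≤
      shiftSum α h (0, 1) (fun w => ‖(g w.1 w.2 : ℂ) - trigPoly φ ψ c w‖ₑ) z := by
  have h1 := enorm_tsum_sub_le (u := fun ν : ℕ => g z.1 (z.2 + (α - ν) * h))
    (hasSum_trigPoly φ ψ (fun i => hasSum_sgnBinom_tr (χ := ψ) hα h i) c z)
  refine h1.trans (le_of_eq (tsum_congr fun ν => ?_))
  simp only [mul_one, mul_zero]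
  rw [trigPoly_shift, neg_zero, tr_zero, one_smul, add_zero]

/-- The `L_p` distance between a function and a trigonometric polynomial. -/
def trigDist (p : ℝ) (f : ℝ → ℝ → ℝ) (c : ι →₀ ℂ) : ℝ≥0∞ :=
  eLpNorm (fun z : ℝ × ℝ => (f z.1 z.2 : ℂ) - trigPoly φ ψ c z) (ENNReal.ofReal p) sqMeasure

variable {p : ℝ} (hp : 1 ≤ p) {f : ℝ → ℝ → ℝ}

lemma eN_oneSubPow_eq {α β : ℝ} (h k : ℝ) (c : ι →₀ ℂ) :
    eN (trigNorm φ ψ hp) (oneSubPow (tr φ h) α • oneSubPow (tr ψ k) β • c) =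
      eLpNorm (trigPoly φ ψ ((tr φ (-(α * h)) * oneSubPow (tr φ h) α) •
        (tr ψ (-(β * k)) * oneSubPow (tr ψ k) β) • c)) (ENNReal.ofReal p) sqMeasure := by
  rw [← eN_trigNorm φ ψ hp]
  unfold eN
  rw [← trigNorm_shift φ ψ hp _ (-(α * h)) (-(β * k))]
  congr 2
  simp only [← mul_smul]
  congr 1
  ring

include hp in
lemma eLpNorm_diff_sub_le (hf : MemLp0 p f) {α β : ℝ} (hα : 0 < α) (hβ : 0 < β) (h k : ℝ)
    (c : ι →₀ ℂ) :
    eLpNorm (fun z : ℝ × ℝ => (diffX α h (diffY β k f) z.1 z.2 : ℂ) -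
      trigPoly φ ψ ((tr φ (-(α * h)) * oneSubPow (tr φ h) α) •
        (tr ψ (-(β * k)) * oneSubPow (tr ψ k) β) • c) z) (ENNReal.ofReal p) sqMeasure ≤
      diffConst α * diffConst β * trigDist φ ψ p f c := by
  set G : ℝ × ℝ → ℝ≥0∞ := fun z => ‖(f z.1 z.2 : ℂ) - trigPoly φ ψ c z‖ₑ
  have hG : Measurable G := ((Complex.measurable_ofReal.comp hf.meas).sub
    (continuous_trigPoly φ ψ c).measurable).enorm
  have hper : BiPeriodic G := by
    have h0 := biPeriodic_trigPoly φ ψ c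
    have hx : ∀ x y, f (x + 2 * π) y = f x y := fun x y => hf.periodic_x y x
    have hy : ∀ x y, f x (y + 2 * π) = f x y := fun x y => hf.periodic_y x y
    exact ⟨fun x y => by simp only [G, h0.1, hx], fun x y => by simp only [G, h0.2, hy]⟩
  have e : trigDist φ ψ p f c = eLpNorm G (ENNReal.ofReal p) sqMeasure :=
    (eLpNorm_enorm _).symm
  rw [e, mul_assoc]
  refine le_trans ?_ ((eLpNorm_shiftSum_le (α := α) (h := h) (v := (1, 0)) hp
    (measurable_shiftSum (α := β) (h := k) (v := (0, 1)) hG) (biPeriodic_shiftSum hper)).trans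
    (mul_le_mul_right (eLpNorm_shiftSum_le hp hG hper) _))
  refine eLpNorm_mono_enorm fun z => ?_
  rw [enorm_eq_self]
  exact (enorm_diffX_sub_le φ ψ hα h _ _ z).trans
    (shiftSum_mono (fun w => enorm_diffY_sub_le φ ψ hβ k _ _ w) z)

lemma aestronglyMeasurable_diff (hf : MemLp0 p f) (α β h k : ℝ) :
    AEStronglyMeasurable (fun z : ℝ × ℝ => (diffX α h (diffY β k f) z.1 z.2 : ℂ)) sqMeasure :=
  (Complex.measurable_ofReal.comp
    (measurable_diffX (measurable_diffY hf.meas β k) α h)).aestronglyMeasurable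

lemma mixedMod_le_coefMod (hf : MemLp0 p f) {α β : ℝ} (hα : 0 < α) (hβ : 0 < β) (t u : ℝ)
    (c : ι →₀ ℂ) : mixedMod p α β t u f ≤ coefMod (trigNorm φ ψ hp) φ ψ α β t u c +
      diffConst α * diffConst β * trigDist φ ψ p f c := by
  refine iSup₂_le fun h hh => iSup₂_le fun k hk => ?_
  rw [Lp2Norm_eq_eLpNorm (by linarith) (measurable_diffX (measurable_diffY hf.meas β k) α h)]
  have h1 := le_coefMod (N := trigNorm φ ψ hp) (φ := φ) (ψ := ψ) (a := α) (b := β) hh hk c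
  rw [eN_oneSubPow_eq] at h1
  refine le_trans ?_ (add_le_add h1 (eLpNorm_diff_sub_le φ ψ hp hf hα hβ h k c))
  have hT := (memLp_trigPoly φ ψ ((tr φ (-(α * h)) * oneSubPow (tr φ h) α) •
        (tr ψ (-(β * k)) * oneSubPow (tr ψ k) β) • c) (ENNReal.ofReal p)).1
  have hD := aestronglyMeasurable_diff hf α β h k
  refine le_trans (le_of_eq ?_) (eLpNorm_add_le hT (hD.sub hT) (by simpa using hp))
  congr 1
  funext z
  simp

lemma coefMod_le_mixedMod (hf : MemLp0 p f) {α β : ℝ} (hα : 0 < α) (hβ : 0 < β) (t u : ℝ)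
    (c : ι →₀ ℂ) : coefMod (trigNorm φ ψ hp) φ ψ α β t u c ≤ mixedMod p α β t u f +
      diffConst α * diffConst β * trigDist φ ψ p f c := by
  refine coefMod_le fun h k hh hk => ?_
  rw [eN_oneSubPow_eq]
  have h1 : Lp2Norm p (diffX α h (diffY β k f)) ≤ mixedMod p α β t u f :=
    le_iSup₂_of_le h hh (le_iSup₂_of_le k hk le_rfl)
  rw [Lp2Norm_eq_eLpNorm (by linarith) (measurable_diffX (measurable_diffY hf.meas β k) α h)] at h1
  refine le_trans ?_ (add_le_add h1 (eLpNorm_diff_sub_le φ ψ hp hf hα hβ h k c))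
  have hT := (memLp_trigPoly φ ψ ((tr φ (-(α * h)) * oneSubPow (tr φ h) α) •
        (tr ψ (-(β * k)) * oneSubPow (tr ψ k) β) • c) (ENNReal.ofReal p)).1
  have hD := aestronglyMeasurable_diff hf α β h k
  refine le_trans (le_of_eq ?_) (eLpNorm_sub_le hD (hD.sub hT) (by simpa using hp))
  congr 1
  funext z
  simp

end Transfer

section Density

/-- The covering map from the plane to the unit torus, scaled to periods `2π`. -/
def coverMap (z : ℝ × ℝ) : UnitAddTorus (Fin 2) :=
  ![((z.1 / (2 * π) : ℝ) : UnitAddCircle), ((z.2 / (2 * π) : ℝ) : UnitAddCircle)]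

lemma measurable_coverMap : Measurable coverMap := by
  refine measurable_pi_lambda _ fun i => ?_
  fin_cases i
  · exact AddCircle.measurable_mk'.comp (measurable_fst.div_const _)
  · exact AddCircle.measurable_mk'.comp (measurable_snd.div_const _)

/-- The representative in `(0,2π]` of a point of the unit circle. -/
def circleRep (t : UnitAddCircle) : ℝ := 2 * π * (AddCircle.measurableEquivIoc 1 0 t : ℝ)

lemma measurable_circleRep : Measurable circleRep :=
  ((measurable_subtype_coe.comp (AddCircle.measurableEquivIoc 1 0).measurable)).const_mul _

lemma periodic_circleRep {g : ℝ → ℝ} (hg : Function.Periodic g (2 * π)) (x : ℝ) :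
    g (circleRep ((x / (2 * π) : ℝ) : UnitAddCircle)) = g x := by
  set t : ℝ := (AddCircle.measurableEquivIoc 1 0 ((x / (2 * π) : ℝ) : UnitAddCircle) : ℝ) with ht
  have h1 : (t : UnitAddCircle) = ((x / (2 * π) : ℝ) : UnitAddCircle) :=
    AddCircle.coe_equivIoc (p := (1:ℝ)) (a := 0)
  rw [← sub_eq_zero, ← AddCircle.coe_sub, AddCircle.coe_eq_zero_iff] at h1
  obtain ⟨n, hn⟩ := h1
  have h2 : circleRep ((x / (2 * π) : ℝ) : UnitAddCircle) = x + n * (2 * π) := by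
    have h3 : t = x / (2 * π) + n := by
      rw [zsmul_eq_mul, mul_one] at hn; linarith
    have : circleRep ((x / (2 * π) : ℝ) : UnitAddCircle) = 2 * π * t := rfl
    rw [this, h3]
    have := two_pi_pos.ne'
    field_simp
  rw [h2]
  exact hg.int_mul n x

lemma mFourier_coverMap (k : Fin 2 → ℤ) (z : ℝ × ℝ) : UnitAddTorus.mFourier k (coverMap z) =
    Complex.exp ((z.1 * k 0 + z.2 * k 1 : ℝ) * Complex.I) := by
  have hpi : (π : ℂ) ≠ 0 := by exact_mod_cast pi_ne_zero
  simp only [UnitAddTorus.mFourier, ContinuousMap.coe_mk, Fin.prod_univ_two, coverMap,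
    Matrix.cons_val_zero, Matrix.cons_val_one, fourier_coe_apply]
  rw [← Complex.exp_add]
  congr 1
  push_cast
  field_simp

lemma exists_pos_mul_ofReal_le {A ε : ℝ≥0∞} (hA : A ≠ ⊤) (hε : ε ≠ 0) :
    ∃ η : ℝ, 0 < η ∧ A * ENNReal.ofReal η ≤ ε := by
  rcases eq_or_ne ε ⊤ with rfl | ht
  · exact ⟨1, one_pos, le_top⟩
  · have h1 : ε / (A + 1) ≠ ⊤ := ENNReal.div_ne_top ht (by simp)
    have h2 : ε / (A + 1) ≠ 0 := by simp [hε, hA]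
    refine ⟨(ε / (A + 1)).toReal, ENNReal.toReal_pos h2 h1, ?_⟩
    rw [ENNReal.ofReal_toReal h1]
    exact (mul_le_mul_left (le_self_add : A ≤ A + 1) _).trans ENNReal.mul_div_le

lemma exists_mem_span_mFourier_dist_lt (G : C(UnitAddTorus (Fin 2), ℂ)) {η : ℝ} (hη : 0 < η) :
    ∃ c : (Fin 2 → ℤ) →₀ ℂ, ∀ t, ‖G t - c.sum fun k a => a * UnitAddTorus.mFourier k t‖ ≤ η := by
  have hd : G ∈
      (Submodule.span ℂ (Set.range (UnitAddTorus.mFourier (d := Fin 2)))).topologicalClosure := by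
    rw [UnitAddTorus.span_mFourier_closure_eq_top]; trivial
  obtain ⟨P, hP, hGP⟩ := Metric.mem_closure_iff.1 hd η hη
  obtain ⟨c, hc⟩ := Finsupp.mem_span_range_iff_exists_finsupp.1 hP
  refine ⟨c, fun t => ?_⟩
  have : P t = c.sum fun k a => a * UnitAddTorus.mFourier k t := by
    rw [← hc, Finsupp.sum, ContinuousMap.sum_apply]
    rfl
  rw [← this]
  rw [dist_eq_norm] at hGP
  exact ((G - P).norm_coe_le_norm t).trans hGP.le

lemma exists_mFourier_eLpNorm_le {ν : Measure (UnitAddTorus (Fin 2))} [IsFiniteMeasure ν]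
    {q : ℝ≥0∞} (hq : 1 ≤ q) (hqt : q ≠ ⊤) {g : UnitAddTorus (Fin 2) → ℂ} (hg : MemLp g q ν)
    {ε : ℝ≥0∞} (hε : ε ≠ 0) : ∃ c : (Fin 2 → ℤ) →₀ ℂ,
      eLpNorm (fun t => g t - c.sum fun k a => a * UnitAddTorus.mFourier k t) q ν ≤ ε := by
  have hε2 : ε / 2 ≠ 0 := by simpa using hε
  obtain ⟨G, hG, hGm⟩ := hg.exists_boundedContinuous_eLpNorm_sub_le hqt hε2
  set A : ℝ≥0∞ := ν Set.univ ^ q.toReal⁻¹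
  have hA : A ≠ ⊤ := ENNReal.rpow_ne_top_of_nonneg (by positivity) (measure_ne_top _ _)
  obtain ⟨η, hη, hηA⟩ := exists_pos_mul_ofReal_le hA hε2
  obtain ⟨c, hc⟩ := exists_mem_span_mFourier_dist_lt G.toContinuousMap hη
  refine ⟨c, ?_⟩
  set P : UnitAddTorus (Fin 2) → ℂ := fun t => c.sum fun k a => a * UnitAddTorus.mFourier k t
  have hPc : Continuous P := by
    simp only [P, Finsupp.sum]
    exact continuous_finsetSum _ fun k _ =>
      continuous_const.mul (UnitAddTorus.mFourier k).continuous
  have h1 : eLpNorm (fun t => G t - P t) q ν ≤ A * ENNReal.ofReal η :=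
    eLpNorm_le_of_ae_bound (Filter.Eventually.of_forall hc)
  have h2 : (fun t => g t - P t) = (g - G) + fun t => G t - P t := by
    funext t; simp
  rw [h2]
  refine (eLpNorm_add_le (hg.1.sub hGm.1) (hGm.1.sub hPc.aestronglyMeasurable) hq).trans ?_
  calc _ ≤ ε / 2 + ε / 2 := add_le_add hG (h1.trans hηA)
    _ = ε := ENNReal.add_halves ε

lemma exists_trigDist_le {p : ℝ} (hp : 1 ≤ p) {f : ℝ → ℝ → ℝ} (hf : MemLp0 p f) {ε : ℝ≥0∞}
    (hε : ε ≠ 0) : ∃ c : (Fin 2 → ℤ) →₀ ℂ,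
      trigDist (fun k => k 0) (fun k => k 1) p f c ≤ ε := by
  have hp0 : 0 < p := by linarith
  have : IsFiniteMeasure (sqMeasure.map coverMap) := Measure.isFiniteMeasure_map _ _
  have h0 : Measurable fun t : UnitAddTorus (Fin 2) => circleRep (t 0) :=
    measurable_circleRep.comp (measurable_pi_apply 0)
  have h1 : Measurable fun t : UnitAddTorus (Fin 2) => circleRep (t 1) :=
    measurable_circleRep.comp (measurable_pi_apply 1)
  have h2 : Measurable fun t : UnitAddTorus (Fin 2) => f (circleRep (t 0)) (circleRep (t 1)) :=
    hf.meas.comp (h0.prodMk h1)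
  set g : UnitAddTorus (Fin 2) → ℂ := fun t => (f (circleRep (t 0)) (circleRep (t 1)) : ℂ) with hgd
  have hg : Measurable g := Complex.measurable_ofReal.comp h2
  have hgf : ∀ z : ℝ × ℝ, g (coverMap z) = (f z.1 z.2 : ℂ) := fun z => by
    have e1 : f (circleRep ((z.1 / (2 * π) : ℝ) : UnitAddCircle))
        (circleRep ((z.2 / (2 * π) : ℝ) : UnitAddCircle)) = f z.1 z.2 := by
      rw [periodic_circleRep (hf.periodic_y _)]
      exact periodic_circleRep (hf.periodic_x z.2) z.1
    exact congrArg Complex.ofReal e1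
  have hmem : MemLp g (ENNReal.ofReal p) (sqMeasure.map coverMap) := by
    refine ⟨hg.aestronglyMeasurable, ?_⟩
    rw [eLpNorm_map_measure hg.aestronglyMeasurable measurable_coverMap.aemeasurable]
    have : g ∘ coverMap = fun z => (f z.1 z.2 : ℂ) := funext hgf
    rw [this, ← Lp2Norm_eq_eLpNorm hp0 hf.meas]
    exact hf.norm_ne_top.lt_top
  obtain ⟨c, hc⟩ := exists_mFourier_eLpNorm_le (by simpa using hp) ENNReal.ofReal_ne_top hmem hε
  refine ⟨c, ?_⟩
  rw [eLpNorm_map_measure ?_ measurable_coverMap.aemeasurable] at hc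
  · refine le_of_eq_of_le ?_ hc
    unfold trigDist
    congr 1
    funext z
    simp only [Function.comp, hgf, mFourier_coverMap, trigPoly_apply, Finsupp.sum]
  · refine hg.aestronglyMeasurable.sub ?_
    simp only [Finsupp.sum]
    exact (continuous_finsetSum _ fun k _ =>
      continuous_const.mul (UnitAddTorus.mFourier k).continuous).aestronglyMeasurable

end Density

section ZeroMean

lemma integral_exp_int (n : ℤ) (w : ℝ) :
    ∫ x in (0:ℝ)..(2 * π), Complex.exp ((x * n + w : ℝ) * Complex.I) =
      if n = 0 then 2 * π * Complex.exp (w * Complex.I) else 0 := by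
  split_ifs with h
  · subst h
    simp
  · have h1 : ∀ x : ℝ, Complex.exp ((x * n + w : ℝ) * Complex.I) =
        Complex.exp (w * Complex.I) * Complex.exp ((n * Complex.I) * x) := fun x => by
      rw [← Complex.exp_add]; congr 1; push_cast; ring
    simp_rw [h1]
    rw [intervalIntegral.integral_const_mul, integral_exp_mul_complex]
    · have h2 : (n * Complex.I : ℂ) * ((2 * π : ℝ) : ℂ) = n * (2 * π * Complex.I) := by
        push_cast; ring
      rw [h2, Complex.exp_int_mul_two_pi_mul_I]
      simp
    · exact mul_ne_zero (by exact_mod_cast h) Complex.I_ne_zero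

variable {ι : Type*} (φ ψ : ι → ℤ)

lemma integral_trigPoly_left (c : ι →₀ ℂ) (x y : ℝ) :
    ∫ s in (0:ℝ)..(2 * π), trigPoly φ ψ c (s, y) =
      2 * π * trigPoly φ ψ (c.filter fun i => φ i = 0) (x, y) := by
  simp_rw [trigPoly_apply]
  rw [intervalIntegral.integral_finsetSum fun i _ =>
    Continuous.intervalIntegrable (by fun_prop) _ _, Finset.mul_sum, Finsupp.support_filter,
    Finset.sum_filter]
  refine Finset.sum_congr rfl fun i _ => ?_
  rw [intervalIntegral.integral_const_mul, integral_exp_int]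
  split_ifs with h
  · rw [Finsupp.filter_apply_pos (fun i => φ i = 0) _ h, h]
    push_cast
    ring_nf
  · simp

lemma enorm_trigPoly_filter_le {f : ℝ → ℝ → ℝ} (hf : Measurable (Function.uncurry f))
    (c : ι →₀ ℂ) (x : ℝ) {y : ℝ} (hy : ∫ s in (0:ℝ)..(2 * π), f s y = 0) :
    ‖trigPoly φ ψ (c.filter fun i => φ i = 0) (x, y)‖ₑ ≤ ENNReal.ofReal (2 * π)⁻¹ *
      ∫⁻ s in Set.Ioc (0:ℝ) (2 * π), ‖(f s y : ℂ) - trigPoly φ ψ c (s, y)‖ₑ := by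
  have hTc : Continuous fun s => trigPoly φ ψ c (s, y) :=
    (continuous_trigPoly φ ψ c).comp (by fun_prop)
  have hfm : Measurable fun s => (f s y : ℂ) :=
    Complex.measurable_ofReal.comp (hf.comp (measurable_id.prodMk measurable_const))
  have hm : Measurable fun s => (f s y : ℂ) - trigPoly φ ψ c (s, y) := hfm.sub hTc.measurable
  have hpi : (0:ℝ) < (2 * π)⁻¹ := inv_pos.2 two_pi_pos
  by_cases ht : ∫⁻ s in Set.Ioc (0:ℝ) (2 * π), ‖(f s y : ℂ) - trigPoly φ ψ c (s, y)‖ₑ = ⊤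
  · rw [ht, ENNReal.mul_top (by simpa using hpi)]
    exact le_top
  have hI : IntervalIntegrable (fun s => (f s y : ℂ) - trigPoly φ ψ c (s, y)) volume 0 (2 * π) := by
    rw [intervalIntegrable_iff_integrableOn_Ioc_of_le two_pi_pos.le]
    exact ⟨hm.aestronglyMeasurable, Ne.lt_top ht⟩
  have hT : IntervalIntegrable (fun s => trigPoly φ ψ c (s, y)) volume 0 (2 * π) :=
    hTc.intervalIntegrable _ _
  have h1 : ∫ s in (0:ℝ)..(2 * π), (f s y : ℂ) = 0 := by
    rw [intervalIntegral.integral_ofReal, hy, Complex.ofReal_zero]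
  have hfI : IntervalIntegrable (fun s => (f s y : ℂ)) volume 0 (2 * π) := by
    have := hI.add hT
    simpa using this
  have h2 : ∫ s in (0:ℝ)..(2 * π), ((f s y : ℂ) - trigPoly φ ψ c (s, y)) =
      -(2 * π * trigPoly φ ψ (c.filter fun i => φ i = 0) (x, y)) := by
    rw [intervalIntegral.integral_sub hfI hT, h1, integral_trigPoly_left φ ψ c x y, zero_sub]
  have h3 : trigPoly φ ψ (c.filter fun i => φ i = 0) (x, y) = -(((2 * π)⁻¹ : ℝ) : ℂ) *
      ∫ s in Set.Ioc (0:ℝ) (2 * π), ((f s y : ℂ) - trigPoly φ ψ c (s, y)) := by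
    rw [← intervalIntegral.integral_of_le two_pi_pos.le, h2]
    have : (π : ℂ) ≠ 0 := by exact_mod_cast pi_ne_zero
    push_cast
    field_simp
  rw [h3, enorm_mul, enorm_neg]
  refine mul_le_mul' (le_of_eq ?_) (enorm_integral_le_lintegral_enorm _)
  rw [← ofReal_norm, Complex.norm_real, Real.norm_of_nonneg hpi.le]

/-- The constant bounding the mean over one variable on the period square. -/
def meanConst (p : ℝ) : ℝ≥0∞ :=
  (ENNReal.ofReal (2 * π) * (ENNReal.ofReal (2 * π)⁻¹ * ENNReal.ofReal (2 * π) ^ (1 - 1 / p)) ^ p)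
    ^ (1 / p)

lemma meanConst_ne_top {p : ℝ} (hp : 1 ≤ p) : meanConst p ≠ ⊤ := by
  have h : 0 ≤ 1 - 1 / p := by
    rw [sub_nonneg, div_le_one (by linarith)]; exact hp
  exact ENNReal.rpow_ne_top_of_nonneg (by positivity)
    (ENNReal.mul_ne_top ENNReal.ofReal_ne_top (ENNReal.rpow_ne_top_of_nonneg (by linarith)
      (ENNReal.mul_ne_top ENNReal.ofReal_ne_top
        (ENNReal.rpow_ne_top_of_nonneg h ENNReal.ofReal_ne_top))))

lemma lintegral_enorm_le_rpow {p : ℝ} (hp : 1 ≤ p) {F : ℝ → ℂ} (hF : Measurable F) :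
    ∫⁻ s in Set.Ioc (0:ℝ) (2 * π), ‖F s‖ₑ ≤
      (∫⁻ s in Set.Ioc (0:ℝ) (2 * π), ‖F s‖ₑ ^ p) ^ (1 / p) *
        ENNReal.ofReal (2 * π) ^ (1 - 1 / p) := by
  have hp0 : 0 < p := by linarith
  have h := eLpNorm_le_eLpNorm_mul_rpow_measure_univ (p := 1) (q := ENNReal.ofReal p)
    (μ := volume.restrict (Set.Ioc (0:ℝ) (2 * π))) (by simpa using hp) hF.aestronglyMeasurable
  rw [eLpNorm_one_eq_lintegral_enorm, eLpNorm_eq_of_pos hp0] at h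
  simpa [ENNReal.toReal_ofReal hp0.le] using h

lemma eLpNorm_trigPoly_filter_le {p : ℝ} (hp : 1 ≤ p) {f : ℝ → ℝ → ℝ}
    (hf : Measurable (Function.uncurry f))
    (hmean : ∀ᵐ (y : ℝ) ∂volume, (∫ x in (0:ℝ)..(2 * π), f x y) = 0) (c : ι →₀ ℂ) :
    eLpNorm (trigPoly φ ψ (c.filter fun i => φ i = 0)) (ENNReal.ofReal p) sqMeasure ≤
      meanConst p * trigDist φ ψ p f c := by
  have hp0 : 0 < p := by linarith
  set m : Measure ℝ := volume.restrict (Set.Ioc (0:ℝ) (2 * π)) with hm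
  set F : ℝ × ℝ → ℂ := fun z => (f z.1 z.2 : ℂ) - trigPoly φ ψ c z with hFd
  have hF : Measurable F :=
    (Complex.measurable_ofReal.comp hf).sub (continuous_trigPoly φ ψ c).measurable
  set M : ℝ≥0∞ := ENNReal.ofReal (2 * π)⁻¹ * ENNReal.ofReal (2 * π) ^ (1 - 1 / p) with hM
  have hFp : Measurable fun z => ‖F z‖ₑ ^ p := hF.enorm.pow_const p
  have hH : Measurable fun y => ∫⁻ s, ‖F (s, y)‖ₑ ^ p ∂m := hFp.lintegral_prod_left'
  have hae : ∀ᵐ z ∂sqMeasure, ‖trigPoly φ ψ (c.filter fun i => φ i = 0) z‖ₑ ^ p ≤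
      M ^ p * ∫⁻ s, ‖F (s, z.2)‖ₑ ^ p ∂m := by
    have h1 : ∀ᵐ y ∂m, (∫ x in (0:ℝ)..(2 * π), f x y) = 0 := ae_restrict_of_ae hmean
    have h2 : ∀ᵐ z ∂(m.prod m), (∫ x in (0:ℝ)..(2 * π), f x z.2) = 0 :=
      Measure.quasiMeasurePreserving_snd.ae h1
    filter_upwards [h2] with z hz
    have h3 := enorm_trigPoly_filter_le φ ψ hf c z.1 hz
    have h4 := lintegral_enorm_le_rpow hp (F := fun s => F (s, z.2))
      (hF.comp (measurable_id.prodMk measurable_const))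
    have h5 : ‖trigPoly φ ψ (c.filter fun i => φ i = 0) z‖ₑ ≤
        M * (∫⁻ s, ‖F (s, z.2)‖ₑ ^ p ∂m) ^ (1 / p) := by
      refine h3.trans ((mul_le_mul_right h4 _).trans (le_of_eq ?_))
      rw [hM]; ring
    refine (ENNReal.rpow_le_rpow h5 hp0.le).trans (le_of_eq ?_)
    rw [ENNReal.mul_rpow_of_nonneg _ _ hp0.le, ← ENNReal.rpow_mul, one_div,
      inv_mul_cancel₀ hp0.ne', ENNReal.rpow_one]
  have hFint : ∫⁻ z, M ^ p * ∫⁻ s, ‖F (s, z.2)‖ₑ ^ p ∂m ∂sqMeasure =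
      ENNReal.ofReal (2 * π) * M ^ p * ∫⁻ z, ‖F z‖ₑ ^ p ∂sqMeasure := by
    have hu : m Set.univ = ENNReal.ofReal (2 * π) := by simp [hm]
    have hH2 : Measurable fun z : ℝ × ℝ => ∫⁻ s, ‖F (s, z.2)‖ₑ ^ p ∂m := hH.comp measurable_snd
    rw [lintegral_const_mul _ hH2]
    unfold sqMeasure
    rw [lintegral_prod _ hH2.aemeasurable,
      lintegral_prod_symm _ hFp.aemeasurable]
    simp only
    rw [lintegral_const, ← hm, hu]
    ring
  unfold trigDist
  rw [eLpNorm_eq_of_pos hp0, eLpNorm_eq_of_pos hp0, meanConst,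
    ← ENNReal.mul_rpow_of_nonneg _ _ (by positivity), ← hFint]
  exact ENNReal.rpow_le_rpow (lintegral_mono_ae hae) (by positivity)

lemma trigDist_filter_left_le {p : ℝ} (hp : 1 ≤ p) {f : ℝ → ℝ → ℝ}
    (hf : Measurable (Function.uncurry f))
    (hmean : ∀ᵐ (y : ℝ) ∂volume, (∫ x in (0:ℝ)..(2 * π), f x y) = 0) (c : ι →₀ ℂ) :
    trigDist φ ψ p f (c.filter fun i => φ i ≠ 0) ≤ (1 + meanConst p) * trigDist φ ψ p f c := by
  have hc : c.filter (fun i => φ i = 0) + c.filter (fun i => φ i ≠ 0) = c :=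
    Finsupp.filter_add_filter_not _ _
  have hT : ∀ d : ι →₀ ℂ, AEStronglyMeasurable (trigPoly φ ψ d) sqMeasure := fun d =>
    (continuous_trigPoly φ ψ d).aestronglyMeasurable
  have hfm : Measurable fun z : ℝ × ℝ => (f z.1 z.2 : ℂ) := Complex.measurable_ofReal.comp hf
  have e : (fun z : ℝ × ℝ => (f z.1 z.2 : ℂ) - trigPoly φ ψ (c.filter fun i => φ i ≠ 0) z) =
      (fun z => (f z.1 z.2 : ℂ) - trigPoly φ ψ c z) +
        trigPoly φ ψ (c.filter fun i => φ i = 0) := by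
    funext z
    conv_rhs => rw [← hc, map_add]
    simp only [Pi.add_apply, hc]
    ring
  rw [trigDist, e, add_mul, one_mul]
  exact (eLpNorm_add_le (hfm.aestronglyMeasurable.sub (hT _)) (hT _) (by simpa using hp)).trans
    (add_le_add le_rfl (eLpNorm_trigPoly_filter_le φ ψ hp hf hmean c))

lemma trigDist_swap {p : ℝ} {f : ℝ → ℝ → ℝ} (hf : Measurable (Function.uncurry f)) (c : ι →₀ ℂ) :
    trigDist ψ φ p (fun x y => f y x) c = trigDist φ ψ p f c := by
  have hfm : Measurable fun z : ℝ × ℝ => (f z.1 z.2 : ℂ) := Complex.measurable_ofReal.comp hf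
  have hF : Measurable fun z : ℝ × ℝ => (f z.1 z.2 : ℂ) - trigPoly φ ψ c z :=
    hfm.sub (continuous_trigPoly φ ψ c).measurable
  unfold trigDist
  rw [← eLpNorm_comp_measurePreserving (ν := sqMeasure) (f := Prod.swap)
    hF.aestronglyMeasurable Measure.measurePreserving_swap]
  congr 1
  funext z
  simp only [Function.comp, trigPoly_apply, Prod.fst_swap, Prod.snd_swap, add_comm (z.1 * _)]

lemma trigDist_filter_right_le {p : ℝ} (hp : 1 ≤ p) {f : ℝ → ℝ → ℝ}
    (hf : Measurable (Function.uncurry f))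
    (hmean : ∀ᵐ (x : ℝ) ∂volume, (∫ y in (0:ℝ)..(2 * π), f x y) = 0) (c : ι →₀ ℂ) :
    trigDist φ ψ p f (c.filter fun i => ψ i ≠ 0) ≤ (1 + meanConst p) * trigDist φ ψ p f c := by
  rw [← trigDist_swap φ ψ hf, ← trigDist_swap φ ψ hf]
  exact trigDist_filter_left_le ψ φ (f := fun x y => f y x) hp (hf.comp measurable_swap) hmean c

/-- Frequencies with no vanishing coordinate. -/
abbrev NonzeroFreq : Type := {k : Fin 2 → ℤ // k 0 ≠ 0 ∧ k 1 ≠ 0}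

/-- Trigonometric polynomials without zero frequencies are dense in `L_p^0`. -/
lemma exists_nonzeroFreq_trigDist_le {p : ℝ} (hp : 1 ≤ p) {f : ℝ → ℝ → ℝ} (hf : MemLp0 p f)
    {ε : ℝ≥0∞} (hε : ε ≠ 0) : ∃ c : NonzeroFreq →₀ ℂ,
      trigDist (fun k => k.1 0) (fun k => k.1 1) p f c ≤ ε := by
  set φ : (Fin 2 → ℤ) → ℤ := fun k => k 0
  set ψ : (Fin 2 → ℤ) → ℤ := fun k => k 1
  set K : ℝ≥0∞ := (1 + meanConst p) * (1 + meanConst p) with hK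
  have hKt : K ≠ ⊤ := by simp [hK, ENNReal.mul_eq_top, meanConst_ne_top hp]
  obtain ⟨η, hη, hηK⟩ := exists_pos_mul_ofReal_le hKt hε
  obtain ⟨c, hc⟩ := exists_trigDist_le hp hf (ε := ENNReal.ofReal η) (by simpa using hη)
  set d := (c.filter fun k => φ k ≠ 0).filter fun k => ψ k ≠ 0 with hd
  have h1 : trigDist φ ψ p f d ≤ ε :=
    calc trigDist φ ψ p f d
        ≤ (1 + meanConst p) * trigDist φ ψ p f (c.filter fun k => φ k ≠ 0) :=
          trigDist_filter_right_le φ ψ hp hf.meas hf.mean_y _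
      _ ≤ (1 + meanConst p) * ((1 + meanConst p) * trigDist φ ψ p f c) :=
          mul_le_mul_right (trigDist_filter_left_le φ ψ hp hf.meas hf.mean_x _) _
      _ ≤ K * ENNReal.ofReal η := by
          rw [← mul_assoc]; exact mul_le_mul_right hc _
      _ ≤ ε := hηK
  set d' : NonzeroFreq →₀ ℂ := d.subtypeDomain fun k => k 0 ≠ 0 ∧ k 1 ≠ 0 with hd'
  refine ⟨d', ?_⟩
  have h2 : trigPoly (fun k : NonzeroFreq => k.1 0) (fun k => k.1 1) d' = trigPoly φ ψ d := by
    funext z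
    rw [trigPoly_apply, trigPoly_apply]
    refine Finset.sum_bij_ne_zero (fun k _ _ => k.1) ?_ ?_ ?_ ?_
    · intro k hk _
      simpa [hd'] using hk
    · intro a _ _ b _ _ h
      exact Subtype.ext h
    · intro k hk _
      have h3 : k 0 ≠ 0 ∧ k 1 ≠ 0 := by
        rw [hd, Finsupp.support_filter, Finset.mem_filter, Finsupp.support_filter,
          Finset.mem_filter] at hk
        exact ⟨hk.1.2, hk.2⟩
      exact ⟨⟨k, h3⟩, by simpa [hd'] using hk, by assumption, rfl⟩
    · intro k _ _
      rfl
  unfold trigDist at h1 ⊢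
  rwa [h2]

end ZeroMean

section DiscreteInequalities

lemma tendsto_of_le_add_of_le_add {x : ℝ≥0∞} {a e : ℕ → ℝ≥0∞}
    (he : Filter.Tendsto e Filter.atTop (nhds 0)) (h1 : ∀ n, x ≤ a n + e n)
    (h2 : ∀ n, a n ≤ x + e n) : Filter.Tendsto a Filter.atTop (nhds x) := by
  refine tendsto_of_tendsto_of_tendsto_of_le_of_le (g := fun n => x - e n) (h := fun n => x + e n)
    ?_ ?_ (fun n => tsub_le_iff_right.2 (h1 n)) h2
  · simpa using ENNReal.Tendsto.sub (tendsto_const_nhds (x := x)) he (Or.inr ENNReal.zero_ne_top)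
  · simpa using (tendsto_const_nhds (x := x)).add he

lemma exists_tendsto_coefMod {p : ℝ} (hp : 1 ≤ p) {f : ℝ → ℝ → ℝ} (hf : MemLp0 p f) :
    ∃ c : ℕ → NonzeroFreq →₀ ℂ, ∀ a b t u : ℝ, 0 < a → 0 < b →
      Filter.Tendsto (fun n => coefMod (trigNorm (fun k : NonzeroFreq => k.1 0) (fun k => k.1 1) hp)
        (fun k => k.1 0) (fun k => k.1 1) a b t u (c n)) Filter.atTop
        (nhds (mixedMod p a b t u f)) := by
  have h : ∀ n : ℕ, ∃ c : NonzeroFreq →₀ ℂ,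
      trigDist (fun k => k.1 0) (fun k => k.1 1) p f c ≤ (n : ℝ≥0∞)⁻¹ := fun n =>
    exists_nonzeroFreq_trigDist_le hp hf (by simp)
  choose c hc using h
  refine ⟨c, fun a b t u ha hb => ?_⟩
  have hD : diffConst a * diffConst b ≠ ⊤ :=
    ENNReal.mul_ne_top (diffConst_ne_top ha) (diffConst_ne_top hb)
  refine tendsto_of_le_add_of_le_add (e := fun n => diffConst a * diffConst b * (n : ℝ≥0∞)⁻¹)
    ?_ (fun n => ?_) fun n => ?_
  · simpa using ENNReal.Tendsto.const_mul ENNReal.tendsto_inv_nat_nhds_zero (Or.inr hD)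
  · exact (mixedMod_le_coefMod _ _ hp hf ha hb t u (c n)).trans
      (add_le_add le_rfl (mul_le_mul_right (hc n) _))
  · exact (coefMod_le_mixedMod _ _ hp hf ha hb t u (c n)).trans
      (add_le_add le_rfl (mul_le_mul_right (hc n) _))

variable {p : ℝ} (hp : 1 < p) {a b a' b' : ℝ} (ha : 0 < a) (hb : 0 < b) (haa : a < a')
  (hbb : b < b')
include hp ha hb haa hbb

/-- Discrete form of the sharp Marchaud inequality. -/
lemma tsum_mixedMod_rpow_le : ∃ C : ℝ≥0, ∀ f, MemLp0 p f → ∀ t u : ℝ, 0 < t → 0 < u →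
    ∑' j : ℕ, ∑' k : ℕ, (gw a ^ j * gw b ^ k *
      mixedMod p a' b' (2 ^ j * t) (2 ^ k * u) f) ^ max 2 p ≤
      C * mixedMod p a b t u f ^ max 2 p := by
  set φ : NonzeroFreq → ℤ := fun k => k.1 0
  set ψ : NonzeroFreq → ℤ := fun k => k.1 1
  obtain ⟨S, hS, hUC⟩ := (isLpSeminorm_trigNorm φ ψ hp.le).exists_unifConvex hp
  obtain ⟨C, hC⟩ := tsum_coefMod_rpow_le (transInv_trigNorm_left φ ψ hp.le)
    (transInv_trigNorm_right φ ψ hp.le) (fun k => k.2.1) (fun k => k.2.2)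
    (by linarith [le_max_left 2 p]) hS hUC ha hb haa hbb
  refine ⟨C, fun f hf t u ht hu => ?_⟩
  obtain ⟨c, hc⟩ := exists_tendsto_coefMod hp.le hf
  rw [← ENNReal.tsum_prod, ENNReal.tsum_eq_iSup_sum]
  refine iSup_le fun s => ?_
  have hl : Filter.Tendsto (fun n => ∑ x ∈ s, (gw a ^ x.1 * gw b ^ x.2 *
      coefMod (trigNorm φ ψ hp.le) φ ψ a' b' (2 ^ x.1 * t) (2 ^ x.2 * u) (c n)) ^ max 2 p)
      Filter.atTop (nhds (∑ x ∈ s, (gw a ^ x.1 * gw b ^ x.2 *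
        mixedMod p a' b' (2 ^ x.1 * t) (2 ^ x.2 * u) f) ^ max 2 p)) :=
    tendsto_finsetSum _ fun x _ => (ENNReal.continuous_rpow_const.tendsto _).comp
      (ENNReal.Tendsto.const_mul (hc a' b' _ _ (by linarith) (by linarith))
        (Or.inr (ENNReal.mul_ne_top (ENNReal.pow_ne_top (gw_ne_top _))
          (ENNReal.pow_ne_top (gw_ne_top _)))))
  have hr : Filter.Tendsto (fun n => (C : ℝ≥0∞) *
      coefMod (trigNorm φ ψ hp.le) φ ψ a b t u (c n) ^ max 2 p) Filter.atTop
      (nhds (C * mixedMod p a b t u f ^ max 2 p)) :=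
    ENNReal.Tendsto.const_mul ((ENNReal.continuous_rpow_const.tendsto _).comp (hc a b t u ha hb))
      (Or.inr ENNReal.coe_ne_top)
  refine le_of_tendsto_of_tendsto' hl hr fun n => ?_
  refine le_trans ?_ (hC t u ht hu (c n))
  rw [← ENNReal.tsum_prod]
  exact ENNReal.sum_le_tsum s

/-- Discrete form of the sharp Jackson-type inequality. -/
lemma mixedMod_rpow_le_sum : ∃ C : ℝ≥0, ∀ f, MemLp0 p f → ∀ (t u : ℝ) (J J' : ℕ), 0 < t → 0 < u →
    1 / 4 ≤ 2 ^ J * t → 1 / 4 ≤ 2 ^ J' * u → mixedMod p a b t u f ^ min 2 p ≤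
      C * ∑ j ∈ Finset.range (J + 1), ∑ k ∈ Finset.range (J' + 1), (gw a ^ j * gw b ^ k *
        mixedMod p a' b' (2 ^ j * t) (2 ^ k * u) f) ^ min 2 p := by
  set φ : NonzeroFreq → ℤ := fun k => k.1 0
  set ψ : NonzeroFreq → ℤ := fun k => k.1 1
  obtain ⟨S, hS, hUS⟩ := (isLpSeminorm_trigNorm φ ψ hp.le).exists_unifSmooth hp
  obtain ⟨C, hC⟩ := coefMod_rpow_le_sum (transInv_trigNorm_left φ ψ hp.le)
    (transInv_trigNorm_right φ ψ hp.le) (fun k => k.2.1) (fun k => k.2.2)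
    (le_min one_le_two hp.le) (min_le_left 2 p) hS hUS ha hb haa hbb
  refine ⟨C, fun f hf t u J J' ht hu hJ hJ' => ?_⟩
  obtain ⟨c, hc⟩ := exists_tendsto_coefMod hp.le hf
  refine le_of_tendsto_of_tendsto'
    ((ENNReal.continuous_rpow_const.tendsto _).comp (hc a b t u ha hb))
    (ENNReal.Tendsto.const_mul ?_ (Or.inr ENNReal.coe_ne_top))
    fun n => hC t u J J' ht hu hJ hJ' (c n)
  exact tendsto_finsetSum _ fun j _ => tendsto_finsetSum _ fun k _ =>
    (ENNReal.continuous_rpow_const.tendsto _).comp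
      (ENNReal.Tendsto.const_mul (hc a' b' _ _ (by linarith) (by linarith))
        (Or.inr (ENNReal.mul_ne_top (ENNReal.pow_ne_top (gw_ne_top _))
          (ENNReal.pow_ne_top (gw_ne_top _)))))

end DiscreteInequalities

section DyadicIntegrals

/-- The weight `t ^ (-a - 1)`. -/
def powWeight (a t : ℝ) : ℝ≥0∞ := ENNReal.ofReal (t ^ (-a) / t)

lemma ofReal_two_pow_mul_rpow_neg {a δ : ℝ} (hδ : 0 < δ) (j : ℕ) :
    ENNReal.ofReal ((2 ^ j * δ) ^ (-a)) = ENNReal.ofReal (δ ^ (-a)) * gw a ^ j := by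
  rw [gw_pow, gw, ← ENNReal.ofReal_mul (by positivity), mul_rpow (by positivity) hδ.le,
    ← rpow_natCast, ← rpow_mul (by norm_num), mul_comm, mul_neg]

lemma lintegral_powWeight_le {a r : ℝ} (ha : 0 < a) (hr : 0 < r) {G : ℝ → ℝ≥0∞} (hG : Monotone G) :
    ∫⁻ t in Set.Ico r (2 * r), powWeight a t * G t ≤ ENNReal.ofReal (r ^ (-a)) * G (2 * r) := by
  calc ∫⁻ t in Set.Ico r (2 * r), powWeight a t * G t
      ≤ ∫⁻ _ in Set.Ico r (2 * r), ENNReal.ofReal (r ^ (-a) / r) * G (2 * r) := by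
        refine setLIntegral_mono' measurableSet_Ico fun t ht => mul_le_mul' ?_ (hG ht.2.le)
        refine ENNReal.ofReal_le_ofReal (div_le_div₀ (by positivity) ?_ hr ht.1)
        exact rpow_le_rpow_of_nonpos hr ht.1 (by linarith)
    _ = ENNReal.ofReal (r ^ (-a)) * G (2 * r) := by
        rw [setLIntegral_const, Real.volume_Ico, mul_right_comm,
          ← ENNReal.ofReal_mul (by positivity)]
        congr 3
        field_simp
        ring

lemma le_lintegral_powWeight {a r : ℝ} (ha : 0 < a) (hr : 0 < r) {G : ℝ → ℝ≥0∞} (hG : Monotone G) :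
    ENNReal.ofReal (r ^ (-a)) * G r ≤
      ENNReal.ofReal (2 ^ (a + 1)) * ∫⁻ t in Set.Ioo r (2 * r), powWeight a t * G t := by
  have h : ∫⁻ _ in Set.Ioo r (2 * r), ENNReal.ofReal ((2 * r) ^ (-a) / (2 * r)) * G r ≤
      ∫⁻ t in Set.Ioo r (2 * r), powWeight a t * G t := by
    refine setLIntegral_mono' measurableSet_Ioo fun t ht => mul_le_mul' ?_ (hG ht.1.le)
    have ht0 : 0 < t := hr.trans ht.1
    refine ENNReal.ofReal_le_ofReal (div_le_div₀ (by positivity) ?_ ht0 ht.2.le)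
    exact rpow_le_rpow_of_nonpos ht0 ht.2.le (by linarith)
  refine le_trans (le_of_eq ?_) (mul_le_mul_right h _)
  rw [setLIntegral_const, Real.volume_Ioo, mul_right_comm, ← ENNReal.ofReal_mul (by positivity),
    ← mul_assoc, ← ENNReal.ofReal_mul (by positivity)]
  congr 2
  rw [mul_rpow (by norm_num) hr.le, rpow_add (by norm_num), rpow_one,
    rpow_neg (zero_le_two : (0:ℝ) ≤ 2), rpow_neg hr.le]
  field_simp
  ring

lemma lintegral_powWeight_le_tsum {a δ : ℝ} (ha : 0 < a) (hδ : 0 < δ) {G : ℝ → ℝ≥0∞}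
    (hG : Monotone G) : ∫⁻ t in Set.Ioo δ 1, powWeight a t * G t ≤
      ENNReal.ofReal (2 ^ a) * ENNReal.ofReal (δ ^ (-a)) * ∑' j : ℕ, gw a ^ j * G (2 ^ j * δ) := by
  have hcov : Set.Ioo δ 1 ⊆ ⋃ j : ℕ, Set.Ico (2 ^ j * δ) (2 * (2 ^ j * δ)) := fun t ht => by
    obtain ⟨n, h1, h2⟩ := exists_nat_pow_near (x := t / δ) (y := 2)
      ((one_le_div hδ).2 ht.1.le) one_lt_two
    refine Set.mem_iUnion.2 ⟨n, (le_div_iff₀ hδ).1 h1, ?_⟩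
    have := (div_lt_iff₀ hδ).1 h2
    rwa [pow_succ', mul_assoc] at this
  have h2a : (1 : ℝ≥0∞) = ENNReal.ofReal (2 ^ a) * gw a := by
    rw [gw, ← ENNReal.ofReal_mul (by positivity), ← rpow_add (by norm_num)]
    simp
  calc ∫⁻ t in Set.Ioo δ 1, powWeight a t * G t
      ≤ ∫⁻ t in ⋃ j : ℕ, Set.Ico (2 ^ j * δ) (2 * (2 ^ j * δ)), powWeight a t * G t :=
        lintegral_mono_set hcov
    _ ≤ ∑' j : ℕ, ∫⁻ t in Set.Ico (2 ^ j * δ) (2 * (2 ^ j * δ)), powWeight a t * G t :=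
        lintegral_iUnion_le _ _
    _ ≤ ∑' j : ℕ, ENNReal.ofReal (2 ^ a) * ENNReal.ofReal (δ ^ (-a)) *
          (gw a ^ (j + 1) * G (2 ^ (j + 1) * δ)) := by
        refine ENNReal.tsum_le_tsum fun j => ?_
        refine (lintegral_powWeight_le ha (by positivity) hG).trans (le_of_eq ?_)
        rw [ofReal_two_pow_mul_rpow_neg hδ, pow_succ' (2:ℝ), mul_assoc (2:ℝ), pow_succ]
        calc _ = 1 * (ENNReal.ofReal (δ ^ (-a)) * gw a ^ j * G (2 * (2 ^ j * δ))) := (one_mul _).symm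
          _ = _ := by rw [h2a]; ring
    _ ≤ _ := by
        rw [ENNReal.tsum_mul_left]
        refine mul_le_mul_right ?_ _
        exact ENNReal.tsum_comp_le_tsum_of_injective (add_left_injective 1)
          fun j => gw a ^ j * G (2 ^ j * δ)

lemma sum_le_lintegral_powWeight {a δ : ℝ} (ha : 0 < a) (hδ : 0 < δ) {J : ℕ}
    (hJ : 2 ^ J * δ ≤ 1 / 2) {G : ℝ → ℝ≥0∞} (hG : Monotone G) :
    ENNReal.ofReal (δ ^ (-a)) * ∑ j ∈ Finset.range (J + 1), gw a ^ j * G (2 ^ j * δ) ≤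
      ENNReal.ofReal (2 ^ (a + 1)) * ∫⁻ t in Set.Ioo δ 1, powWeight a t * G t := by
  set I : ℕ → Set ℝ := fun j => Set.Ioo (2 ^ j * δ) (2 * (2 ^ j * δ)) with hI
  have hle : ∀ i j : ℕ, i < j → 2 * (2 ^ i * δ) ≤ 2 ^ j * δ := fun i j hij => by
    rw [← mul_assoc, ← pow_succ']
    exact mul_le_mul_of_nonneg_right (pow_le_pow_right₀ one_le_two hij) hδ.le
  have hdis : Set.PairwiseDisjoint (Finset.range (J + 1) : Set ℕ) I := by
    intro i _ j _ hij
    refine Set.disjoint_left.2 fun t hi hj => ?_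
    rcases lt_or_gt_of_ne hij with h | h
    · exact absurd (hi.2.trans_le (hle i j h)) hj.1.not_gt
    · exact absurd (hj.2.trans_le (hle j i h)) hi.1.not_gt
  have hsub : ⋃ j ∈ Finset.range (J + 1), I j ⊆ Set.Ioo δ 1 := by
    refine Set.iUnion₂_subset fun j hj t ht => ⟨?_, ?_⟩
    · refine lt_of_le_of_lt ?_ ht.1
      exact le_mul_of_one_le_left hδ.le (one_le_pow₀ one_le_two)
    · have h1 : (2:ℝ) ^ j * δ ≤ 2 ^ J * δ := mul_le_mul_of_nonneg_right
        (pow_le_pow_right₀ one_le_two (by simpa [Nat.lt_succ_iff] using hj)) hδ.le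
      have := ht.2
      linarith
  calc _ = ∑ j ∈ Finset.range (J + 1),
          ENNReal.ofReal ((2 ^ j * δ) ^ (-a)) * G (2 ^ j * δ) := by
        rw [Finset.mul_sum]
        refine Finset.sum_congr rfl fun j _ => ?_
        rw [ofReal_two_pow_mul_rpow_neg hδ, mul_assoc]
    _ ≤ ∑ j ∈ Finset.range (J + 1),
          ENNReal.ofReal (2 ^ (a + 1)) * ∫⁻ t in I j, powWeight a t * G t :=
        Finset.sum_le_sum fun j _ => le_lintegral_powWeight ha (by positivity) hG
    _ = ENNReal.ofReal (2 ^ (a + 1)) *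
          ∫⁻ t in ⋃ j ∈ Finset.range (J + 1), I j, powWeight a t * G t := by
        rw [← Finset.mul_sum, lintegral_biUnion_finset hdis fun _ _ => measurableSet_Ioo]
    _ ≤ _ := mul_le_mul_right (lintegral_mono_set hsub) _

/-- The double integral in the Marchaud expression, with separated weights. -/
def dyadicInt (a b δ ε : ℝ) (W : ℝ → ℝ → ℝ≥0∞) : ℝ≥0∞ :=
  ∫⁻ t in Set.Ioo δ 1, powWeight a t * ∫⁻ u in Set.Ioo ε 1, powWeight b u * W t u

lemma dyadicInt_le_tsum {a b δ ε : ℝ} (ha : 0 < a) (hb : 0 < b) (hδ : 0 < δ) (hε : 0 < ε)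
    {W : ℝ → ℝ → ℝ≥0∞} (hW : Monotone W) (hW' : ∀ t, Monotone (W t)) :
    dyadicInt a b δ ε W ≤ ENNReal.ofReal (2 ^ a) * ENNReal.ofReal (2 ^ b) *
      (ENNReal.ofReal (δ ^ (-a)) * ENNReal.ofReal (ε ^ (-b))) *
        ∑' j : ℕ, ∑' k : ℕ, gw a ^ j * gw b ^ k * W (2 ^ j * δ) (2 ^ k * ε) := by
  refine (lintegral_powWeight_le_tsum ha hδ
    (G := fun t => ∫⁻ u in Set.Ioo ε 1, powWeight b u * W t u) fun t t' htt =>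
    lintegral_mono fun u => mul_le_mul_right (hW htt u) _).trans ?_
  calc _ ≤ ENNReal.ofReal (2 ^ a) * ENNReal.ofReal (δ ^ (-a)) * ∑' j : ℕ, gw a ^ j *
        (ENNReal.ofReal (2 ^ b) * ENNReal.ofReal (ε ^ (-b)) *
          ∑' k : ℕ, gw b ^ k * W (2 ^ j * δ) (2 ^ k * ε)) :=
        mul_le_mul_right (ENNReal.tsum_le_tsum fun j => mul_le_mul_right
          (lintegral_powWeight_le_tsum hb hε (hW' _)) _) _
    _ = _ := by
        have : ∀ j : ℕ, ∑' k : ℕ, gw a ^ j * gw b ^ k * W (2 ^ j * δ) (2 ^ k * ε) =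
            gw a ^ j * ∑' k : ℕ, gw b ^ k * W (2 ^ j * δ) (2 ^ k * ε) := fun j => by
          rw [← ENNReal.tsum_mul_left]
          simp only [mul_assoc]
        simp only [this, mul_left_comm (gw a ^ _)]
        rw [ENNReal.tsum_mul_left]
        ring

lemma sum_le_dyadicInt {a b δ ε : ℝ} (ha : 0 < a) (hb : 0 < b) (hδ : 0 < δ) (hε : 0 < ε) {J J' : ℕ}
    (hJ : 2 ^ J * δ ≤ 1 / 2) (hJ' : 2 ^ J' * ε ≤ 1 / 2)
    {W : ℝ → ℝ → ℝ≥0∞} (hW : Monotone W) (hW' : ∀ t, Monotone (W t)) :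
    ENNReal.ofReal (δ ^ (-a)) * ENNReal.ofReal (ε ^ (-b)) *
      ∑ j ∈ Finset.range (J + 1), ∑ k ∈ Finset.range (J' + 1),
        gw a ^ j * gw b ^ k * W (2 ^ j * δ) (2 ^ k * ε) ≤
      ENNReal.ofReal (2 ^ (a + 1)) * ENNReal.ofReal (2 ^ (b + 1)) * dyadicInt a b δ ε W := by
  calc _ = ENNReal.ofReal (δ ^ (-a)) * ∑ j ∈ Finset.range (J + 1), gw a ^ j *
        (ENNReal.ofReal (ε ^ (-b)) *
          ∑ k ∈ Finset.range (J' + 1), gw b ^ k * W (2 ^ j * δ) (2 ^ k * ε)) := by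
        simp only [Finset.mul_sum]
        refine Finset.sum_congr rfl fun j _ => Finset.sum_congr rfl fun k _ => ?_
        ring
    _ ≤ ENNReal.ofReal (δ ^ (-a)) * ∑ j ∈ Finset.range (J + 1), gw a ^ j *
        (ENNReal.ofReal (2 ^ (b + 1)) *
          ∫⁻ u in Set.Ioo ε 1, powWeight b u * W (2 ^ j * δ) u) :=
        mul_le_mul_right (Finset.sum_le_sum fun j _ => mul_le_mul_right
          (sum_le_lintegral_powWeight hb hε hJ' (hW' _)) _) _
    _ = ENNReal.ofReal (2 ^ (b + 1)) * (ENNReal.ofReal (δ ^ (-a)) *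
          ∑ j ∈ Finset.range (J + 1), gw a ^ j *
            ∫⁻ u in Set.Ioo ε 1, powWeight b u * W (2 ^ j * δ) u) := by
        simp only [Finset.mul_sum]
        refine Finset.sum_congr rfl fun j _ => ?_
        ring
    _ ≤ ENNReal.ofReal (2 ^ (b + 1)) * (ENNReal.ofReal (2 ^ (a + 1)) * dyadicInt a b δ ε W) :=
        mul_le_mul_right (sum_le_lintegral_powWeight ha hδ hJ
          (G := fun t => ∫⁻ u in Set.Ioo ε 1, powWeight b u * W t u) fun t t' htt =>
          lintegral_mono fun u => mul_le_mul_right (hW htt u) _) _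
    _ = _ := by ring

end DyadicIntegrals

section Marchaud

variable {p α₁ α₂ β₁ β₂ : ℝ} {f : ℝ → ℝ → ℝ}

lemma mixedMod_mono {t t' u u' : ℝ} (ht : t ≤ t') (hu : u ≤ u') :
    mixedMod p β₁ β₂ t u f ≤ mixedMod p β₁ β₂ t' u' f :=
  iSup₂_le fun h hh => iSup₂_le fun k hk =>
    le_iSup₂_of_le h (hh.trans ht) (le_iSup₂_of_le k (hk.trans hu) le_rfl)

lemma marchaudInt_eq {δ₁ δ₂ s : ℝ} (hδ₁ : 0 < δ₁) (hδ₂ : 0 < δ₂) :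
    marchaudInt p α₁ α₂ β₁ β₂ δ₁ δ₂ s f = ENNReal.ofReal (δ₁ ^ α₁ * δ₂ ^ α₂) *
      dyadicInt (α₁ * s) (α₂ * s) δ₁ δ₂ (fun t u => mixedMod p β₁ β₂ t u f ^ s) ^ (1 / s) := by
  unfold marchaudInt dyadicInt
  congr 2
  refine setLIntegral_congr_fun measurableSet_Ioo fun t ht => ?_
  have ht0 : 0 < t := hδ₁.trans ht.1
  simp only
  have hw : powWeight (α₁ * s) t ≠ ⊤ := ENNReal.ofReal_ne_top
  rw [← lintegral_const_mul' _ _ hw]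
  refine setLIntegral_congr_fun measurableSet_Ioo fun u hu => ?_
  have hu0 : 0 < u := hδ₂.trans hu.1
  rw [powWeight, powWeight, ← mul_assoc, ← ENNReal.ofReal_mul (by positivity)]
  congr 2
  rw [mul_rpow (by positivity) (by positivity), ← rpow_mul ht0.le, ← rpow_mul hu0.le]
  simp only [neg_mul]
  field_simp

lemma ofReal_rpow_mul_ofReal_rpow_neg {δ₁ δ₂ s : ℝ} (hs : 0 < s) (hδ₁ : 0 < δ₁) (hδ₂ : 0 < δ₂) :
    ENNReal.ofReal (δ₁ ^ α₁ * δ₂ ^ α₂) *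
      (ENNReal.ofReal (δ₁ ^ (-(α₁ * s))) * ENNReal.ofReal (δ₂ ^ (-(α₂ * s)))) ^ (1 / s) = 1 := by
  have h : ∀ δ α : ℝ, 0 < δ → (δ ^ (-(α * s))) ^ (1 / s) = (δ ^ α)⁻¹ := fun δ α hδ => by
    rw [← rpow_mul hδ.le, ← rpow_neg hδ.le]
    congr 1
    field_simp
  rw [← ENNReal.ofReal_mul (by positivity),
    ENNReal.ofReal_rpow_of_nonneg (by positivity) (by positivity),
    ← ENNReal.ofReal_mul (by positivity), mul_rpow (by positivity) (by positivity), h _ _ hδ₁,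
    h _ _ hδ₂, ← ENNReal.ofReal_one]
  congr 1
  have := (rpow_pos_of_pos hδ₁ α₁).ne'
  have := (rpow_pos_of_pos hδ₂ α₂).ne'
  field_simp

lemma gw_mul_rpow {s : ℝ} (hs : 0 ≤ s) (j k : ℕ) (w : ℝ≥0∞) :
    (gw α₁ ^ j * gw α₂ ^ k * w) ^ s = gw (α₁ * s) ^ j * gw (α₂ * s) ^ k * w ^ s := by
  rw [ENNReal.mul_rpow_of_nonneg _ _ hs, ENNReal.mul_rpow_of_nonneg _ _ hs, gw_pow, gw_pow,
    gw_rpow, gw_rpow, gw_pow, gw_pow, mul_assoc (j : ℝ), mul_assoc (k : ℝ)]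

variable (hp : 1 < p) (hα₁ : 0 < α₁) (hα₂ : 0 < α₂) (hαβ₁ : α₁ < β₁) (hαβ₂ : α₂ < β₂)
include hp hα₁ hα₂ hαβ₁ hαβ₂

lemma exists_marchaudInt_le : ∃ K : ℝ≥0∞, K ≠ ⊤ ∧ ∀ (f : ℝ → ℝ → ℝ) (δ₁ δ₂ : ℝ), MemLp0 p f →
    0 < δ₁ → 0 < δ₂ → marchaudInt p α₁ α₂ β₁ β₂ δ₁ δ₂ (max 2 p) f ≤
      K * mixedMod p α₁ α₂ δ₁ δ₂ f := by
  obtain ⟨C, hC⟩ := tsum_mixedMod_rpow_le hp hα₁ hα₂ hαβ₁ hαβ₂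
  set s : ℝ := max 2 p
  have hs : 0 < s := by have : 2 ≤ s := le_max_left 2 p; linarith
  have hs' : 0 ≤ 1 / s := by positivity
  refine ⟨(ENNReal.ofReal (2 ^ (α₁ * s)) * ENNReal.ofReal (2 ^ (α₂ * s)) * C) ^ (1 / s),
    ENNReal.rpow_ne_top_of_nonneg hs' (by finiteness), fun f δ₁ δ₂ hf hδ₁ hδ₂ => ?_⟩
  have h1 := dyadicInt_le_tsum (mul_pos hα₁ hs) (mul_pos hα₂ hs) hδ₁ hδ₂
    (W := fun t u => mixedMod p β₁ β₂ t u f ^ s)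
    (fun t t' ht u => ENNReal.rpow_le_rpow (mixedMod_mono ht le_rfl) hs.le)
    (fun t u u' hu => ENNReal.rpow_le_rpow (mixedMod_mono le_rfl hu) hs.le)
  simp only [← gw_mul_rpow hs.le] at h1
  have h2 := h1.trans (mul_le_mul_right (hC f hf δ₁ δ₂ hδ₁ hδ₂) _)
  have h3 := ENNReal.rpow_le_rpow h2 hs'
  rw [marchaudInt_eq hδ₁ hδ₂]
  refine (mul_le_mul_right h3 _).trans (le_of_eq ?_)
  have hω : (mixedMod p α₁ α₂ δ₁ δ₂ f ^ s) ^ (1 / s) = mixedMod p α₁ α₂ δ₁ δ₂ f := by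
    rw [one_div, ENNReal.rpow_rpow_inv hs.ne']
  have h4 := ofReal_rpow_mul_ofReal_rpow_neg (α₁ := α₁) (α₂ := α₂) hs hδ₁ hδ₂
  simp only [ENNReal.mul_rpow_of_nonneg _ _ hs'] at h4 ⊢
  rw [hω]
  calc _ = ENNReal.ofReal (δ₁ ^ α₁ * δ₂ ^ α₂) * (ENNReal.ofReal (δ₁ ^ (-(α₁ * s))) ^ (1 / s) *
        ENNReal.ofReal (δ₂ ^ (-(α₂ * s))) ^ (1 / s)) * (ENNReal.ofReal (2 ^ (α₁ * s)) ^ (1 / s) *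
        ENNReal.ofReal (2 ^ (α₂ * s)) ^ (1 / s) * (C : ℝ≥0∞) ^ (1 / s) *
          mixedMod p α₁ α₂ δ₁ δ₂ f) := by ring
    _ = _ := by rw [h4, one_mul]

lemma exists_le_marchaudInt : ∃ K : ℝ≥0∞, K ≠ ⊤ ∧ ∀ (f : ℝ → ℝ → ℝ) (δ₁ δ₂ : ℝ), MemLp0 p f →
    δ₁ ∈ Set.Ioo (0:ℝ) (1/2) → δ₂ ∈ Set.Ioo (0:ℝ) (1/2) → mixedMod p α₁ α₂ δ₁ δ₂ f ≤
      K * marchaudInt p α₁ α₂ β₁ β₂ δ₁ δ₂ (min 2 p) f := by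
  obtain ⟨C, hC⟩ := mixedMod_rpow_le_sum hp hα₁ hα₂ hαβ₁ hαβ₂
  set s : ℝ := min 2 p
  have hs : 0 < s := lt_min two_pos (by linarith)
  have hs' : 0 ≤ 1 / s := by positivity
  refine ⟨(C * (ENNReal.ofReal (2 ^ (α₁ * s + 1)) * ENNReal.ofReal (2 ^ (α₂ * s + 1)))) ^ (1 / s),
    ENNReal.rpow_ne_top_of_nonneg hs' (by finiteness), fun f δ₁ δ₂ hf hδ₁ hδ₂ => ?_⟩
  have hJ : ∀ δ ∈ Set.Ioo (0:ℝ) (1/2), ∃ J : ℕ, 2 ^ J * δ ≤ 1 / 2 ∧ 1 / 4 ≤ 2 ^ J * δ := by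
    intro δ hδ
    obtain ⟨J, h1, h2⟩ := exists_nat_pow_near (x := 1 / 2 / δ) (y := 2)
      ((one_le_div hδ.1).2 hδ.2.le) one_lt_two
    refine ⟨J, (le_div_iff₀ hδ.1).1 h1, ?_⟩
    have := (div_lt_iff₀ hδ.1).1 h2
    rw [pow_succ] at this
    linarith
  obtain ⟨J, hJ1, hJ2⟩ := hJ δ₁ hδ₁
  obtain ⟨J', hJ'1, hJ'2⟩ := hJ δ₂ hδ₂
  have h1 := sum_le_dyadicInt (mul_pos hα₁ hs) (mul_pos hα₂ hs) hδ₁.1 hδ₂.1 hJ1 hJ'1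
    (W := fun t u => mixedMod p β₁ β₂ t u f ^ s)
    (fun t t' ht u => ENNReal.rpow_le_rpow (mixedMod_mono ht le_rfl) hs.le)
    (fun t u u' hu => ENNReal.rpow_le_rpow (mixedMod_mono le_rfl hu) hs.le)
  simp only [← gw_mul_rpow hs.le] at h1
  have h2 := hC f hf δ₁ δ₂ J J' hδ₁.1 hδ₂.1 hJ2 hJ'2
  have h5 := ofReal_rpow_mul_ofReal_rpow_neg (α₁ := α₁) (α₂ := α₂) hs hδ₁.1 hδ₂.1
  set E := ENNReal.ofReal (δ₁ ^ (-(α₁ * s))) * ENNReal.ofReal (δ₂ ^ (-(α₂ * s)))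
  clear_value E
  have h3 : E * mixedMod p α₁ α₂ δ₁ δ₂ f ^ s ≤
      C * (ENNReal.ofReal (2 ^ (α₁ * s + 1)) * ENNReal.ofReal (2 ^ (α₂ * s + 1))) *
        dyadicInt (α₁ * s) (α₂ * s) δ₁ δ₂ fun t u => mixedMod p β₁ β₂ t u f ^ s := by
    refine (mul_le_mul_right h2 _).trans ?_
    rw [mul_left_comm, mul_assoc (C : ℝ≥0∞)]
    exact mul_le_mul_right h1 _
  have h4 := ENNReal.rpow_le_rpow h3 hs'
  rw [ENNReal.mul_rpow_of_nonneg _ _ hs', ENNReal.mul_rpow_of_nonneg _ _ hs', one_div s,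
    ENNReal.rpow_rpow_inv hs.ne', ← one_div] at h4
  rw [marchaudInt_eq hδ₁.1 hδ₂.1, mul_left_comm]
  refine le_trans (le_of_eq ?_) (mul_le_mul_right h4 _)
  rw [← mul_assoc, h5, one_mul]

end Marchaud

/-- Sharp Marchaud and sharp Jackson-type inequalities between mixed moduli of
different orders (Theorem 10.1). -/
theorem sharp_marchaud (p α₁ α₂ β₁ β₂ : ℝ) (hp : 1 < p)
    (hα₁ : 0 < α₁) (hα₂ : 0 < α₂) (hαβ₁ : α₁ < β₁) (hαβ₂ : α₂ < β₂) :
    ∃ C : ℝ, 0 < C ∧ ∀ (f : ℝ → ℝ → ℝ) (δ₁ δ₂ : ℝ), MemLp0 p f →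
      δ₁ ∈ Set.Ioo (0:ℝ) (1/2) → δ₂ ∈ Set.Ioo (0:ℝ) (1/2) →
      marchaudInt p α₁ α₂ β₁ β₂ δ₁ δ₂ (max 2 p) f ≤
          ENNReal.ofReal C * mixedMod p α₁ α₂ δ₁ δ₂ f ∧
      mixedMod p α₁ α₂ δ₁ δ₂ f ≤
          ENNReal.ofReal C * marchaudInt p α₁ α₂ β₁ β₂ δ₁ δ₂ (min 2 p) f := by
  obtain ⟨K₁, hK₁, h₁⟩ := exists_marchaudInt_le hp hα₁ hα₂ hαβ₁ hαβ₂
  obtain ⟨K₂, hK₂, h₂⟩ := exists_le_marchaudInt hp hα₁ hα₂ hαβ₁ hαβ₂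
  have ht : K₁ + K₂ + 1 ≠ ⊤ := by finiteness
  refine ⟨(K₁ + K₂ + 1).toReal, ENNReal.toReal_pos (by simp) ht, fun f δ₁ δ₂ hf hδ₁ hδ₂ => ?_⟩
  rw [ENNReal.ofReal_toReal ht]
  refine ⟨(h₁ f δ₁ δ₂ hf hδ₁.1 hδ₂.1).trans (mul_le_mul_left ?_ _),
    (h₂ f δ₁ δ₂ hf hδ₁ hδ₂).trans (mul_le_mul_left ?_ _)⟩
  · rw [add_assoc]; exact le_self_add
  · rw [add_right_comm]; exact le_add_self

end
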